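/- Let q = p^f where p is an odd prime with p different from 3. Then the weak normal covering number of PSp_6(q) is at least 3: for any two proper subgroups H and K of PSp_6(q) there exists an element g of PSp_6(q) such that phi(g) lies in neither H nor K for every automorphism phi of PSp_6(q). -/

import Mathlib

/-- The projective symplectic group `PSp_{2m}(F)`: the quotient of the symplectic group
`Sp_{2m}(F)` by its center. -/
abbrev ProjSp (m : ℕ) (F : Type*) [Field F] : Type _ :=
  ↥(Matrix.symplecticGroup (Fin m) F) ⧸
    Subgroup.center ↥(Matrix.symplecticGroup (Fin m) F)


open Module
set_option linter.unusedSectionVars false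
set_option linter.unusedVariables false
set_option linter.style.longLine false
set_option linter.unnecessarySimpa false
set_option linter.unusedSimpArgs false
namespace PSP
noncomputable section

section base
variable {F : Type*} {V : Type*} [Field F] [Fintype F] [AddCommGroup V] [Module F V] [FiniteDimensional F V]

class Sy (B : V →ₗ[F] V →ₗ[F] F) : Prop where
  alt : ∀ x, B x x = 0
  nd : ∀ x, (∀ y, B x y = 0) → x = 0
  two : (2:F) ≠ 0
  three : (3:F) ≠ 0
  fd : finrank F V = 6

def Sp (B : V →ₗ[F] V →ₗ[F] F) : Subgroup (V ≃ₗ[F] V) where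
  carrier := {g | ∀ x y, B (g x) (g y) = B x y}
  mul_mem' := by
    intro a b ha hb x y
    simp only [Set.mem_ofPred_eq] at ha hb
    simp [LinearEquiv.mul_apply, ha, hb]
  one_mem' := by intro x y; rfl
  inv_mem' := by
    intro a ha x y
    have := ha (a⁻¹ x) (a⁻¹ y)
    rw [← this, ← LinearEquiv.mul_apply, ← LinearEquiv.mul_apply]
    simp

variable (B : V →ₗ[F] V →ₗ[F] F)

variable {B}

theorem Bg (g : Sp B) (x y : V) : B (g • x) (g • y) = B x y := g.2 x y

theorem Bgi (g : Sp B) (x y : V) : B (g • x) y = B x (g⁻¹ • y) := by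
  rw [← Bg g x, smul_inv_smul]

theorem sp_ext {g h : Sp B} (H : ∀ x : V, g • x = h • x) : g = h :=
  Subtype.ext (LinearEquiv.ext H)

theorem gc (g : Sp B) (c : F) (x : V) : g • (c • x) = c • (g • x) := smul_comm g c x

variable [hS : Sy B]

theorem Bs (x y : V) : B x y = - B y x := by
  have := hS.alt (x + y)
  simp only [map_add, LinearMap.add_apply, hS.alt] at this
  linear_combination this

variable (B) in
def mkS (f : V →ₗ[F] V) (h : ∀ x y, B (f x) (f y) = B x y) : Sp B :=
  ⟨LinearEquiv.ofInjectiveEndo f (by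
    rw [← LinearMap.ker_eq_bot, LinearMap.ker_eq_bot']
    intro x hx
    apply hS.nd
    intro y
    rw [← h, hx]; simp), h⟩

@[simp] theorem mkS_smul (f : V →ₗ[F] V) (h) (x : V) : mkS B f h • x = f x := rfl

variable (B) in
def nu : Sp B := mkS B (-LinearMap.id) (by intro x y; simp)

@[simp] theorem nu_smul (x : V) : nu B • x = - x := rfl

theorem nu_comm (g : Sp B) : g * nu B = nu B * g := sp_ext (by intro x; simp [mul_smul])
theorem nu_sq : nu B * nu B = 1 := sp_ext (by intro x; simp [mul_smul])

theorem ex_ne (B : V →ₗ[F] V →ₗ[F] F) [hS : Sy B] : ∃ x : V, x ≠ 0 := by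
  have : 0 < finrank F V := by rw [hS.fd]; norm_num
  have := Module.finrank_pos_iff (R := F) (M := V) |>.1 this
  exact exists_ne 0

theorem eq_zero_of_neg (B : V →ₗ[F] V →ₗ[F] F) [hS : Sy B] {x : V} (h : x = - x) : x = 0 := by
  have : (2:F) • x = 0 := by rw [two_smul]; nth_rewrite 1 [h]; simp
  exact (smul_eq_zero.1 this).resolve_left hS.two

theorem nu_ne : nu B ≠ 1 := by
  intro h
  obtain ⟨x, hx⟩ := ex_ne B
  apply hx
  have := congrArg (fun g : Sp B => g • x) h
  simp at this
  exact eq_zero_of_neg B (by simpa using this.symm)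

variable (B) in
def t (v : V) (a : F) : Sp B :=
  mkS B (LinearMap.id + (a • (B.flip v)).smulRight v) (by
    intro x y
    simp [hS.alt]
    rw [Bs v y]; ring)

@[simp] theorem t_smul (v : V) (a : F) (x : V) : t B v a • x = x + (a * B x v) • v := rfl

variable (B) in
open Classical in
def z (e f : V) : Sp B := if h : B e f = 1 then
  mkS B (LinearMap.id - (2:F) • ((B.flip f).smulRight e - (B.flip e).smulRight f)) (by
    intro x y
    have h2 : B f e = -1 := by rw [Bs, h]
    simp [hS.alt, h, h2]
    rw [Bs e y, Bs f y]; ring) else 1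

theorem z_smul {e f : V} (h : B e f = 1) (x : V) :
    z B e f • x = x - (2:F) • (B x f • e - B x e • f) := by
  rw [z, dif_pos h]; simp

theorem nd' {x : V} (h : x ≠ 0) : ∃ y, B x y = 1 := by
  by_contra! hc
  apply h
  apply hS.nd
  intro y
  by_contra hy
  apply hc ((B x y)⁻¹ • y)
  simp [hy]

theorem t_mul (v : V) (a b : F) : t B v a * t B v b = t B v (a + b) :=
  sp_ext (by intro x; simp [mul_smul, hS.alt]; module)

theorem t_zero (v : V) : t B v 0 = 1 := sp_ext (by intro x; simp)
theorem t_zero' (a : F) : t B 0 a = 1 := sp_ext (by intro x; simp)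

theorem t_inv (v : V) (a : F) : (t B v a)⁻¹ = t B v (-a) := by
  rw [inv_eq_iff_mul_eq_one, t_mul]; simp [t_zero]

theorem t_pow (v : V) (a : F) (n : ℕ) : (t B v a)^n = t B v (n * a) := by
  induction n with
  | zero => simp [t_zero]
  | succ k ih => rw [pow_succ, ih, t_mul]; congr 1; push_cast; ring

theorem t_conj (h : Sp B) (v : V) (a : F) : h * t B v a * h⁻¹ = t B (h • v) a :=
  sp_ext (by
    intro x
    simp only [mul_smul, t_smul, smul_add, gc, smul_inv_smul]
    rw [Bgi h⁻¹ x v, inv_inv])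

theorem t_conj' (h : Sp B) (v : V) (a : F) : h * t B v a = t B (h • v) a * h := by
  rw [← t_conj]; group

theorem t_smul_v (v : V) (c a : F) : t B (c • v) a = t B v (c^2 * a) :=
  sp_ext (by intro x; simp [smul_smul]; congr 1; ring)

theorem t_eq_one {v : V} {a : F} (hv : v ≠ 0) (h : t B v a = 1) : a = 0 := by
  obtain ⟨y, hy⟩ := nd' (B := B) hv
  have := congrArg (fun g : Sp B => g • y) h
  simp [Bs y v, hy] at this
  tauto

theorem t_eq {v w : V} {a b : F} (hv : v ≠ 0) (ha : a ≠ 0) (h : t B v a = t B w b) :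
    ∃ c : F, c ≠ 0 ∧ w = c • v := by
  obtain ⟨y, hy⟩ := nd' (B := B) hv
  have := congrArg (fun g : Sp B => g • y) h
  simp [Bs y v, hy] at this
  -- -(a • v) = (b * B y w) • w
  have h0 : b * B y w ≠ 0 := by
    intro h0
    rw [h0] at this; simp at this; tauto
  refine ⟨(b * B y w)⁻¹ * (-a), mul_ne_zero (inv_ne_zero h0) (neg_ne_zero.2 ha), ?_⟩
  rw [mul_smul, neg_smul, this, smul_smul, inv_mul_cancel₀ h0, one_smul]

theorem z_conj (h : Sp B) {e f : V} (hef : B e f = 1) : h * z B e f * h⁻¹ = z B (h • e) (h • f) :=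
  sp_ext (by
    intro x
    have : B (h • e) (h • f) = 1 := by rw [Bg, hef]
    rw [z_smul this, mul_smul, mul_smul, z_smul hef]
    simp only [smul_sub, gc, smul_inv_smul]
    rw [Bgi h⁻¹ x f, Bgi h⁻¹ x e, inv_inv])

theorem Bfe {e f : V} (hef : B e f = 1) : B f e = -1 := by rw [Bs, hef]

theorem z_sq {e f : V} (hef : B e f = 1) : z B e f * z B e f = 1 :=
  sp_ext (by
    intro x
    rw [mul_smul, z_smul hef, z_smul hef]
    simp [hS.alt, hef, Bfe hef]
    module)

/-- W = span e f, membership form -/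
def InW (B : V →ₗ[F] V →ₗ[F] F) (e f x : V) : Prop := x = B x f • e - B x e • f

theorem z_neg_iff {e f : V} (hef : B e f = 1) (x : V) : z B e f • x = - x ↔ InW B e f x := by
  rw [z_smul hef, InW]
  have h2 := hS.two
  constructor
  · intro h
    have : (2:F) • x = (2:F) • (B x f • e - B x e • f) := by
      rw [two_smul F x]
      rw [sub_eq_iff_eq_add] at h
      nth_rewrite 1 [h]; abel
    exact smul_right_injective _ h2 this
  · intro h
    rw [← h]; rw [two_smul]; abel

theorem z_fix_iff {e f : V} (hef : B e f = 1) (x : V) :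
    z B e f • x = x ↔ B x e = 0 ∧ B x f = 0 := by
  rw [z_smul hef, sub_eq_self, smul_eq_zero_iff_right hS.two]
  constructor
  · intro h
    have h1 := congrArg (B e) h
    have h2 := congrArg (B f) h
    simp [hS.alt, hef, Bfe hef] at h1 h2
    exact ⟨h1, h2⟩
  · rintro ⟨h1, h2⟩; simp [h1, h2]

theorem InW_e {e f : V} (hef : B e f = 1) : InW B e f e := by simp [InW, hef, hS.alt]
theorem InW_f {e f : V} (hef : B e f = 1) : InW B e f f := by simp [InW, Bfe hef, hS.alt]

/-- decomposition -/
theorem z_dec {e f : V} (hef : B e f = 1) (x : V) : ∃ w u, x = w + u ∧ z B e f • w = - w ∧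
    z B e f • u = u := by
  refine ⟨B x f • e - B x e • f, x - (B x f • e - B x e • f), by abel, ?_, ?_⟩
  · rw [z_smul hef]; simp [hS.alt, hef, Bfe hef]; module
  · rw [z_smul hef]; simp [hS.alt, hef, Bfe hef]

theorem W_dep {e f x y : V} (hx : InW B e f x) (hy : InW B e f y) (h0 : x ≠ 0)
    (h : B x y = 0) : ∃ c : F, y = c • x := by
  have h1 := hx
  have h2 := hy
  unfold InW at h1 h2
  have h3 : B x f * B y e = B x e * B y f := by
    have := h
    rw [h1] at this
    simp at this
    rw [Bs e y, Bs f y] at this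
    linear_combination -this
  generalize B x f = α at *
  generalize B x e = β at *
  generalize B y f = γ at *
  generalize B y e = δ at *
  by_cases hxe : β = 0
  · by_cases hxf : α = 0
    · rw [hxe, hxf] at h1; simp at h1; tauto
    · refine ⟨γ / α, ?_⟩
      have h4 : δ = 0 := by
        rw [hxe] at h3; simp at h3; tauto
      rw [h1, h2, hxe, h4, smul_sub, smul_smul, div_mul_cancel₀ _ hxf]; simp
  · refine ⟨δ / β, ?_⟩
    have h5 : γ = δ / β * α := by field_simp; linear_combination -h3
    rw [h1, h2, h5, smul_sub, smul_smul, smul_smul, div_mul_cancel₀ _ hxe]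

end base
end
end PSP

open Module
set_option linter.unusedSectionVars false
set_option linter.unusedVariables false
set_option linter.style.longLine false
set_option linter.unnecessarySimpa false
set_option linter.unusedSimpArgs false
namespace PSP
noncomputable section
section base
variable {F : Type*} {V : Type*} [Field F] [Fintype F] [AddCommGroup V] [Module F V] [FiniteDimensional F V]
variable {B : V →ₗ[F] V →ₗ[F] F}
variable [hS : Sy B]

def Fx (g : Sp B) : Submodule F V where
  carrier := {x | g • x = x}
  add_mem' := by intro a b ha hb; simp only [Set.mem_ofPred_eq] at *; rw [smul_add, ha, hb]
  zero_mem' := smul_zero g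
  smul_mem' := by intro c x hx; simp only [Set.mem_ofPred_eq] at *; rw [gc, hx]

theorem mem_Fx {g : Sp B} {x : V} : x ∈ Fx g ↔ g • x = x := Iff.rfl

def Inv (g : Sp B) (M : Submodule F V) : Prop := ∀ x ∈ M, g • x ∈ M

theorem Inv.pow {g : Sp B} {M : Submodule F V} (h : Inv g M) (n : ℕ) : Inv (g^n) M := by
  induction n with
  | zero => intro x hx; simpa using hx
  | succ k ih => intro x hx; rw [pow_succ, mul_smul]; exact ih _ (h _ hx)

theorem Inv.inf {g : Sp B} {M N : Submodule F V} (h : Inv g M) (h' : Inv g N) : Inv g (M ⊓ N) :=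
  fun x hx => ⟨h x hx.1, h' x hx.2⟩

theorem Inv_Fx {g h : Sp B} (c : g * h = h * g) : Inv g (Fx h) := by
  intro x hx
  rw [mem_Fx] at *
  rw [← mul_smul, ← c, mul_smul, hx]

theorem Inv.inv {g : Sp B} {M : Submodule F V} (h : Inv g M) : Inv g⁻¹ M := by
  have : Finite (V ≃ₗ[F] V) := by
    have : Finite V := Module.finite_of_finite F
    exact DFunLike.finite _
  have h1 : g⁻¹ = g ^ (orderOf g - 1) := by
    rw [inv_eq_iff_mul_eq_one, ← pow_succ']
    rw [Nat.sub_add_cancel (orderOf_pos g), pow_orderOf_eq_one]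
  rw [h1]; exact h.pow _

instance : Finite (Sp B) := by
  have : Finite V := Module.finite_of_finite F
  have : Finite (V ≃ₗ[F] V) := DFunLike.finite _
  infer_instance

theorem card_sub (M : Submodule F V) : Nat.card M = Fintype.card F ^ finrank F M := by
  rw [Module.natCard_eq_pow_finrank (K := F), Nat.card_eq_fintype_card]

theorem CNT {g : Sp B} {M : Submodule F V} (hM : Inv g M) {r : ℕ} (hr : r.Prime)
    (h : ∀ x ∈ M, g^r • x = x) :
    Fintype.card F ^ finrank F M ≡ Fintype.card F ^ finrank F (M ⊓ Fx g : Submodule F V) [MOD r] := by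
  have : Fact r.Prime := ⟨hr⟩
  have : Finite V := Module.finite_of_finite F
  have : Fintype M := Fintype.ofFinite _
  let φ : Function.End M := fun x => ⟨g • x.1, hM x.1 x.2⟩
  have hφ : ∀ n, ∀ x : M, ((φ^n) x).1 = g^n • x.1 := by
    intro n
    induction n with
    | zero => intro x; simp; rfl
    | succ k ih =>
      intro x
      rw [pow_succ, pow_succ, mul_smul, ← show ((φ x).1 : V) = g • x.1 from rfl, ← ih]; rfl
  have h1 : φ^(r^1) = 1 := by
    funext x
    apply Subtype.ext
    rw [hφ, pow_one, h _ x.2]; rfl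
  classical
  have := Equiv.Perm.card_fixedPoints_modEq (f := φ) h1
  rw [← Nat.card_eq_fintype_card, ← Nat.card_eq_fintype_card (α := φ.fixedPoints), card_sub] at this
  have e : Nat.card (Function.fixedPoints φ) = Nat.card (M ⊓ Fx g : Submodule F V) := by
    apply Nat.card_congr
    refine ⟨fun x => ⟨x.1.1, x.1.2, ?_⟩, fun x => ⟨⟨x.1, x.2.1⟩, ?_⟩, fun x => rfl, fun x => rfl⟩
    · have := x.2; exact congrArg Subtype.val this
    · apply Subtype.ext; exact x.2.2
  rw [e, card_sub] at this
  exact this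

theorem AVG {g : Sp B} {n : ℕ} (hg : g^n = 1) (hn : (n:F) ≠ 0) {y : V} (hy : g • y = y)
    (h : ∀ w, g • w = w → B y w = 0) : y = 0 := by
  apply hS.nd
  intro v
  have hn0 : n ≠ 0 := by rintro rfl; simp at hn
  have h1 : g • (∑ i ∈ Finset.range n, g^i • v) = ∑ i ∈ Finset.range n, g^i • v := by
    rw [Finset.smul_sum]
    simp only [← mul_smul, ← pow_succ']
    have := Finset.sum_range_succ (fun i => g^i • v) n
    rw [Finset.sum_range_succ' (fun i => g^i • v) n] at this
    simp [hg] at this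
    exact this
  have h2 := h _ h1
  rw [map_sum] at h2
  have h3 : ∀ i, B y (g^i • v) = B y v := by
    intro i
    induction i with
    | zero => simp
    | succ k ih =>
      rw [pow_succ', mul_smul]; nth_rewrite 1 [← hy]; rw [Bg, ih]
  simp only [h3, Finset.sum_const, Finset.card_range, nsmul_eq_mul] at h2
  exact (mul_eq_zero.1 h2).resolve_left hn

/-- plane submodule and its perp -/
def Wm (B : V →ₗ[F] V →ₗ[F] F) (e f : V) : Submodule F V where
  carrier := {x | InW B e f x}
  add_mem' := by
    intro a b ha hb; simp only [Set.mem_ofPred_eq, InW] at *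
    simp only [map_add, LinearMap.add_apply]
    nth_rewrite 1 [ha, hb]; module
  zero_mem' := by simp [InW]
  smul_mem' := by
    intro c x hx; simp only [Set.mem_ofPred_eq, InW] at *
    simp only [map_smul, LinearMap.smul_apply]
    nth_rewrite 1 [hx]; simp; module

theorem mem_Wm {e f x : V} : x ∈ Wm B e f ↔ InW B e f x := Iff.rfl

def Wp (B : V →ₗ[F] V →ₗ[F] F) (e f : V) : Submodule F V :=
  LinearMap.ker ((B.flip e).prod (B.flip f))

theorem mem_Wp {e f x : V} : x ∈ Wp B e f ↔ B x e = 0 ∧ B x f = 0 := by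
  simp [Wp, LinearMap.mem_ker]

theorem W_compl {e f : V} (hef : B e f = 1) : IsCompl (Wm B e f) (Wp B e f) := by
  rw [isCompl_iff, Submodule.disjoint_def, codisjoint_iff, eq_top_iff]
  constructor
  · intro x h1 h2
    rw [mem_Wp] at h2
    rw [mem_Wm, InW, h2.1, h2.2] at h1
    simpa using h1
  · intro x _
    obtain ⟨w, u, h, h1, h2⟩ := z_dec hef x
    rw [h]
    exact Submodule.add_mem_sup ((z_neg_iff hef w).1 h1) (mem_Wp.2 ((z_fix_iff hef u).1 h2))

theorem W_perp {e f x y : V} (hx : x ∈ Wm B e f) (hy : y ∈ Wp B e f) : B x y = 0 := by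
  rw [mem_Wp] at hy
  rw [mem_Wm, InW] at hx
  rw [hx]; simp
  rw [Bs f y, Bs e y, hy.1, hy.2]; simp

theorem finrank_Wp {e f : V} (hef : B e f = 1) : finrank F (Wp B e f) = 4 := by
  have h := LinearMap.finrank_range_add_finrank_ker ((B.flip e).prod (B.flip f))
  have h1 : LinearMap.range ((B.flip e).prod (B.flip f)) = ⊤ := by
    rw [LinearMap.range_eq_top]
    rintro ⟨a, b⟩
    refine ⟨b • e - a • f, ?_⟩
    simp [hS.alt, hef, Bfe hef]
  rw [h1, finrank_top, hS.fd] at h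
  simp at h
  unfold Wp; omega

theorem finrank_Wm {e f : V} (hef : B e f = 1) : finrank F (Wm B e f) = 2 := by
  have := Submodule.finrank_add_eq_of_isCompl (W_compl hef)
  rw [finrank_Wp hef, hS.fd] at this; omega

theorem ODD {M : Submodule F V} (hd : ∀ x ∈ M, (∀ y ∈ M, B x y = 0) → x = 0) : finrank F M ≠ 3 := by
  intro h3
  have : M ≠ ⊥ := by rintro rfl; simp at h3
  obtain ⟨e, he, he0⟩ := Submodule.exists_mem_ne_zero_of_ne_bot this
  have : ∃ f ∈ M, B e f = 1 := by
    by_contra! hc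
    apply he0
    apply hd e he
    intro y hy
    by_contra hy0
    apply hc ((B e y)⁻¹ • y) (M.smul_mem _ hy)
    simp [hy0]
  obtain ⟨f, hf, hef⟩ := this
  have hW : Wm B e f ≤ M := by
    intro x hx
    rw [mem_Wm, InW] at hx; rw [hx]
    exact M.sub_mem (M.smul_mem _ he) (M.smul_mem _ hf)
  have h1 : M ⊓ Wp B e f ≠ ⊥ := by
    intro h0
    have h4 : M ≤ Wm B e f := by
      intro x hx
      obtain ⟨w, u, h, h1, h2⟩ := z_dec hef x
      have hw := (z_neg_iff hef w).1 h1
      have hu := mem_Wp.2 ((z_fix_iff hef u).1 h2)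
      have : u ∈ M ⊓ Wp B e f := by
        refine ⟨?_, hu⟩
        have : u = x - w := by rw [h]; abel
        rw [this]; exact M.sub_mem hx (hW hw)
      rw [h0, Submodule.mem_bot] at this
      rw [h, this, add_zero]; exact hw
    have := Submodule.finrank_mono h4
    rw [finrank_Wm hef] at this; omega
  obtain ⟨u, hu, hu0⟩ := Submodule.exists_mem_ne_zero_of_ne_bot h1
  obtain ⟨u', hu', huu'⟩ : ∃ u' ∈ M, B u u' ≠ 0 := by
    by_contra! hc
    exact hu0 (hd u hu.1 hc)
  -- M ⊓ Wp has dim 1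
  have h5 : finrank F (M ⊓ Wp B e f : Submodule F V) ≤ 1 := by
    have h6 := Submodule.finrank_sup_add_finrank_inf_eq (Wm B e f) (M ⊓ Wp B e f)
    have h7 : Wm B e f ⊓ (M ⊓ Wp B e f) = ⊥ := by
      rw [eq_bot_iff]; intro x hx
      have := (W_compl hef).1.le_bot (show x ∈ Wm B e f ⊓ Wp B e f from ⟨hx.1, hx.2.2⟩)
      exact this
    have h8 : Wm B e f ⊔ (M ⊓ Wp B e f) ≤ M := sup_le hW inf_le_left
    have := Submodule.finrank_mono h8
    rw [h7, finrank_Wm hef] at h6; simp at h6; omega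
  obtain ⟨w, k, h, h1, h2⟩ := z_dec hef u'
  have hw := (z_neg_iff hef w).1 h1
  have hk := mem_Wp.2 ((z_fix_iff hef k).1 h2)
  have hkM : k ∈ M ⊓ Wp B e f := by
    refine ⟨?_, hk⟩
    have : k = u' - w := by rw [h]; abel
    rw [this]; exact M.sub_mem hu' (hW hw)
  rw [finrank_le_one_iff] at h5
  obtain ⟨b, hb⟩ := h5
  obtain ⟨c, hc⟩ := hb ⟨u, hu⟩
  obtain ⟨d, hd'⟩ := hb ⟨k, hkM⟩
  have hc := congrArg Subtype.val hc
  have hd' := congrArg Subtype.val hd'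
  simp at hc hd'
  apply huu'
  rw [h, map_add, Bs u w, W_perp hw hu.2, ← hc, ← hd']
  simp [hS.alt]

end base
end
end PSP

open Module
set_option linter.unusedSectionVars false
set_option linter.unusedVariables false
set_option linter.style.longLine false
set_option linter.unnecessarySimpa false
set_option linter.unusedSimpArgs false
namespace PSP
noncomputable section
section base
variable {F : Type*} {V : Type*} [Field F] [Fintype F] [AddCommGroup V] [Module F V] [FiniteDimensional F V]
variable {B : V →ₗ[F] V →ₗ[F] F}
variable [hS : Sy B]

local notation "q" => Fintype.card F

theorem qF : ((q : ℕ) : F) = 0 := by simp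

theorem q_prime {r : ℕ} (hr : r.Prime) (h : r ∣ q) : (r:F) = 0 := by
  obtain ⟨p, hp⟩ := CharP.exists F
  obtain ⟨n, hp1, hn⟩ := FiniteField.card F p
  rw [hn] at h
  have := (Nat.prime_dvd_prime_iff_eq hr hp1).1 (hr.dvd_of_dvd_pow h)
  rw [this]; simp

theorem q_odd (B : V →ₗ[F] V →ₗ[F] F) [hS : Sy B] : q % 2 = 1 := by
  by_contra h
  have : 2 ∣ q := by omega
  exact hS.two (by exact_mod_cast q_prime Nat.prime_two this)

theorem q_three (B : V →ₗ[F] V →ₗ[F] F) [hS : Sy B] : q % 3 ≠ 0 := by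
  intro h
  have : 3 ∣ q := by omega
  exact hS.three (by exact_mod_cast q_prime Nat.prime_three this)

theorem q_five (B : V →ₗ[F] V →ₗ[F] F) [hS : Sy B] : 5 ≤ q := by
  have h1 := q_odd B
  have h2 := q_three B
  have h3 : 1 < q := Fintype.one_lt_card
  by_contra h
  interval_cases h : q <;> omega

theorem ne_of_dvd {n r : ℕ} (hn : (n:F) ≠ 0) (h : r ∣ n) : (r:F) ≠ 0 := by
  obtain ⟨k, rfl⟩ := h
  push_cast at hn
  exact left_ne_zero_of_mul hn

structure IsS (s : Sp B) (e f : V) : Prop where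
  hef : B e f = 1
  se : s • e = e
  sf : s • f = f
  inv : ∀ M, Inv s M → M ≤ Wm B e f ∨ Wp B e f ≤ M
  ford : 2 * orderOf s = q^2 + 1

theorem IsS.fixW {s : Sp B} {e f : V} (h : IsS s e f) {x : V} (hx : x ∈ Wm B e f) : s • x = x := by
  rw [mem_Wm, InW] at hx
  rw [hx, smul_sub, gc, gc, h.se, h.sf]

theorem fix_pow {s : Sp B} {x : V} (h : s • x = x) (k : ℕ) : s ^ k • x = x := by
  induction k with
  | zero => simp
  | succ k ih => rw [pow_succ, mul_smul, h, ih]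

theorem eq_one_of {s : Sp B} {e f : V} (hef : B e f = 1) (h1 : Wm B e f ≤ Fx s) (h2 : Wp B e f ≤ Fx s) :
    s = 1 := by
  apply sp_ext
  intro x
  have : x ∈ Wm B e f ⊔ Wp B e f := by rw [(W_compl hef).sup_eq_top]; trivial
  have := (sup_le h1 h2) this
  rw [mem_Fx] at this
  rw [this, one_smul]

theorem IsS.fixpow {s : Sp B} {e f : V} (h : IsS s e f) {k : ℕ} (hk : s^k ≠ 1) {x : V}
    (hx : s^k • x = x) : x ∈ Wm B e f := by
  have h1 : Inv s (Fx (s^k)) := Inv_Fx (by rw [← pow_succ, ← pow_succ'])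
  rcases h.inv _ h1 with h2 | h2
  · exact h2 hx
  · exfalso; apply hk
    apply eq_one_of h.hef _ h2
    intro y hy
    exact fix_pow (h.fixW hy) k

/-- power congruences -/
theorem mod4 {u : ℕ} {r : ℕ} (hr : r.Prime) (hr2 : r ≠ 2) (h : r ∣ u^2+1) {a b : ℕ}
    (ha : a ≤ 6) (hb : b ≤ 6) (hab : u^a ≡ u^b [MOD r]) : a % 4 = b % 4 := by
  have : Fact r.Prime := ⟨hr⟩
  rw [← ZMod.natCast_eq_natCast_iff] at hab
  rw [← ZMod.natCast_eq_zero_iff] at h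
  push_cast at hab h
  generalize (u : ZMod r) = x at *
  have h2 : (2 : ZMod r) ≠ 0 := by
    intro h; have : ((2:ℕ) : ZMod r) = 0 := by exact_mod_cast h
    rw [ZMod.natCast_eq_zero_iff] at this
    exact hr2 ((Nat.prime_dvd_prime_iff_eq hr Nat.prime_two).1 this)
  have e2 : x^2 = -1 := by linear_combination h
  have e3 : x^3 = -x := by linear_combination x * h
  have e4 : x^4 = 1 := by linear_combination (x^2-1)*h
  have e5 : x^5 = x := by linear_combination (x^3-x)*h
  have e6 : x^6 = -1 := by linear_combination (x^4-x^2+1)*h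
  have n1 : x ≠ 1 := by rintro rfl; apply h2; linear_combination h
  have n2 : x ≠ -1 := by rintro rfl; apply h2; linear_combination h
  have n3 : (1 : ZMod r) ≠ -1 := by intro h'; apply h2; linear_combination h'
  have n4 : x ≠ 0 := by rintro rfl; simp at h
  have n5 : x ≠ -x := by intro h'; apply n4; have : 2 * x = 0 := by linear_combination h'
                         exact (mul_eq_zero.1 this).resolve_left h2
  interval_cases a <;> interval_cases b <;>
    simp only [pow_zero, pow_one, e2, e3, e4, e5, e6] at hab <;> first | rfl | (exfalso; grind)

theorem exS {s : Sp B} (hs : 2 * orderOf s = q^2 + 1) : ∃ e f, IsS s e f := by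
  have hq := q_five B
  have hodd := q_odd B
  set m := orderOf s with hm
  have hm1 : m ≠ 1 := by rintro h; rw [h] at hs; nlinarith
  obtain ⟨r, hr, hrm⟩ := Nat.exists_prime_and_dvd hm1
  have hmodd : m % 2 = 1 := by
    obtain ⟨k, hk⟩ : ∃ k, q = 2*k+1 := ⟨q/2, by omega⟩
    rw [hk] at hs
    have : m = 2 * (k^2 + k) + 1 := by nlinarith
    omega
  have hP : ∀ r, r.Prime → r ∣ m → r ≠ 2 ∧ r ∣ q^2+1 := by
    intro r hr hrm
    refine ⟨?_, hs ▸ Dvd.dvd.mul_left hrm 2⟩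
    rintro rfl; omega
  obtain ⟨hr2, hrq⟩ := hP r hr hrm
  have hmF : ((q^2+1 : ℕ) : F) ≠ 0 := by push_cast; rw [qF]; simp
  have hrF := ne_of_dvd hmF hrq
  set x := s^(m/r) with hx
  have hxr : x^r = 1 := by rw [hx, ← pow_mul, Nat.div_mul_cancel hrm, pow_orderOf_eq_one]
  have hx1 : x ≠ 1 := by
    rw [hx]; apply pow_ne_one_of_lt_orderOf
    · have := Nat.div_pos (Nat.le_of_dvd (by omega) hrm) hr.pos; omega
    · exact Nat.div_lt_self (by omega) hr.one_lt
  have hsx : s * x = x * s := by rw [hx, ← pow_succ, ← pow_succ']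
  have hcnt : ∀ M, Inv x M → finrank F M % 4 = finrank F (M ⊓ Fx x : Submodule F V) % 4 := by
    intro M hM
    have l1 := Submodule.finrank_le M
    have l2 := Submodule.finrank_le (M ⊓ Fx x)
    rw [hS.fd] at l1 l2
    exact mod4 hr hr2 hrq l1 l2 (CNT hM hr (by intro y _; rw [hxr, one_smul]))
  have hfix : finrank F (Fx x) = 2 := by
    have := hcnt ⊤ (fun _ _ => trivial)
    rw [finrank_top, hS.fd, top_inf_eq] at this
    have l2 := Submodule.finrank_le (Fx x)
    rw [hS.fd] at l2
    have : finrank F (Fx x) ≠ 6 := by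
      intro h6
      rw [← hS.fd] at h6
      have := Submodule.eq_top_of_finrank_eq h6
      apply hx1; apply sp_ext; intro y
      have hy : y ∈ Fx x := by rw [this]; trivial
      rw [one_smul]; exact hy
    omega
  have : Fx x ≠ ⊥ := by intro h; rw [h] at hfix; simp at hfix
  obtain ⟨e, he, he0⟩ := Submodule.exists_mem_ne_zero_of_ne_bot this
  obtain ⟨f, hf, hef⟩ : ∃ f ∈ Fx x, B e f = 1 := by
    by_contra! hc
    apply he0
    apply AVG hxr hrF he
    intro y hy
    by_contra hy0
    apply hc ((B e y)⁻¹ • y) ((Fx x).smul_mem _ hy)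
    simp [hy0]
  have hW : Wm B e f ≤ Fx x := by
    intro x hx
    rw [mem_Wm, InW] at hx; rw [hx]
    exact Submodule.sub_mem _ (Submodule.smul_mem _ _ he) (Submodule.smul_mem _ _ hf)
  have hWe : Wm B e f = Fx x := Submodule.eq_of_le_of_finrank_eq hW (by rw [hfix, finrank_Wm hef])
  have hsW : Inv s (Wm B e f) := by rw [hWe]; exact Inv_Fx hsx
  have triv : ∀ n, n ∣ m → n ≠ 0 → Wm B e f ≤ Fx (s^n) → Wm B e f ≤ Fx s := by
    intro n
    induction n using Nat.strong_induction_on with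
    | _ n ih =>
      intro hnm hn0 hn
      by_cases h1 : n = 1
      · rwa [h1, pow_one] at hn
      obtain ⟨l, hl, hln⟩ := Nat.exists_prime_and_dvd h1
      obtain ⟨hl2, hlq⟩ := hP l hl (hln.trans hnm)
      apply ih (n / l) (Nat.div_lt_self (by omega) hl.one_lt) ((Nat.div_dvd_of_dvd hln).trans hnm)
        (by have := Nat.div_pos (Nat.le_of_dvd (by omega) hln) hl.pos; omega)
      have l2 := Submodule.finrank_mono (inf_le_left : Wm B e f ⊓ Fx (s^(n/l)) ≤ _)
      rw [finrank_Wm hef] at l2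
      have := mod4 hl hl2 hlq (by rw [finrank_Wm hef]; norm_num) (by omega) (CNT (hsW.pow (n/l)) hl (by
        intro y hy; rw [← pow_mul, Nat.div_mul_cancel hln]; exact hn hy))
      rw [finrank_Wm hef] at this
      have : Wm B e f ⊓ Fx (s^(n/l)) = Wm B e f :=
        Submodule.eq_of_le_of_finrank_eq inf_le_left (by rw [finrank_Wm hef]; omega)
      exact inf_eq_left.1 this
  have hs1 := triv m dvd_rfl (by omega) (by rw [hm, pow_orderOf_eq_one]; intro y _; exact one_smul _ y)
  have hse : s • e = e := hs1 (InW_e hef)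
  have hsf : s • f = f := hs1 (InW_f hef)
  have hsP : Inv s (Wp B e f) := by
    intro y hy
    rw [mem_Wp] at *
    have h1 := Bg s y e
    have h2 := Bg s y f
    rw [hse] at h1
    rw [hsf] at h2
    rwa [h1, h2]
  refine ⟨e, f, hef, hse, hsf, ?_, hs⟩
  intro M hM
  have a1 := hcnt _ ((hM.inf hsP).pow (m/r))
  have a2 : M ⊓ Wp B e f ⊓ Fx x = ⊥ := by
    rw [← hWe, inf_assoc, (W_compl hef).symm.inf_eq_bot, inf_bot_eq]
  rw [a2, finrank_bot] at a1
  have a3 := Submodule.finrank_mono (inf_le_right : M ⊓ Wp B e f ≤ _)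
  rw [finrank_Wp hef] at a3
  have a4 := Submodule.finrank_sup_add_finrank_inf_eq M (Wp B e f)
  have a5 := Submodule.finrank_le (M ⊔ Wp B e f)
  rw [finrank_Wp hef] at a4
  rw [hS.fd] at a5
  by_cases h4 : finrank F (M ⊓ Wp B e f : Submodule F V) = 4
  · right
    exact inf_eq_right.1 (Submodule.eq_of_le_of_finrank_eq inf_le_right (by rw [h4, finrank_Wp hef]))
  · left
    have a6 := hcnt _ (hM.pow (m/r))
    have a7 := Submodule.finrank_mono (inf_le_left : M ⊓ Fx x ≤ _)
    rw [hWe]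
    exact inf_eq_left.1 (Submodule.eq_of_le_of_finrank_eq inf_le_left (by omega))

end base
end
end PSP

open Module
set_option linter.unusedSectionVars false
set_option linter.unusedVariables false
set_option linter.style.longLine false
set_option linter.unnecessarySimpa false
set_option linter.unusedSimpArgs false
namespace PSP
noncomputable section
section base
variable {F : Type*} {V : Type*} [Field F] [Fintype F] [AddCommGroup V] [Module F V] [FiniteDimensional F V]
variable {B : V →ₗ[F] V →ₗ[F] F}
variable [hS : Sy B]

local notation "q" => Fintype.card F

theorem prime5 {n : ℕ} (h2 : n % 2 = 1) (h9 : n % 9 ≠ 0) (h3 : 3 < n) : ∃ r, r.Prime ∧ 5 ≤ r ∧ r ∣ n := by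
  have key : ∀ k, k ∣ n → k ≠ 1 → k % 3 ≠ 0 → ∃ r, r.Prime ∧ 5 ≤ r ∧ r ∣ n := by
    intro k hk h1 hk3
    obtain ⟨r, hr, hrk⟩ := Nat.exists_prime_and_dvd h1
    refine ⟨r, hr, ?_, hrk.trans hk⟩
    by_contra hlt
    have := hr.two_le
    have hrn := hrk.trans hk
    interval_cases r
    · omega
    · omega
    · revert hr; decide
  by_cases h : n % 3 = 0
  · apply key (n/3) (Nat.div_dvd_of_dvd (by omega)) (by omega) (by omega)
  · exact key n dvd_rfl (by omega) h

def PO (a : Sp B) (N : ℕ) : Prop := ∀ k, (a^k = 1 ∨ a^k = nu B) ↔ N ∣ k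

theorem nu_pow (k : ℕ) : (nu B)^(2*k) = 1 := by rw [pow_mul, pow_two, nu_sq, one_pow]

theorem PO.two {a : Sp B} {N : ℕ} (h : PO a N) : a^(2*N) = 1 := by
  rcases (h N).2 dvd_rfl with h | h
  · rw [mul_comm, pow_mul, h, one_pow]
  · rw [mul_comm, pow_mul, h, pow_two, nu_sq]

theorem PO_r {a : Sp B} {N r : ℕ} (hN : N ≠ 0) (h : PO a N) (hr : 5 ≤ r) (hrN : r ∣ N) :
    ∃ i, (a^i)^r = 1 ∧ a^i ≠ 1 := by
  refine ⟨2*(N/r), ?_, ?_⟩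
  · rw [← pow_mul, mul_assoc, Nat.div_mul_cancel hrN, h.two]
  · intro h1
    have h2 := Nat.le_of_dvd ?_ ((h _).1 (Or.inl h1))
    · obtain ⟨k, rfl⟩ := hrN
      rw [Nat.mul_div_cancel_left _ (by omega)] at h2
      have : 0 < k := Nat.pos_of_ne_zero (by rintro rfl; simp at hN)
      nlinarith
    · have := Nat.div_pos (Nat.le_of_dvd (Nat.pos_of_ne_zero hN) hrN) (by omega)
      omega

theorem modA {u r : ℕ} (hr : r.Prime) (hr5 : 5 ≤ r) {n : ℕ} (hn : n + u = u^2 + 1) (h : r ∣ n) {a : ℕ}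
    (ha : a ≤ 6) (hab : u^a ≡ 1 [MOD r]) : a = 0 ∨ a = 6 := by
  have : Fact r.Prime := ⟨hr⟩
  have hn' := congrArg (Nat.cast (R := ZMod r)) hn
  rw [← ZMod.natCast_eq_natCast_iff] at hab
  rw [← ZMod.natCast_eq_zero_iff] at h
  push_cast at hab h hn'
  rw [h] at hn'
  generalize (u : ZMod r) = x at *
  have hs : ∀ k : ℕ, k.Prime → k < 5 → ((k:ℕ) : ZMod r) ≠ 0 := by
    intro k hk hk5 h
    rw [ZMod.natCast_eq_zero_iff] at h
    have := ((Nat.prime_dvd_prime_iff_eq hr hk).1 h); omega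
  have h2 : (2 : ZMod r) ≠ 0 := by exact_mod_cast hs 2 Nat.prime_two (by norm_num)
  have h3 : (3 : ZMod r) ≠ 0 := by exact_mod_cast hs 3 Nat.prime_three (by norm_num)
  have e2 : x^2 = x - 1 := by linear_combination -hn'
  have e3 : x^3 = -1 := by linear_combination -(x+1)*hn'
  have e4 : x^4 = -x := by linear_combination -(x^2+x)*hn'
  have e5 : x^5 = 1 - x := by linear_combination -(x^3+x^2-1)*hn'
  have n1 : x ≠ 1 := by rintro rfl; simp at hn'
  have n2 : x ≠ -1 := by rintro rfl; apply h3; linear_combination -hn'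
  have n3 : x ≠ 2 := by rintro rfl; apply h3; linear_combination -hn'
  have n4 : x ≠ 0 := by rintro rfl; simp at hn'
  interval_cases a <;> try simp only [pow_zero, pow_one, e2, e3, e4, e5] at hab
  all_goals first | omega | (exfalso; grind)

theorem modC {u r : ℕ} (hr : r.Prime) (hr5 : 5 ≤ r) (h : r ∣ u^2+u+1) {a : ℕ}
    (ha : a ≤ 6) (hab : u^a ≡ 1 [MOD r]) : a = 0 ∨ a = 3 ∨ a = 6 := by
  have : Fact r.Prime := ⟨hr⟩
  rw [← ZMod.natCast_eq_natCast_iff] at hab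
  rw [← ZMod.natCast_eq_zero_iff] at h
  push_cast at hab h
  generalize (u : ZMod r) = x at *
  have h3 : (3 : ZMod r) ≠ 0 := by
    intro h
    have h : ((3:ℕ):ZMod r) = 0 := by exact_mod_cast h
    rw [ZMod.natCast_eq_zero_iff] at h
    have := ((Nat.prime_dvd_prime_iff_eq hr Nat.prime_three).1 h); omega
  have e2 : x^2 = -x - 1 := by linear_combination h
  have e4 : x^4 = x := by linear_combination (x^2-x)*h
  have e5 : x^5 = -x-1 := by linear_combination (x^3-x^2+1)*h
  have n1 : x ≠ 1 := by rintro rfl; apply h3; linear_combination h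
  interval_cases a <;> try simp only [pow_zero, pow_one, e2, e4, e5] at hab
  all_goals first | omega | (exfalso; grind)

theorem structA {a : Sp B} {N : ℕ} (hN : 2*N = q^3+1) (h : PO a N) (M : Submodule F V) (hM : Inv a M) :
    M = ⊥ ∨ M = ⊤ := by
  have hq := q_five B
  have hodd := q_odd B
  have h3 := q_three B
  obtain ⟨n, hn⟩ : ∃ n, n + q = q^2+1 := ⟨q^2+1-q, Nat.sub_add_cancel (by nlinarith)⟩
  have hnN : n * (q+1) = 2*N := by
    rw [hN]; zify at hn ⊢; linear_combination ((q:ℤ)+1) * hn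
  obtain ⟨r, hr, hr5, hrn⟩ : ∃ r, r.Prime ∧ 5 ≤ r ∧ r ∣ n := by
    apply prime5
    · have : (q^2) % 2 = 1 := by rw [Nat.pow_mod, hodd]
      omega
    · intro h9
      have h10 : (q^2+1) % 9 = q % 9 := by omega
      rw [Nat.add_mod, Nat.pow_mod] at h10
      have h11 : q % 9 % 3 ≠ 0 := by omega
      have : q % 9 < 9 := Nat.mod_lt _ (by norm_num)
      interval_cases q % 9 <;> omega
    · nlinarith
  have hrN : r ∣ N := by
    have h1 : r ∣ 2 * N := hnN ▸ Dvd.dvd.mul_right hrn _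
    rcases (Nat.Prime.dvd_mul hr).1 h1 with h2 | h2
    · have := Nat.le_of_dvd (by norm_num) h2; omega
    · exact h2
  obtain ⟨i, hx, hx1⟩ := PO_r (by rintro rfl; simp at hN) h hr5 hrN
  have key : ∀ M, Inv a M → M ⊓ Fx (a^i) = ⊥ → M = ⊥ ∨ M = ⊤ := by
    intro M hM h0
    have h1 := CNT (hM.pow i) hr (by intro y _; rw [hx, one_smul])
    rw [h0, finrank_bot, pow_zero] at h1
    have l := Submodule.finrank_le M
    rw [hS.fd] at l
    rcases modA hr hr5 hn hrn l h1 with h2 | h2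
    · left; exact Submodule.finrank_eq_zero.1 h2
    · right; apply Submodule.eq_top_of_finrank_eq; rw [h2, hS.fd]
  have hF : Fx (a^i) = ⊥ := by
    have h1 := CNT (g := a^i) (M := ⊤) (fun _ _ => trivial) hr (by intro y _; rw [hx, one_smul])
    rw [finrank_top, hS.fd, top_inf_eq] at h1
    have h2 : q^6 ≡ 1 [MOD r] := by
      apply (Nat.modEq_iff_dvd' (by apply Nat.one_le_pow; omega)).2 _ |>.symm
      have : q^6 - 1 = (q^3+1)*(q^3-1) := by
        rw [← Nat.sq_sub_sq]; ring_nf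
      rw [this, ← hN]
      exact Dvd.dvd.mul_right (Dvd.dvd.mul_left hrN _) _
    have l := Submodule.finrank_le (Fx (a^i))
    rw [hS.fd] at l
    rcases modA hr hr5 hn hrn l (h1.symm.trans h2) with h2 | h2
    · exact Submodule.finrank_eq_zero.1 h2
    · exfalso; apply hx1
      have : Fx (a^i) = ⊤ := by apply Submodule.eq_top_of_finrank_eq; rw [h2, hS.fd]
      apply sp_ext; intro y
      have hy : y ∈ Fx (a^i) := by rw [this]; trivial
      rw [one_smul]; exact hy
  exact key M hM (by rw [hF, inf_bot_eq])

theorem structC {a : Sp B} {N : ℕ} (hN : 2*N + 1 = q^3) (h : PO a N) (M : Submodule F V) (hM : Inv a M) :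
    finrank F M = 0 ∨ finrank F M = 3 ∨ finrank F M = 6 := by
  have hq := q_five B
  have hodd := q_odd B
  have h3 := q_three B
  obtain ⟨n, hn⟩ : ∃ n, n + 1 = q := ⟨q-1, Nat.sub_add_cancel (by omega)⟩
  have hnN : n * (q^2+q+1) = 2*N := by
    zify at hn hN ⊢; linear_combination ((q:ℤ)^2+q+1) * hn - hN
  obtain ⟨r, hr, hr5, hrn⟩ : ∃ r, r.Prime ∧ 5 ≤ r ∧ r ∣ q^2+q+1 := by
    apply prime5
    · have : (q^2) % 2 = 1 := by rw [Nat.pow_mod, hodd]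
      omega
    · intro h10
      rw [Nat.add_mod, Nat.add_mod (q^2), Nat.pow_mod] at h10
      have h11 : q % 9 % 3 ≠ 0 := by omega
      have : q % 9 < 9 := Nat.mod_lt _ (by norm_num)
      interval_cases q % 9 <;> omega
    · nlinarith
  have hrN : r ∣ N := by
    have h1 : r ∣ 2 * N := hnN ▸ Dvd.dvd.mul_left hrn _
    rcases (Nat.Prime.dvd_mul hr).1 h1 with h2 | h2
    · have := Nat.le_of_dvd (by norm_num) h2; omega
    · exact h2
  have hN0 : N ≠ 0 := by
    rintro rfl
    have : 1 < q^3 := Nat.one_lt_pow (by norm_num) (by omega)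
    omega
  obtain ⟨i, hx, hx1⟩ := PO_r hN0 h hr5 hrN
  have hrF : (r : F) ≠ 0 := by
    apply ne_of_dvd (n := 2*N) _ (Dvd.dvd.mul_left hrN _)
    have := congrArg (Nat.cast (R := F)) hN
    rw [Nat.cast_add, Nat.cast_pow, qF] at this
    intro h0
    rw [h0] at this; simp at this
  have hF : Fx (a^i) = ⊥ := by
    have h1 := CNT (g := a^i) (M := ⊤) (fun _ _ => trivial) hr (by intro y _; rw [hx, one_smul])
    rw [finrank_top, hS.fd, top_inf_eq] at h1
    have h2 : q^6 ≡ 1 [MOD r] := by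
      apply (Nat.modEq_iff_dvd' (by apply Nat.one_le_pow; omega)).2 _ |>.symm
      have : q^6 - 1 = (q^3+1)*(q^3-1) := by
        rw [← Nat.sq_sub_sq]; ring_nf
      rw [this, ← hN]
      exact Dvd.dvd.mul_left (Dvd.dvd.mul_left hrN _) _
    have l := Submodule.finrank_le (Fx (a^i))
    rw [hS.fd] at l
    rcases modC hr hr5 hrn l (h1.symm.trans h2) with h2 | h2 | h2
    · exact Submodule.finrank_eq_zero.1 h2
    · exfalso
      exact ODD (fun y hy hy' => AVG hx hrF hy hy') h2
    · exfalso; apply hx1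
      have : Fx (a^i) = ⊤ := by apply Submodule.eq_top_of_finrank_eq; rw [h2, hS.fd]
      apply sp_ext; intro y
      have hy : y ∈ Fx (a^i) := by rw [this]; trivial
      rw [one_smul]; exact hy
  have h1 := CNT (hM.pow i) hr (by intro y _; rw [hx, one_smul])
  rw [hF, inf_bot_eq, finrank_bot, pow_zero] at h1
  have l := Submodule.finrank_le M
  rw [hS.fd] at l
  exact modC hr hr5 hrn l h1

/-- the group generated by a and -1 -/
def PG (a : Sp B) : Subgroup (Sp B) := Subgroup.closure {a, nu B}

theorem PG_form {a g : Sp B} (hg : g ∈ PG a) : ∃ k : ℕ, g = a^k ∨ g = nu B * a^k := by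
  have hfin : ∀ g : Sp B, g ∈ (PG a) → ∃ k : ℕ, g = a^k ∨ g = nu B * a^k := by
    intro g hg
    have hc : ∀ k, a^k * nu B = nu B * a^k := fun k => nu_comm _
    induction hg using Subgroup.closure_induction'' with
    | mem x hx =>
      rcases hx with rfl | rfl
      · exact ⟨1, Or.inl (by simp)⟩
      · exact ⟨0, Or.inr (by simp)⟩
    | inv_mem x hx =>
      rcases hx with rfl | rfl
      · refine ⟨orderOf x - 1, Or.inl ?_⟩
        rw [inv_eq_iff_mul_eq_one, ← pow_succ', Nat.sub_add_cancel (orderOf_pos x), pow_orderOf_eq_one]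
      · exact ⟨0, Or.inr (by simp [inv_eq_iff_mul_eq_one, nu_sq])⟩
    | one => exact ⟨0, Or.inl (by simp)⟩
    | mul x y _ _ hx hy =>
      obtain ⟨k, hk⟩ := hx
      obtain ⟨l, hl⟩ := hy
      refine ⟨k + l, ?_⟩
      rw [pow_add]
      rcases hk with rfl | rfl <;> rcases hl with rfl | rfl
      · left; rfl
      · right; rw [← mul_assoc, hc, mul_assoc]
      · right; rw [mul_assoc]
      · left; rw [mul_assoc, ← mul_assoc (a^k), hc, mul_assoc, ← mul_assoc, nu_sq, one_mul]
  exact hfin g hg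

theorem PG_card {a : Sp B} {N : ℕ} (h : PO a N) (hN : N ≠ 0) : Nat.card (PG a) = 2 * N := by
  have ha : a ∈ PG a := Subgroup.subset_closure (by simp)
  have hn : nu B ∈ PG a := Subgroup.subset_closure (by simp)
  have : Nat.card (Fin 2 × Fin N) = 2 * N := by simp
  rw [← this]
  symm
  let F' : Fin 2 × Fin N → PG a := fun x => ⟨(nu B)^(x.1:ℕ) * a^(x.2:ℕ),
    mul_mem (pow_mem hn _) (pow_mem ha _)⟩
  apply Nat.card_congr (Equiv.ofBijective F' ⟨?_, ?_⟩)
  · have key : ∀ i i' j j' : ℕ, i < 2 → i' < 2 → j < N → j' < N → j ≤ j' →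
        (nu B)^i * a^j = (nu B)^i' * a^j' → i = i' ∧ j = j' := by
      intro i i' j j' hi hi' hj hj' hjj h1
      have hjj' : a^j' = a^(j'-j) * a^j := by rw [← pow_add, Nat.sub_add_cancel hjj]
      rw [hjj', ← mul_assoc] at h1
      have h1 := mul_right_cancel h1
      have h2 : a^(j'-j) = 1 ∨ a^(j'-j) = nu B := by
        interval_cases i <;> interval_cases i' <;> simp at h1
        · left; exact h1.symm
        · right; rw [← mul_left_cancel_iff (a := nu B), ← h1, nu_sq]
        · right; exact h1.symm
        · left; exact h1
      have h3 := (h _).1 h2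
      have h4 : j' - j = 0 := Nat.eq_zero_of_dvd_of_lt h3 (by omega)
      rw [h4] at h1
      refine ⟨?_, by omega⟩
      interval_cases i <;> interval_cases i' <;> simp at h1 ⊢
      · exact nu_ne h1.symm
      · exact nu_ne h1
    rintro ⟨i, j⟩ ⟨i', j'⟩ hh
    have hh : (nu B)^(i:ℕ) * a^(j:ℕ) = (nu B)^(i':ℕ) * a^(j':ℕ) := congrArg Subtype.val hh
    rcases le_total (j:ℕ) (j':ℕ) with hl | hl
    · obtain ⟨h1, h2⟩ := key _ _ _ _ i.2 i'.2 j.2 j'.2 hl hh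
      rw [Prod.mk.injEq]; exact ⟨Fin.ext h1, Fin.ext h2⟩
    · obtain ⟨h1, h2⟩ := key _ _ _ _ i'.2 i.2 j'.2 j.2 hl hh.symm
      rw [Prod.mk.injEq]; exact ⟨Fin.ext h1.symm, Fin.ext h2.symm⟩
  · rintro ⟨g, hg⟩
    obtain ⟨k, hk⟩ := PG_form hg
    have hkN : k % N < N := Nat.mod_lt _ (Nat.pos_of_ne_zero hN)
    have h1 : a^k = a^(k % N) ∨ a^k = nu B * a^(k % N) := by
      have h2 : a^k = a^(N * (k/N)) * a^(k % N) := by rw [← pow_add, Nat.div_add_mod]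
      rcases (h (N*(k/N))).2 ⟨_, rfl⟩ with h3 | h3
      · left; rw [h2, h3, one_mul]
      · right; rw [h2, h3]
    rcases hk with rfl | rfl <;> rcases h1 with h1 | h1
    · exact ⟨(0, ⟨k % N, hkN⟩), Subtype.ext (by simp [F', h1])⟩
    · exact ⟨(1, ⟨k % N, hkN⟩), Subtype.ext (by simp [F', h1])⟩
    · exact ⟨(1, ⟨k % N, hkN⟩), Subtype.ext (by simp [F', h1])⟩
    · exact ⟨(0, ⟨k % N, hkN⟩), Subtype.ext (by simp [F', h1, ← mul_assoc, nu_sq])⟩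

theorem PG_comm {a g : Sp B} (hg : g ∈ PG a) : a * g = g * a := by
  obtain ⟨k, rfl | rfl⟩ := PG_form hg
  · rw [← pow_succ, ← pow_succ']
  · rw [← mul_assoc, nu_comm, mul_assoc, mul_assoc, ← pow_succ, ← pow_succ']

theorem Fx_top {g : Sp B} (h : Fx g = ⊤) : g = 1 := by
  apply sp_ext; intro y
  have hy : y ∈ Fx g := by rw [h]; trivial
  rw [one_smul]; exact hy

theorem freeA {a : Sp B} {N : ℕ} (hN : 2*N = q^3+1) (h : PO a N) {g : Sp B} (hg : g ∈ PG a) {x : V}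
    (hx : x ≠ 0) (hgx : g • x = x) : g = 1 := by
  rcases structA hN h _ (Inv_Fx (PG_comm hg)) with h1 | h1
  · exfalso; apply hx
    have : x ∈ Fx g := hgx
    rwa [h1, Submodule.mem_bot] at this
  · exact Fx_top h1

theorem freeC {a : Sp B} {N : ℕ} (hN : 2*N+1 = q^3) (h : PO a N) {g : Sp B} (hg : g ∈ PG a) {x : V}
    (hx : x ≠ 0) (hgx : g • x = x) : g = 1 := by
  rcases structC hN h _ (Inv_Fx (PG_comm hg)) with h1 | h1 | h1
  · exfalso; apply hx
    have : x ∈ Fx g := hgx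
    rwa [Submodule.finrank_eq_zero.1 h1, Submodule.mem_bot] at this
  · exfalso
    have hF : ((2*N : ℕ):F) ≠ 0 := by
      have := congrArg (Nat.cast (R := F)) hN
      rw [Nat.cast_add, Nat.cast_pow, qF] at this
      intro h0
      rw [h0] at this; simp at this
    have hg1 : g^(2*N) = 1 := by
      obtain ⟨k, rfl | rfl⟩ := PG_form hg
      · rw [← pow_mul, mul_comm, pow_mul, h.two, one_pow]
      · rw [Commute.mul_pow (nu_comm (a^k)).symm, nu_pow, one_mul, ← pow_mul, mul_comm, pow_mul, h.two, one_pow]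
    exact ODD (fun y hy hy' => AVG hg1 hF hy hy') h1
  · exact Fx_top (Submodule.eq_top_of_finrank_eq (by rw [h1, hS.fd]))

theorem free_dvd (P X : Subgroup (Sp B)) (hPX : P ≤ X) {v : V} (hv : v ≠ 0)
    (hfree : ∀ g ∈ P, ∀ x : V, x ≠ 0 → g • x = x → g = 1) :
    Nat.card P ∣ Nat.card (MulAction.orbit X v) := by
  have : Finite V := Module.finite_of_finite F
  let O := MulAction.orbit X v
  let _ : MulAction P O :=
    { smul := fun g x => ⟨g.1 • x.1, by
        obtain ⟨h, hh⟩ := x.2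
        refine ⟨⟨g.1, hPX g.2⟩ * h, ?_⟩
        rw [← hh]; exact mul_smul _ _ _⟩
      one_smul := fun x => Subtype.ext (one_smul _ x.1)
      mul_smul := fun g h x => Subtype.ext (mul_smul g.1 h.1 x.1) }
  have hs : ∀ x : O, MulAction.stabilizer P x = ⊥ := by
    intro x
    rw [eq_bot_iff]
    intro g hg
    have hg : g.1 • x.1 = x.1 := congrArg Subtype.val hg
    have hx : x.1 ≠ 0 := by
      obtain ⟨h, hh⟩ := x.2
      rw [← hh]; intro h0
      exact hv ((smul_eq_zero_iff_eq h).1 h0)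
    exact Subtype.ext (hfree g.1 g.2 x.1 hx hg)
  have e := MulAction.selfEquivOrbitsQuotientProd hs
  rw [Nat.card_congr e, Nat.card_prod]
  exact Dvd.intro_left _ rfl

theorem ORB {a c : Sp B} {N M : ℕ} (hN : 2*N = q^3+1) (ha : PO a N) (hM : 2*M+1 = q^3) (hc : PO c M)
    {X : Subgroup (Sp B)} (haX : a ∈ X) (hcX : c ∈ X) (hnX : nu B ∈ X) {v : V} (hv : v ≠ 0) :
    ∃ k, 2 * Nat.card (MulAction.orbit X v) = k * (q^6-1) := by
  have hq := q_five B
  have hN0 : N ≠ 0 := by rintro rfl; simp at hN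
  have hM0 : M ≠ 0 := by
    rintro rfl
    have : 1 < q^3 := Nat.one_lt_pow (by norm_num) (by omega)
    omega
  have hle : ∀ b ∈ X, PG b ≤ X := by
    intro b hb
    rw [PG, Subgroup.closure_le]
    rintro x (rfl | rfl)
    · exact hb
    · exact hnX
  have h1 := free_dvd (PG a) X (hle a haX) hv (fun g hg x hx h => freeA hN ha hg hx h)
  have h2 := free_dvd (PG c) X (hle c hcX) hv (fun g hg x hx h => freeC hM hc hg hx h)
  rw [PG_card ha hN0] at h1
  rw [PG_card hc hM0] at h2
  obtain ⟨l, hl⟩ : 2 ∣ Nat.card (MulAction.orbit X v) := (Dvd.intro _ rfl).trans h1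
  rw [hl] at h1 h2
  have h1 := Nat.dvd_of_mul_dvd_mul_left (by norm_num) h1
  have h2 := Nat.dvd_of_mul_dvd_mul_left (by norm_num) h2
  have hcop : Nat.Coprime N M := by
    have : N = M + 1 := by omega
    rw [this]; simp
  obtain ⟨k, hk⟩ := Nat.Coprime.mul_dvd_of_dvd_of_dvd hcop h1 h2
  refine ⟨k, ?_⟩
  have : q^6 - 1 = (q^3+1)*(q^3-1) := by
    rw [← Nat.sq_sub_sq]; ring_nf
  rw [hl, hk, this, ← hN, ← hM, Nat.add_sub_cancel]; ring

end base
end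
end PSP

open Module
set_option linter.unusedSectionVars false
set_option linter.unusedVariables false
set_option linter.style.longLine false
set_option linter.unnecessarySimpa false
set_option linter.unusedSimpArgs false
namespace PSP
noncomputable section
section base
variable {F : Type*} {V : Type*} [Field F] [Fintype F] [AddCommGroup V] [Module F V] [FiniteDimensional F V]
variable {B : V →ₗ[F] V →ₗ[F] F}
variable [hS : Sy B]

local notation "q" => Fintype.card F

theorem GEN {X : Subgroup (Sp B)} (h : ∀ v a, t B v a ∈ X) : X = ⊤ := by
  have perpw : ∀ (g : Sp B) (x y : V), g • y = y → B y (g • x - x) = 0 := by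
    intro g x y hy
    rw [map_sub]; nth_rewrite 1 [← hy]; rw [Bg, sub_self]
  have step : ∀ (g : Sp B) (x : V), B x (g • x) ≠ 0 → ∃ w a, Fx g ≤ Fx (t B w a * g) ∧
      x ∈ Fx (t B w a * g) ∧ x ∉ Fx g := by
    intro g x hx
    refine ⟨g • x - x, -(B x (g • x))⁻¹, ?_, ?_, ?_⟩
    · intro y hy
      rw [mem_Fx] at *
      rw [mul_smul, hy, t_smul, perpw g x y hy]; simp
    · rw [mem_Fx, mul_smul, t_smul, map_sub, hS.alt, Bs (g • x) x]
      simp [hx]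
    · intro h; rw [mem_Fx] at h; rw [h, hS.alt] at hx; exact hx rfl
  have main : ∀ n (g : Sp B), 6 ≤ finrank F (Fx g) + n → g ∈ X := by
    intro n
    induction n with
    | zero =>
      intro g hg
      have l := Submodule.finrank_le (Fx g)
      rw [hS.fd] at l
      have := Fx_top (Submodule.eq_top_of_finrank_eq (by rw [hS.fd]; omega) : Fx g = ⊤)
      rw [this]; exact X.one_mem
    | succ n ih =>
      intro g hg
      have main1 : ∀ g' (x : V), Fx g ≤ Fx g' → B x (g' • x) ≠ 0 → g' ∈ X := by
        intro g' x hgg hx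
        obtain ⟨w, a, h1, h2, h3⟩ := step g' x hx
        have h4 : Fx g' < Fx (t B w a * g') := lt_of_le_of_ne h1 (by rintro h; rw [h] at h3; exact h3 h2)
        have h5 := Submodule.finrank_lt_finrank_of_lt h4
        have h6 := Submodule.finrank_mono hgg
        have := ih (t B w a * g') (by omega)
        exact (Subgroup.mul_mem_cancel_left X (h w a)).1 this
      by_cases hx : ∃ x : V, B x (g • x) ≠ 0
      · obtain ⟨x, hx⟩ := hx
        exact main1 g x le_rfl hx
      · push Not at hx
        by_cases hy : ∃ y : V, g • y - y ≠ 0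
        · obtain ⟨y, hy⟩ := hy
          obtain ⟨x, hxw⟩ := nd' (B := B) hy
          have hpol : B x (g • y) + B y (g • x) = 0 := by
            have := hx (x + y)
            simp only [smul_add, map_add, LinearMap.add_apply, hx] at this
            linear_combination this
          have h1 : B x (g • y - y) ≠ 0 := by rw [Bs, hxw]; simp
          have h2 : B (g • x) (g • y - y) = - B x (g • y - y) := by
            simp only [map_sub, Bg]
            rw [Bs (g • x) y]; linear_combination hpol
          have := main1 (t B (g • y - y) 1 * g) x (by
            intro k hk
            rw [mem_Fx] at *
            rw [mul_smul, hk, t_smul, perpw g y k hk]; simp) (by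
            rw [mul_smul, t_smul, map_add, hx, h2]
            simp only [map_smul, one_mul, zero_add, smul_eq_mul]
            exact mul_ne_zero (neg_ne_zero.2 h1) h1)
          exact (Subgroup.mul_mem_cancel_left X (h _ _)).1 this
        · push Not at hy
          have : g = 1 := sp_ext (fun y => by rw [one_smul]; exact sub_eq_zero.1 (hy y))
          rw [this]; exact X.one_mem
  rw [eq_top_iff]
  intro g _
  exact main 6 g (by omega)

def TP (X : Subgroup (Sp B)) (w : V) : Prop := ∀ c, t B w c ∈ X

theorem TP.smul {X : Subgroup (Sp B)} {w : V} (h : TP X w) {g : Sp B} (hg : g ∈ X) : TP X (g • w) := by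
  intro c
  rw [← t_conj]
  exact X.mul_mem (X.mul_mem hg (h c)) (X.inv_mem hg)

theorem TP.scal {X : Subgroup (Sp B)} {w : V} (h : TP X w) (k : F) : TP X (k • w) := by
  intro c
  rw [t_smul_v]; exact h _

theorem TP.line {X : Subgroup (Sp B)} {w w' : V} (h : TP X w) (h' : TP X w') (hB : B w w' ≠ 0) (c : F) :
    TP X (w + c • w') := by
  have := h.smul (h' (c / B w w'))
  rwa [t_smul, div_mul_cancel₀ _ hB] at this

theorem free_dvd' (P : Subgroup (Sp B)) (O : Set V) (hinv : ∀ g ∈ P, ∀ x ∈ O, g • x ∈ O)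
    (hfree : ∀ g ∈ P, ∀ x ∈ O, g • x = x → g = 1) :
    Nat.card P ∣ Nat.card O := by
  have : Finite V := Module.finite_of_finite F
  let _ : MulAction P O :=
    { smul := fun g x => ⟨g.1 • x.1, hinv g.1 g.2 x.1 x.2⟩
      one_smul := fun x => Subtype.ext (one_smul _ x.1)
      mul_smul := fun g h x => Subtype.ext (mul_smul g.1 h.1 x.1) }
  have hs : ∀ x : O, MulAction.stabilizer P x = ⊥ := by
    intro x
    rw [eq_bot_iff]
    intro g hg
    have hg : g.1 • x.1 = x.1 := congrArg Subtype.val hg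
    exact Subtype.ext (hfree g.1 g.2 x.1 x.2 hg)
  have e := MulAction.selfEquivOrbitsQuotientProd hs
  rw [Nat.card_congr e, Nat.card_prod]
  exact Dvd.intro_left _ rfl

theorem card_V (B : V →ₗ[F] V →ₗ[F] F) [hS : Sy B] : Nat.card V = q^6 := by
  rw [Module.natCard_eq_pow_finrank (K := F), Nat.card_eq_fintype_card, hS.fd]

theorem ACT {a c : Sp B} {N M : ℕ} (hN : 2*N = q^3+1) (ha : PO a N) (hM : 2*M+1 = q^3) (hc : PO c M)
    {X : Subgroup (Sp B)} (haX : a ∈ X) (hcX : c ∈ X) (hnX : nu B ∈ X) {v : V} (hv : v ≠ 0)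
    {b : F} (hb : b ≠ 0) (ht : t B v b ∈ X) : X = ⊤ := by
  have hfin : Finite V := Module.finite_of_finite F
  have hq := q_five B
  have orb : ∀ v : V, v ≠ 0 → q^6 - 1 ≤ 2 * (MulAction.orbit X v).ncard := by
    intro v hv
    obtain ⟨k, hk⟩ := ORB hN ha hM hc haX hcX hnX hv
    rw [Nat.card_coe_set_eq] at hk
    have h0 : (MulAction.orbit X v).ncard ≠ 0 :=
      ((Set.ncard_pos (Set.toFinite _)).2 (MulAction.nonempty_orbit v)).ne' 
    have : k ≠ 0 := by rintro rfl; simp at hk; simp [hk] at h0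
    rw [hk]; exact Nat.le_mul_of_pos_left _ (Nat.pos_of_ne_zero this)
  have nz : ∀ v : V, v ≠ 0 → ∀ w ∈ MulAction.orbit X v, w ≠ 0 := by
    rintro v hv _ ⟨h, rfl⟩ h0
    exact hv ((smul_eq_zero_iff_eq h).1 h0)
  have sq : ∀ k : F, k ≠ 0 → k^2 • v ∈ MulAction.orbit X v := by
    intro k hk
    by_contra hno
    have hkv : k • v ≠ 0 := smul_ne_zero hk hv
    have h1 : k • v ∉ MulAction.orbit X v := by
      rintro ⟨g, hg⟩
      apply hno
      refine ⟨g * g, ?_⟩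
      simp only [] at hg ⊢
      rw [mul_smul, hg]
      have : g • k • v = k • g • v := gc g.1 k v
      rw [this, hg, smul_smul, pow_two]
    have h2 : k^2 • v ∉ MulAction.orbit X (k • v) := by
      rintro ⟨g, hg⟩
      apply h1
      refine ⟨g, ?_⟩
      simp only [] at hg ⊢
      have : g • k • v = k • g • v := gc g.1 k v
      rw [this, pow_two, mul_smul] at hg
      exact smul_right_injective _ hk hg
    have hd : Disjoint (MulAction.orbit X v) (MulAction.orbit X (k • v)) := by
      rw [Set.disjoint_left]
      intro x hx hx'
      apply h1
      rw [← MulAction.orbit_eq_iff] at *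
      rw [← hx', ← hx]
    have e1 := Set.ncard_union_eq hd
    have e2 : (insert (k^2 • v) (insert (0:V) (MulAction.orbit X v ∪ MulAction.orbit X (k • v)))).ncard
        = (MulAction.orbit X v ∪ MulAction.orbit X (k • v)).ncard + 1 + 1 := by
      rw [Set.ncard_insert_of_notMem, Set.ncard_insert_of_notMem]
      · rintro (h | h)
        · exact nz v hv _ h rfl
        · exact nz _ hkv _ h rfl
      · rintro (h | h | h)
        · exact smul_ne_zero (pow_ne_zero 2 hk) hv h
        · exact hno h
        · exact h2 h
    have e3 := Set.ncard_le_card (insert (k^2 • v) (insert (0:V) (MulAction.orbit X v ∪ MulAction.orbit X (k • v))))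
    rw [card_V B] at e3
    have := orb v hv
    have := orb _ hkv
    omega
  have fourth : ∀ k : F, t B v (k^4 * b) ∈ X := by
    intro k
    by_cases hk : k = 0
    · rw [hk]; simp [t_zero, X.one_mem]
    obtain ⟨g, hg⟩ := sq k hk
    have h1 : g.1 • v = k^2 • v := hg
    have := X.mul_mem (X.mul_mem g.2 ht) (X.inv_mem g.2)
    rw [t_conj, h1, t_smul_v] at this
    convert this using 2; ring
  have vTP : TP X v := by
    intro d
    have h24 : (24:F) ≠ 0 := by
      have : (24:F) = 2^3*3 := by norm_num
      rw [this]; exact mul_ne_zero (pow_ne_zero _ hS.two) hS.three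
    set x : F := (d/b - 36)/24 with hx
    have add : ∀ c c', t B v c ∈ X → t B v c' ∈ X → t B v (c + c') ∈ X := by
      intro c c' h h'; rw [← t_mul]; exact X.mul_mem h h'
    have neg : ∀ c, t B v c ∈ X → t B v (-c) ∈ X := by
      intro c h; rw [← t_inv]; exact X.inv_mem h
    have f3 := fourth (x+3)
    have f2 := neg _ (fourth (x+2))
    have f1 := fourth (x+1)
    have f0 := neg _ (fourth x)
    have := add _ _ (add _ _ f3 f0) (add _ _ (add _ _ (add _ _ f1 f1) f1) (add _ _ (add _ _ f2 f2) f2))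
    convert this using 2
    have h : 24 * x = d/b - 36 := by rw [hx]; field_simp
    have h' : d = (24*x+36)*b := by rw [h]; field_simp; ring
    rw [h']; ring
  apply GEN
  intro x
  by_contra hx'
  have hx : ¬ TP X x := hx'
  clear hx'
  have hx0 : x ≠ 0 := by
    rintro rfl; apply hx; intro c; rw [t_zero']; exact X.one_mem
  let Ω : Set V := {w | TP X w}
  let L : Submodule F V := LinearMap.ker (B x)
  have hL : (L : Set V).ncard = q^5 := by
    have h := LinearMap.finrank_range_add_finrank_ker (B x)
    have h1 : LinearMap.range (B x) = ⊤ := by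
      rw [LinearMap.range_eq_top]
      intro a
      obtain ⟨y, hy⟩ := nd' (B := B) hx0
      exact ⟨a • y, by simp [hy]⟩
    rw [h1, finrank_top, hS.fd] at h
    simp at h
    have : finrank F L = 5 := by show finrank F (LinearMap.ker (B x)) = 5; omega
    rw [← Nat.card_coe_set_eq]
    have := card_sub L
    rw [‹finrank F L = 5›] at this
    exact this
  have hΩ1 : q^6 ≤ 2 * Ω.ncard := by
    have h1 : insert (0:V) (MulAction.orbit X v) ⊆ Ω := by
      rintro w (rfl | ⟨g, rfl⟩)
      · intro c; rw [t_zero']; exact X.one_mem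
      · exact vTP.smul g.2
    have h2 := Set.ncard_le_ncard h1
    rw [Set.ncard_insert_of_notMem (fun h => nz v hv _ h rfl)] at h2
    have := orb v hv
    omega
  have h1 : (Ω \ L).ncard * q ≤ q^6 - q^5 := by
    have e1 : (((Ω \ L) ×ˢ (Set.univ : Set F))).ncard = (Ω \ L).ncard * q := by
      rw [Set.ncard_prod, Set.ncard_univ, Nat.card_eq_fintype_card]
    have e2 : ((L : Set V)ᶜ).ncard = q^6 - q^5 := by
      rw [Set.ncard_compl, card_V B, hL]
    rw [← e1, ← e2]
    apply Set.ncard_le_ncard_of_injOn (fun y : V × F => y.1 + y.2 • x)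
    · rintro ⟨w, k⟩ ⟨⟨h1, h2⟩, -⟩
      simp only [Set.mem_compl_iff, SetLike.mem_coe, L, LinearMap.mem_ker] at h2 ⊢
      simpa [hS.alt] using h2
    · rintro ⟨w, k⟩ ⟨⟨h1, h2⟩, -⟩ ⟨w', k'⟩ ⟨⟨h1', h2'⟩, -⟩ hh
      simp only [SetLike.mem_coe, L, LinearMap.mem_ker] at h2 h2' hh
      by_cases hkk : k = k'
      · subst hkk; simpa using hh
      · exfalso; apply hx
        have e : w = w' + (k' - k) • x := by
          rw [sub_smul]; rw [← add_sub_assoc, ← hh]; abel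
        have hB : B w w' ≠ 0 := by
          rw [e]; simp [hS.alt]
          exact ⟨fun h => hkk (sub_eq_zero.1 h).symm, h2'⟩
        have := (TP.line h1 h1' hB (-1)).scal (k'-k)⁻¹
        have e' : (k'-k)⁻¹ • (w + (-1:F) • w') = x := by
          rw [e, neg_one_smul, add_neg_cancel_comm, smul_smul, inv_mul_cancel₀ (fun h => hkk (sub_eq_zero.1 h).symm), one_smul]
        rwa [e'] at this
  have h2 : Ω.ncard ≤ (Ω \ L).ncard + (L : Set V).ncard := by
    refine (Set.ncard_le_ncard (t := (Ω \ L) ∪ L) ?_).trans (Set.ncard_union_le _ _)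
    intro y hy
    by_cases h : y ∈ (L : Set V)
    · right; exact h
    · left; exact ⟨hy, h⟩
  rw [hL] at h2
  have h3 : (Ω \ L).ncard ≤ q^5 - q^4 := by
    have : (q^5 - q^4) * q = q^6 - q^5 := by rw [Nat.sub_mul]; ring_nf
    rw [← this] at h1
    exact Nat.le_of_mul_le_mul_right h1 (by omega)
  have h4 : q^4 ≤ q^5 := Nat.pow_le_pow_right (by omega) (by norm_num)
  have h5 : 5 * q^5 ≤ q^6 := by rw [pow_succ q 5, mul_comm]; exact Nat.mul_le_mul_left _ hq
  have h6 : 0 < q^4 := Nat.pow_pos (by omega)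
  omega

end base
end
end PSP

open Module
set_option linter.unusedSectionVars false
set_option linter.unusedVariables false
set_option linter.style.longLine false
set_option linter.unnecessarySimpa false
set_option linter.unusedSimpArgs false
namespace PSP
noncomputable section
section base
variable {F : Type*} {V : Type*} [Field F] [Fintype F] [AddCommGroup V] [Module F V] [FiniteDimensional F V]
variable {B : V →ₗ[F] V →ₗ[F] F}
variable [hS : Sy B]

local notation "q" => Fintype.card F

def IsQ (g : Sp B) (v n : V) (c : F) : Prop := ∀ x, g • x = x + B x v • n + (B x n + c * B x v) • v

theorem IsQ.mul {g g' : Sp B} {v n n' : V} {c c' : F} (h : IsQ g v n c) (h' : IsQ g' v n' c')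
    (hn : B n v = 0) (hn' : B n' v = 0) : IsQ (g * g') v (n + n') (c + c' + B n' n) := by
  intro x
  rw [mul_smul, h', h]
  simp only [map_add, map_smul, LinearMap.add_apply, LinearMap.smul_apply, smul_eq_mul, hn, hn', hS.alt, Bs v n]
  module

theorem IsQ.eq {g g' : Sp B} {v n : V} {c : F} (h : IsQ g v n c) (h' : IsQ g' v n c) : g = g' :=
  sp_ext (fun x => by rw [h, h'])

theorem IsQ.t {v : V} {c : F} : IsQ (t B v c) v 0 c := by intro x; simp

theorem IsQ.eq_t {g : Sp B} {v : V} {c : F} (h : IsQ g v 0 c) : g = PSP.t B v c := h.eq IsQ.t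

theorem IsQ.shift {g : Sp B} {v n : V} {c : F} (h : IsQ g v n c) (k : F) : IsQ g v (n - k • v) (c + 2 * k) := by
  intro x
  rw [h]
  simp
  module

theorem IsQ.conj {g : Sp B} {v n : V} {c : F} (h : IsQ g v n c) (s : Sp B) :
    IsQ (s * g * s⁻¹) (s • v) (s • n) c := by
  intro x
  rw [mul_smul, mul_smul, h]
  simp only [smul_add, gc, smul_inv_smul, Bgi s⁻¹, inv_inv]

theorem IsQ.comm {X : Subgroup (Sp B)} {g g' : Sp B} {v n n' : V} {c c' : F} (h : IsQ g v n c) (h' : IsQ g' v n' c')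
    (hn : B n v = 0) (hn' : B n' v = 0) (hg : g ∈ X) (hg' : g' ∈ X) : PSP.t B v (2 * B n' n) ∈ X := by
  have h1 := h.mul h' hn hn'
  have h2 := h'.mul h hn' hn
  have h3 := (IsQ.t (B := B) (v := v) (c := 2 * B n' n)).mul h2 (by simp) (by simp [hn, hn'])
  have : g * g' = PSP.t B v (2 * B n' n) * (g' * g) := by
    apply h1.eq
    convert h3 using 1
    · rw [zero_add, add_comm]
    · rw [Bs n n']; simp; ring
  have h4 : PSP.t B v (2 * B n' n) = (g * g') * (g' * g)⁻¹ := by rw [this]; group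
  rw [h4]
  exact X.mul_mem (X.mul_mem hg hg') (X.inv_mem (X.mul_mem hg' hg))

theorem exQ {g : Sp B} {v f : V} (hf : B f v = 1) (hv : g • v = v)
    (h : ∀ x, B x v = 0 → ∃ k : F, g • x = x + k • v) :
    B (g • f - f) v = 0 ∧ IsQ g v (g • f - f) (- B f (g • f - f)) := by
  have hd : B (g • f - f) v = 0 := by
    have := Bg g f v
    rw [hv] at this
    rw [map_sub, LinearMap.sub_apply, this, sub_self]
  refine ⟨hd, ?_⟩
  generalize hdd : g • f - f = d at *
  have hgf : g • f = f + d := by rw [← hdd]; abel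
  have h0 : ∀ x, B x v = 0 → g • x = x + B x d • v := by
    intro x hx
    obtain ⟨k, hk⟩ := h x hx
    have h1 := Bg g x f
    rw [hk, hgf] at h1
    simp [Bs v f, Bs v d, hf, hd] at h1
    rw [hk]; congr 2; linear_combination -h1
  intro x
  have e : x = (x - B x v • f) + B x v • f := by abel
  have h1 := h0 (x - B x v • f) (by simp [hf])
  nth_rewrite 1 [e]
  rw [smul_add, h1, gc, hgf]
  simp only [map_sub, map_smul, LinearMap.sub_apply, LinearMap.smul_apply, smul_eq_mul]
  module

def Irr (X : Subgroup (Sp B)) : Prop := ∀ M : Submodule F V, (∀ g ∈ X, Inv g M) → M = ⊥ ∨ M = ⊤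

theorem Irr.ex {X : Subgroup (Sp B)} (h : Irr X) {v w : V} (hv : v ≠ 0) (hw : w ≠ 0) : ∃ g ∈ X, B (g • v) w ≠ 0 := by
  by_contra! hc
  let M : Submodule F V := Submodule.span F {y | ∃ g ∈ X, y = g • v}
  have hM : ∀ g ∈ X, Inv g M := by
    intro g hg x hx
    induction hx using Submodule.span_induction with
    | mem x hx =>
      obtain ⟨g', hg', rfl⟩ := hx
      apply Submodule.subset_span
      exact ⟨g * g', X.mul_mem hg hg', by rw [mul_smul]⟩
    | zero => rw [smul_zero]; exact M.zero_mem
    | add x y _ _ hx hy => rw [smul_add]; exact M.add_mem hx hy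
    | smul c x _ hx => rw [gc]; exact M.smul_mem _ hx
  have hle : M ≤ LinearMap.ker (B.flip w) := by
    rw [Submodule.span_le]
    rintro _ ⟨g, hg, rfl⟩
    exact hc g hg
  have hvM : v ∈ M := Submodule.subset_span ⟨1, X.one_mem, by simp⟩
  rcases h M hM with h0 | h0
  · rw [h0, Submodule.mem_bot] at hvM; exact hv hvM
  · apply hw
    apply hS.nd
    intro y
    have : y ∈ LinearMap.ker (B.flip w) := hle (by rw [h0]; trivial)
    rw [LinearMap.mem_ker, LinearMap.flip_apply] at this
    rw [Bs, this, neg_zero]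

theorem NT {p f k m : ℕ} (hp : 5 ≤ p) (hf : f ≠ 0) (hm : 2 * m = (p^f)^2 + 1) (hk : k ≤ 4 * f) (h0 : k ≠ 0)
    (hd : m ∣ p^k - 1) : k = 4 * f := by
  by_contra hne
  have hp0 : 0 < p := by omega
  have small : ∀ j, j < 2 * f → 5 * p^j ≤ (p^f)^2 := by
    intro j hj
    calc 5 * p^j ≤ p * p^j := Nat.mul_le_mul_right _ hp
      _ = p^(j+1) := by rw [pow_succ, mul_comm]
      _ ≤ p^(2*f) := Nat.pow_le_pow_right hp0 hj
      _ = (p^f)^2 := by rw [← pow_mul, mul_comm]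
  have hpk : 1 < p^k := Nat.one_lt_pow h0 (by omega)
  by_cases h2 : k < 2 * f
  · have := Nat.le_of_dvd (by omega) hd
    have := small k h2
    omega
  · obtain ⟨j, rfl⟩ : ∃ j, k = 2 * f + j := ⟨k - 2*f, by omega⟩
    have h1 : m ∣ p^j + 1 := by
      have h3 : m ∣ (p^(2*f+j) - 1) + (p^j + 1) := by
        have : (p^(2*f+j) - 1) + (p^j + 1) = 2 * m * p^j := by
          rw [hm]
          have : p^(2*f+j) = (p^f)^2 * p^j := by rw [pow_add, ← pow_mul, mul_comm f]
          rw [add_mul, ← this]; omega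
        rw [this]; exact ⟨2 * p^j, by ring⟩
      exact (Nat.dvd_add_right hd).1 h3
    have h4 := Nat.le_of_dvd (by omega) h1
    have h5 := small j (by omega)
    have h6 : 0 < p^j := Nat.pow_pos hp0
    nlinarith

theorem q_pf (B : V →ₗ[F] V →ₗ[F] F) [hS : Sy B] : ∃ p f, p.Prime ∧ CharP F p ∧ 5 ≤ p ∧ f ≠ 0 ∧ q = p^f := by
  obtain ⟨p, hp⟩ := CharP.exists F
  obtain ⟨n, hp1, hn⟩ := FiniteField.card F p
  refine ⟨p, n, hp1, hp, ?_, n.2.ne', hn⟩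
  by_contra hlt
  have := hp1.two_le
  have h2 := hS.two
  have h3 := hS.three
  interval_cases p
  · exact h2 (by exact_mod_cast CharP.cast_eq_zero F 2)
  · exact h3 (by exact_mod_cast CharP.cast_eq_zero F 3)
  · revert hp1; decide

theorem IsS.invP {s : Sp B} {e f : V} (h : IsS s e f) : Inv s (Wp B e f) := by
  intro y hy
  rw [mem_Wp] at *
  have h1 := Bg s y e
  have h2 := Bg s y f
  rw [h.se] at h1
  rw [h.sf] at h2
  rwa [h1, h2]

theorem W_part {e f v n : V} (hef : B e f = 1) (hv : v ∈ Wm B e f) (hv0 : v ≠ 0) (hn : B n v = 0) :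
    ∃ k : F, n - k • v ∈ Wp B e f := by
  obtain ⟨w, u, h, h1, h2⟩ := z_dec hef n
  have hw := (z_neg_iff hef w).1 h1
  have hu := mem_Wp.2 ((z_fix_iff hef u).1 h2)
  obtain ⟨k, hk⟩ := W_dep hv hw hv0 (by
    have := W_perp hv hu
    rw [h, map_add, LinearMap.add_apply, Bs u v, this, Bs w v] at hn; simpa using hn)
  exact ⟨k, by rw [h, hk]; simpa using hu⟩

theorem FULL {X : Subgroup (Sp B)} (hX : Irr X) {s : Sp B} {e f : V} (hs : IsS s e f) (hsX : s ∈ X) {v : V}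
    (hv : v ∈ Wm B e f) (hv0 : v ≠ 0) {g : Sp B} {n : V} {c : F} (hg : IsQ g v n c) (hgX : g ∈ X)
    (hn : B n v = 0) (hn0 : ∀ k : F, n ≠ k • v) : X = ⊤ := by
  have hfin : Finite V := Module.finite_of_finite F
  have hef := hs.hef
  obtain ⟨k, hk⟩ := W_part hef hv hv0 hn
  have hg := hg.shift k
  have hn0 : n - k • v ≠ 0 := sub_ne_zero.2 (hn0 k)
  clear hn
  generalize n - k • v = n at *
  generalize c + 2 * k = c at *
  have hsv : s • v = v := hs.fixW hv
  have hPv : ∀ n ∈ Wp B e f, B n v = 0 := by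
    intro n hn; rw [Bs, W_perp hv hn, neg_zero]
  let M : AddSubgroup V :=
    { carrier := {n | n ∈ Wp B e f ∧ ∃ c, ∃ g ∈ X, IsQ g v n c}
      add_mem' := by
        rintro n n' ⟨hn, c, g, hg, h⟩ ⟨hn', c', g', hg', h'⟩
        exact ⟨Submodule.add_mem _ hn hn', _, g * g', X.mul_mem hg hg', h.mul h' (hPv n hn) (hPv n' hn')⟩
      zero_mem' := ⟨Submodule.zero_mem _, 0, 1, X.one_mem, by intro x; simp⟩
      neg_mem' := by
        rintro n ⟨hn, c, g, hg, h⟩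
        refine ⟨Submodule.neg_mem _ hn, -c, g⁻¹, X.inv_mem hg, ?_⟩
        intro x
        rw [inv_smul_eq_iff, h]
        have := hPv n hn
        simp [hS.alt, this, Bs v n]
        module }
  have hsM : ∀ x ∈ M, s • x ∈ M := by
    rintro n ⟨hn, c, g, hg, h⟩
    refine ⟨hs.invP _ hn, c, s * g * s⁻¹, X.mul_mem (X.mul_mem hsX hg) (X.inv_mem hsX), ?_⟩
    have := h.conj s
    rwa [hsv] at this
  have hsMk : ∀ k : ℕ, ∀ x ∈ M, s^k • x ∈ M := by
    intro k
    induction k with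
    | zero => intro x hx; simpa using hx
    | succ k ih => intro x hx; rw [pow_succ, mul_smul]; exact ih _ (hsM _ hx)
  have hML : M ≤ (Wp B e f).toAddSubgroup := fun x hx => hx.1
  have hc1 : Nat.card M ∣ q^4 := by
    have := AddSubgroup.card_dvd_of_le hML
    have h2 : Nat.card (Wp B e f).toAddSubgroup = q^4 := by
      have := card_sub (Wp B e f)
      rw [finrank_Wp hef] at this
      exact this
    rwa [h2] at this
  have hc2 : orderOf s ∣ Nat.card M - 1 := by
    have h1 := free_dvd' (Subgroup.zpowers s) ((M : Set V) \ {0}) (by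
      intro g hg x hx
      obtain ⟨k, rfl⟩ := mem_powers_iff_mem_zpowers.2 hg
      exact ⟨hsMk k x hx.1, (smul_ne_zero_iff_ne _).2 hx.2⟩) (by
      intro g hg x hx hgx
      obtain ⟨k, rfl⟩ := mem_powers_iff_mem_zpowers.2 hg
      by_contra hne
      apply hx.2
      have h1 := hs.fixpow hne hgx
      have h2 : x ∈ Wp B e f := hML hx.1
      have h3 : x ∈ Wm B e f ⊓ Wp B e f := ⟨h1, h2⟩
      rwa [(W_compl hef).inf_eq_bot] at h3)
    rw [Nat.card_zpowers, Nat.card_coe_set_eq, Set.ncard_sdiff_singleton_of_mem M.zero_mem] at h1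
    exact h1
  have hMM : Nat.card M = q^4 := by
    obtain ⟨p, l, hp, -, hp5, hl, hq⟩ := q_pf B
    rw [hq, ← pow_mul] at hc1
    obtain ⟨k', hk1, hk2⟩ := (Nat.dvd_prime_pow hp).1 hc1
    have ho := hs.ford
    rw [hq] at ho
    rw [hk2] at hc2
    have := NT hp5 hl ho (by omega) (by
      rintro rfl
      have hM1 : Nat.card M = 1 := by rw [hk2]; simp
      have := AddSubgroup.card_eq_one.1 hM1
      have hnM : n ∈ M := ⟨hk, c, g, hgX, hg⟩
      rw [this] at hnM
      exact hn0 hnM) hc2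
    rw [hk2, this, hq, ← pow_mul, mul_comm]
  have hMe : ∀ n ∈ Wp B e f, ∃ c, ∃ g ∈ X, IsQ g v n c := by
    have h1 : Nat.card (Wp B e f).toAddSubgroup = q^4 := by
      have := card_sub (Wp B e f)
      rw [finrank_Wp hef] at this
      exact this
    have : M = (Wp B e f).toAddSubgroup := AddSubgroup.eq_of_le_of_card_ge hML (by rw [h1, hMM])
    intro n hn
    have : n ∈ M := by rw [this]; exact hn
    exact this.2
  have hvT : TP X v := by
    intro d
    obtain ⟨n', hn'⟩ := nd' (B := B) hn0
    obtain ⟨w, u, h, h1, h2⟩ := z_dec hef n'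
    have hw := (z_neg_iff hef w).1 h1
    have hu := mem_Wp.2 ((z_fix_iff hef u).1 h2)
    have hnu : B u n = -1 := by
      rw [h, map_add, Bs n w, W_perp hw hk] at hn'
      rw [Bs, ← hn']; simp
    obtain ⟨c', g', hg', h'⟩ := hMe ((-d/2) • u) (Submodule.smul_mem _ _ hu)
    have := hg.comm h' (hPv _ hk) (hPv _ (Submodule.smul_mem _ _ hu)) hgX hg'
    convert this using 2
    have := hS.two
    simp [hnu]; field_simp
  have hQ : ∀ n ∈ Wp B e f, ∀ c, ∃ g ∈ X, IsQ g v n c := by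
    intro n hn c
    obtain ⟨c', g, hg, h⟩ := hMe n hn
    refine ⟨t B v (c - c') * g, X.mul_mem (hvT _) hg, ?_⟩
    have := (IsQ.t (B := B) (v := v) (c := c - c')).mul h (by simp) (hPv n hn)
    convert this using 1 <;> simp
  have hoff : ∀ w, B w v ≠ 0 → TP X w := by
    intro w hw
    obtain ⟨g0, hg0, h0⟩ := hX.ex hv0 hv0
    set w0 := (B w v / B (g0 • v) v) • g0 • v with hw0
    have hw0T : TP X w0 := (hvT.smul hg0).scal _
    have hw0v : B w0 v = B w v := by rw [hw0]; simp [h0]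
    have hd : B (w - w0) v = 0 := by rw [map_sub, LinearMap.sub_apply, hw0v, sub_self]
    obtain ⟨k, hk⟩ := W_part hef hv hv0 hd
    set d := w - w0 - k • v with hdd
    obtain ⟨g, hg, hgQ⟩ := hQ ((B w v)⁻¹ • d) (Submodule.smul_mem _ _ hk)
      ((k - B w0 ((B w v)⁻¹ • d)) / B w v)
    have : g • w0 = w := by
      rw [hgQ, hw0v, smul_smul, mul_inv_cancel₀ hw, div_mul_cancel₀ _ hw, one_smul, hdd]
      rw [add_sub_cancel]; abel
    rw [← this]
    exact hw0T.smul hg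
  apply GEN
  intro x
  show TP X x
  by_cases hxv : B x v = 0
  · by_cases hx0 : x = 0
    · intro c; rw [hx0, t_zero']; exact X.one_mem
    obtain ⟨w, hw1, hw2⟩ : ∃ w, B w v ≠ 0 ∧ B x w ≠ 0 := by
      obtain ⟨y1, hy1⟩ := nd' (B := B) hv0
      obtain ⟨y2, hy2⟩ := nd' (B := B) hx0
      have hy1' : B y1 v ≠ 0 := by rw [Bs, hy1]; simp
      by_cases h1 : B x y1 = 0
      · by_cases h2 : B y2 v = 0
        · exact ⟨y1 + y2, by simpa [h2] using hy1', by simp [h1, hy2]⟩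
        · exact ⟨y2, h2, by rw [hy2]; simp⟩
      · exact ⟨y1, hy1', h1⟩
    have h1 := hoff w hw1
    have h2 := hoff (x + w) (by simpa [hxv] using hw1)
    have := h2.line h1 (by simpa [hS.alt] using hw2) (-1)
    simpa using this
  · exact hoff x hxv

end base
end
end PSP

open Module
set_option linter.unusedSectionVars false
set_option linter.unusedVariables false
set_option linter.style.longLine false
set_option linter.unnecessarySimpa false
set_option linter.unusedSimpArgs false
namespace PSP
noncomputable section
section base
variable {F : Type*} {V : Type*} [Field F] [Fintype F] [AddCommGroup V] [Module F V] [FiniteDimensional F V]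
variable {B : V →ₗ[F] V →ₗ[F] F}
variable [hS : Sy B]

local notation "q" => Fintype.card F

def IsZ (g : Sp B) : Prop := ∃ e f, B e f = 1 ∧ g = z B e f

theorem IsZ.sq {g : Sp B} (h : IsZ g) : g * g = 1 := by
  obtain ⟨e, f, hef, rfl⟩ := h; exact z_sq hef

theorem IsZ.sqs {g : Sp B} (h : IsZ g) (x : V) : g • g • x = x := by
  rw [← mul_smul, h.sq, one_smul]

theorem IsZ.dep {g : Sp B} (h : IsZ g) {x y : V} (hx : g • x = -x) (hy : g • y = -y) (h0 : x ≠ 0)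
    (hB : B x y = 0) : ∃ c : F, y = c • x := by
  obtain ⟨e, f, hef, rfl⟩ := h
  exact W_dep ((z_neg_iff hef x).1 hx) ((z_neg_iff hef y).1 hy) h0 hB

theorem fn_perp {g : Sp B} {x y : V} (hx : g • x = x) (hy : g • y = -y) : B x y = 0 := by
  have := Bg g x y
  rw [hx, hy, map_neg] at this
  have h2 : (2:F) * B x y = 0 := by linear_combination -this
  exact (mul_eq_zero.1 h2).resolve_left hS.two

theorem IsZ.perp {g : Sp B} (h : IsZ g) {x y : V} (hy : g • y = -y) (h0 : y ≠ 0)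
    (hB : B x y = 0) : ∃ k : F, g • x = x + k • y := by
  have h' := h
  obtain ⟨e, f, hef, rfl⟩ := h
  obtain ⟨w, u, h1, h2, h3⟩ := z_dec hef x
  have h4 := fn_perp h3 hy
  obtain ⟨c, hc⟩ := h'.dep hy h2 h0 (by
    rw [h1, map_add, LinearMap.add_apply, h4, add_zero] at hB
    rw [Bs, hB, neg_zero])
  refine ⟨-2 * c, ?_⟩
  rw [h1, smul_add, h2, h3, hc]; module

theorem IsZ.conj {g : Sp B} (h : IsZ g) (k : Sp B) : IsZ (k * g * k⁻¹) := by
  obtain ⟨e, f, hef, rfl⟩ := h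
  exact ⟨_, _, by rw [Bg, hef], z_conj k hef⟩

theorem IsZ.comm {g h : Sp B} (hg : IsZ g) (hc : g * h = h * g) (hh : h * h = 1) {x : V} (hx0 : x ≠ 0)
    (hx : g • x = -x) (hx' : h • x = x) {u : V} (hu : g • u = -u) : h • u = u := by
  have h1 : h • (u - h • u) = -(u - h • u) := by
    rw [smul_sub, ← mul_smul, hh, one_smul]; abel
  have h2 : g • (u - h • u) = -(u - h • u) := by
    rw [smul_sub, ← mul_smul, hc, mul_smul, hu, smul_neg]; abel
  obtain ⟨c, hc⟩ := hg.dep hx h2 hx0 (fn_perp hx' h1)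
  have h3 : h • (u - h • u) = u - h • u := by rw [hc, gc, hx']
  have := eq_zero_of_neg B (h3.symm.trans h1)
  exact (sub_eq_zero.1 this).symm

theorem L1 {X : Subgroup (Sp B)} (hX : Irr X) {s : Sp B} {e f : V} (hs : IsS s e f) (hsX : s ∈ X) {v : V}
    (hv : v ∈ Wm B e f) (hv0 : v ≠ 0) {a : F} (ha : a ≠ 0) (htX : t B v a ∈ X) (hzX : z B e f ∈ X) : X = ⊤ := by
  by_contra hne
  have h2 := hS.two
  have hef := hs.hef
  let Om : V → Prop := fun y => ∃ h ∈ X, y = h • v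
  have Om0 : ∀ y, Om y → y ≠ 0 := by
    rintro _ ⟨h, hh, rfl⟩; exact (smul_ne_zero_iff_ne _).2 hv0
  have OmS : ∀ g ∈ X, ∀ y, Om y → Om (g • y) := by
    rintro g hg _ ⟨h, hh, rfl⟩; exact ⟨g * h, X.mul_mem hg hh, by rw [mul_smul]⟩
  have hQ : ∀ y, Om y → ∀ g ∈ X, ∀ n c, IsQ g y n c → B n y = 0 → ∃ k : F, n = k • y := by
    rintro _ ⟨h, hh, rfl⟩ g hg n c hgQ hn
    by_contra! hc
    apply hne
    have h1 := hgQ.conj h⁻¹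
    rw [inv_smul_smul] at h1
    refine FULL hX hs hsX hv hv0 h1 (X.mul_mem (X.mul_mem (X.inv_mem hh) hg) (X.inv_mem (X.inv_mem hh))) ?_ ?_
    · rw [Bgi, inv_inv, hn]
    · intro k hk
      apply hc k
      rw [inv_smul_eq_iff] at hk
      rw [hk, gc]
  have U : ∀ y, Om y → ∀ z1 ∈ X, ∀ z2 ∈ X, IsZ z1 → IsZ z2 → z1 • y = -y → z2 • y = -y → z1 = z2 := by
    intro y hy z1 h1 z2 h2' i1 i2 n1 n2
    obtain ⟨y', hy'⟩ := nd' (B := B) (Om0 y hy)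
    obtain ⟨hd, hQ1⟩ := exQ (g := z1 * z2) (v := y) (f := -y') (by simp [Bs y' y, hy'])
      (by rw [mul_smul, n2, smul_neg, n1, neg_neg]) (by
        intro x hx
        obtain ⟨k, hk⟩ := i2.perp n2 (Om0 y hy) hx
        obtain ⟨l, hl⟩ := i1.perp n1 (Om0 y hy) hx
        exact ⟨l - k, by rw [mul_smul, hk, smul_add, hl, gc, n1]; module⟩)
    obtain ⟨k, hk⟩ := hQ y hy _ (X.mul_mem h1 h2') _ _ hQ1 hd
    have h3 := hQ1.shift k
    rw [hk, sub_self] at h3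
    generalize -(B (-y')) (k • y) + 2 * k = c at h3
    have h4 := h3.eq_t
    have h5 := t_conj z1 y c
    have h6 : t B (z1 • y) c = t B y c := by
      rw [n1, show -y = (-1:F) • y by simp, t_smul_v]; congr 1; ring
    rw [h6, ← h4] at h5
    have h7 : (z1 * z2) * (z1 * z2) = 1 := by
      nth_rewrite 1 [← h5]
      have : z1⁻¹ = z1 := by rw [inv_eq_iff_mul_eq_one]; exact i1.sq
      rw [this]
      calc z1 * (z1 * z2) * z1 * (z1 * z2) = (z1 * z1) * z2 * (z1 * z1) * z2 := by group
        _ = 1 := by rw [i1.sq]; simp [i2.sq]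
    rw [h4, t_mul] at h7
    have h8 := t_eq_one (Om0 y hy) h7
    have h9 : c = 0 := by
      have : (2:F) * c = 0 := by linear_combination h8
      exact (mul_eq_zero.1 this).resolve_left h2
    rw [h9, t_zero] at h4
    have : z2⁻¹ = z2 := by rw [inv_eq_iff_mul_eq_one]; exact i2.sq
    rw [← this]; exact eq_inv_of_mul_eq_one_left h4
  have hzv : z B e f • v = -v := (z_neg_iff hef v).2 hv
  have exZ : ∀ y, Om y → ∃ g ∈ X, IsZ g ∧ g • y = -y := by
    rintro _ ⟨h, hh, rfl⟩
    exact ⟨h * z B e f * h⁻¹, X.mul_mem (X.mul_mem hh hzX) (X.inv_mem hh), IsZ.conj ⟨e, f, hef, rfl⟩ h, by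
      rw [mul_smul, mul_smul, inv_smul_smul, hzv, smul_neg]⟩
  choose! Z ZX ZZ Zn using exZ
  have uq : ∀ y, Om y → ∀ g ∈ X, IsZ g → g • y = -y → g = Z y := fun y hy g hg hz hn =>
    U y hy g hg _ (ZX y hy) hz (ZZ y hy) hn (Zn y hy)
  have cj : ∀ g ∈ X, ∀ y, Om y → g * Z y * g⁻¹ = Z (g • y) := fun g hg y hy =>
    uq _ (OmS g hg y hy) _ (X.mul_mem (X.mul_mem hg (ZX y hy)) (X.inv_mem hg)) ((ZZ y hy).conj g) (by
      rw [mul_smul, mul_smul, inv_smul_smul, Zn y hy, smul_neg])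
  have cm : ∀ g ∈ X, ∀ y, Om y → (g • y = y ∨ g • y = -y) → g * Z y = Z y * g := by
    intro g hg y hy h
    have : g * Z y * g⁻¹ = Z y := by
      apply uq y hy _ (X.mul_mem (X.mul_mem hg (ZX y hy)) (X.inv_mem hg)) ((ZZ y hy).conj g)
      rw [mul_smul, mul_smul]
      rcases h with h | h
      · have : g⁻¹ • y = y := by rw [inv_smul_eq_iff, h]
        rw [this, Zn y hy, smul_neg, h]
      · have : g⁻¹ • y = -y := by rw [inv_smul_eq_iff, smul_neg, h, neg_neg]
        rw [this, smul_neg, Zn y hy, neg_neg, h]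
    rw [mul_inv_eq_iff_eq_mul] at this
    exact this
  have tX : ∀ y, Om y → t B y a ∈ X := by
    rintro _ ⟨h, hh, rfl⟩
    rw [← t_conj]; exact X.mul_mem (X.mul_mem hh htX) (X.inv_mem hh)
  have p1 : ∀ x y, Om x → Om y → B x y = 0 → Z x • y = y ∨ Z x • y = -y := by
    intro x y hx hy hB
    have h1 := cm _ (tX y hy) x hx (Or.inl (by simp [hB]))
    rw [t_conj'] at h1
    have h3 := mul_right_cancel h1
    obtain ⟨c, hc, h4⟩ := t_eq (Om0 y hy) ha h3
    have h5 := (ZZ x hx).sqs y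
    rw [h4, gc, h4, smul_smul] at h5
    have h6 : (c * c - 1) • y = 0 := by rw [sub_smul, h5]; simp
    have h7 := (smul_eq_zero.1 h6).resolve_right (Om0 y hy)
    have h8 : (c - 1) * (c + 1) = 0 := by linear_combination h7
    rcases mul_eq_zero.1 h8 with h9 | h9
    · left; rw [h4, sub_eq_zero.1 h9, one_smul]
    · right; rw [h4, eq_neg_of_add_eq_zero_left h9, neg_one_smul]
  have p2 : ∀ x y, Om x → Om y → (Z y • x = x ∨ Z y • x = -x) ∨ Z x • Z y • x = Z y • x := by
    intro x y hx hy
    have hO := OmS _ (ZX y hy) x hx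
    have h1 : B x (Z y • x) = 0 := by
      have h3 := Bg (Z y) x (Z y • x)
      rw [(ZZ y hy).sqs, Bs] at h3
      have : (2:F) * B x (Z y • x) = 0 := by linear_combination -h3
      exact (mul_eq_zero.1 this).resolve_left h2
    rcases p1 x _ hx hO h1 with h3 | h3
    · right; exact h3
    · left
      obtain ⟨c, h4⟩ := (ZZ x hx).dep (Zn x hx) h3 (Om0 x hx) h1
      have h5 := (ZZ y hy).sqs x
      rw [h4, gc, h4, smul_smul] at h5
      have h6 : (c * c - 1) • x = 0 := by rw [sub_smul, h5]; simp
      have h7 := (smul_eq_zero.1 h6).resolve_right (Om0 x hx)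
      have h8 : (c - 1) * (c + 1) = 0 := by linear_combination h7
      rcases mul_eq_zero.1 h8 with h9 | h9
      · left; rw [h4, sub_eq_zero.1 h9, one_smul]
      · right; rw [h4, eq_neg_of_add_eq_zero_left h9, neg_one_smul]
  have p3 : ∀ x y, Om x → Om y → Z y • x = x ∨ Z y • x = -x := by
    intro x y hx hy
    by_contra hcon
    have hη : B x y ≠ 0 := by
      intro h0
      exact hcon (p1 y x hy hx (by rw [Bs, h0, neg_zero]))
    have hxy : ¬ (Z x • y = y ∨ Z x • y = -y) := by
      intro h
      have h3 := cm _ (ZX x hx) y hy h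
      have h4 : Z x • Z y • x = - (Z y • x) := by
        rw [← mul_smul, h3, mul_smul, Zn x hx, smul_neg]
      rcases p2 x y hx hy with h5 | h5
      · exact hcon h5
      · rw [h5] at h4
        have := eq_zero_of_neg B h4
        exact Om0 x hx ((smul_eq_zero_iff_eq _).1 this)
    set x' := t B y a • x with hx'
    have hOx' : Om x' := OmS _ (tX y hy) x hx
    have ex' : x' = x + (a * B x y) • y := by rw [hx', t_smul]
    have byy : B (Z x • y) y = 0 := by
      have h3 := Bg (Z x) y (Z x • y)
      rw [(ZZ x hx).sqs, Bs y] at h3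
      have : (2:F) * B (Z x • y) y = 0 := by linear_combination h3
      exact (mul_eq_zero.1 this).resolve_left h2
    have bxy : B x (Z x • y) = - B x y := by
      have h3 := Bg (Z x) x (Z x • y)
      rw [(ZZ x hx).sqs, Zn x hx, map_neg, LinearMap.neg_apply] at h3
      exact h3.symm
    have f1 : Z x' • (y - Z x • y) = -(y - Z x • y) := by
      rw [hx', ← cj _ (tX y hy) x hx, mul_smul, mul_smul]
      have h3 : t B y a • (y - Z x • y) = y - Z x • y := by
        rw [t_smul, map_sub, LinearMap.sub_apply, hS.alt, byy]; simp
      have h4 : (t B y a)⁻¹ • (y - Z x • y) = y - Z x • y := by rw [inv_smul_eq_iff, h3]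
      rw [h4, smul_sub (Z x), (ZZ x hx).sqs, ← neg_sub, smul_neg, h3]
    have f2 : Z x • x' = -x + (a * B x y) • Z x • y := by
      rw [ex', smul_add, Zn x hx, gc]
    have f3 : ¬ (Z x • x' = x' ∨ Z x • x' = -x') := by
      rintro (h | h)
      · have := fn_perp h (Zn x hx)
        rw [ex', map_add, LinearMap.add_apply, hS.alt, map_smul, LinearMap.smul_apply, Bs y x] at this
        simp [ha, hη] at this
      · apply hxy
        right
        rw [f2, ex', neg_add, add_right_inj, ← smul_neg] at h
        exact smul_right_injective _ (mul_ne_zero ha hη) h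
    have f4 := (p2 x' x hOx' hx).resolve_left f3
    have f5 := fn_perp f4 f1
    rw [f2] at f5
    simp only [map_add, map_sub, LinearMap.add_apply, map_smul, LinearMap.smul_apply, map_neg, LinearMap.neg_apply,
      hS.alt, byy, bxy, smul_eq_mul] at f5
    have : (2:F) * B x y = 0 := by linear_combination -f5
    exact hη ((mul_eq_zero.1 this).resolve_left h2)
  have Ov : Om v := ⟨1, X.one_mem, by simp⟩
  have Zv : z B e f = Z v := uq v Ov _ hzX ⟨e, f, hef, rfl⟩ hzv
  have hsv : s • v = v := hs.fixW hv
  have hsz : s * z B e f = z B e f * s := by rw [Zv]; exact cm s hsX v Ov (Or.inl hsv)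
  obtain ⟨x, Ox, hzx⟩ : ∃ x, Om x ∧ z B e f • x = x := by
    have : Wp B e f ≠ ⊥ := by
      intro h
      have := finrank_Wp hef
      rw [h] at this; simp at this
    obtain ⟨w, hw, hw0⟩ := Submodule.exists_mem_ne_zero_of_ne_bot this
    obtain ⟨g, hg, hB⟩ := hX.ex hv0 hw0
    have Ox : Om (g • v) := OmS g hg v Ov
    refine ⟨g • v, Ox, ?_⟩
    rcases p3 _ v Ox Ov with h | h
    · rw [Zv]; exact h
    · rw [← Zv, z_neg_iff hef] at h
      exact absurd (W_perp h hw) hB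
  have N : s * Z x ≠ Z x * s := by
    intro h
    obtain ⟨e', f', hef', h'⟩ := ZZ x Ox
    have hi : Inv s (Wm B e' f') := by
      intro y hy
      rw [mem_Wm, ← z_neg_iff hef', ← h'] at *
      rw [← mul_smul, ← h, mul_smul, hy, smul_neg]
    rcases hs.inv _ hi with h3 | h3
    · have h4 : x ∈ Wm B e' f' := by
        rw [mem_Wm, ← z_neg_iff hef', ← h']; exact Zn x Ox
      have h5 := (z_neg_iff hef x).2 (h3 h4)
      rw [hzx] at h5
      exact Om0 x Ox (eq_zero_of_neg B h5)
    · have := Submodule.finrank_mono h3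
      rw [finrank_Wp hef, finrank_Wm hef'] at this
      omega
  have Osx := OmS s hsX x Ox
  have zs : z B e f • s • x = s • x := by rw [← mul_smul, ← hsz, mul_smul, hzx]
  rcases p3 _ x Osx Ox with h3 | h3
  swap
  · have h4 := uq _ Osx _ (ZX x Ox) (ZZ x Ox) h3
    rw [← cj s hsX x Ox, eq_mul_inv_iff_mul_eq] at h4
    exact N h4.symm
  have Ossx := OmS s hsX _ Osx
  rcases p3 _ x Ossx Ox with h4 | h4
  swap
  · have h5 := uq _ Ossx _ (ZX x Ox) (ZZ x Ox) h4
    rw [← cj s hsX _ Osx, ← cj s hsX x Ox] at h5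
    have h6 : Commute (s^2) (Z x) := by
      show s^2 * Z x = Z x * s^2
      nth_rewrite 2 [h5]; rw [pow_two]; group
    apply N
    have ho := hs.ford
    have hq := q_odd B
    have h7 : orderOf s % 2 = 1 := by
      obtain ⟨k, hk⟩ : ∃ k, q = 2 * k + 1 := ⟨q / 2, by omega⟩
      rw [hk] at ho
      have : orderOf s = 2 * (k * k + k) + 1 := by nlinarith
      omega
    obtain ⟨l, hl⟩ : ∃ l, orderOf s = 2 * l + 1 := ⟨orderOf s / 2, by omega⟩
    have h8 : s = (s^2)^(l+1) := by
      rw [← pow_mul, show 2 * (l+1) = orderOf s + 1 by omega, pow_succ, pow_orderOf_eq_one, one_mul]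
    have := h6.pow_left (l+1)
    rw [← h8] at this
    exact this
  · -- all orthogonal
    obtain ⟨e1, f1, hef1, hz1⟩ := ZZ x Ox
    obtain ⟨e2, f2, hef2, hz2⟩ := ZZ _ Osx
    have c1 : Z x * z B e f = z B e f * Z x := (cm _ hzX x Ox (Or.inl hzx)).symm
    have c2 : Z (s • x) * z B e f = z B e f * Z (s • x) := (cm _ hzX _ Osx (Or.inl zs)).symm
    have c3 : Z (s • x) * Z x = Z x * Z (s • x) := (cm _ (ZX x Ox) _ Osx (Or.inl h3)).symm
    have l1 : Wm B e1 f1 ≤ Wp B e f := by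
      intro u hu
      rw [mem_Wm, ← z_neg_iff hef1, ← hz1] at hu
      rw [mem_Wp, ← z_fix_iff hef]
      exact (ZZ x Ox).comm c1 (z_sq hef) (Om0 x Ox) (Zn x Ox) hzx hu
    have l2 : Wm B e2 f2 ≤ Wp B e f := by
      intro u hu
      rw [mem_Wm, ← z_neg_iff hef2, ← hz2] at hu
      rw [mem_Wp, ← z_fix_iff hef]
      exact (ZZ _ Osx).comm c2 (z_sq hef) (Om0 _ Osx) (Zn _ Osx) zs hu
    have l3 : Wm B e1 f1 ⊓ Wm B e2 f2 = ⊥ := by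
      rw [eq_bot_iff]
      rintro u ⟨h1, h2⟩
      have h1 : u ∈ Wm B e1 f1 := h1
      have h2 : u ∈ Wm B e2 f2 := h2
      rw [mem_Wm, ← z_neg_iff hef1, ← hz1] at h1
      rw [mem_Wm, ← z_neg_iff hef2, ← hz2] at h2
      have := (ZZ _ Osx).comm c3 (ZZ x Ox).sq (Om0 _ Osx) (Zn _ Osx) h3 h2
      exact eq_zero_of_neg B (this.symm.trans h1)
    have l4 : Wm B e1 f1 ⊔ Wm B e2 f2 = Wp B e f := by
      apply Submodule.eq_of_le_of_finrank_le (sup_le l1 l2)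
      have := Submodule.finrank_sup_add_finrank_inf_eq (Wm B e1 f1) (Wm B e2 f2)
      rw [l3, finrank_Wm hef1, finrank_Wm hef2, finrank_bot] at this
      rw [finrank_Wp hef]; omega
    have zss : z B e f • s • s • x = s • s • x := by rw [← mul_smul, ← hsz, mul_smul, zs]
    have k2 : Z (s • x) • s • s • x = s • s • x := by
      rw [← cj s hsX x Ox, mul_smul, mul_smul, inv_smul_smul, h3]
    apply Om0 _ Ossx
    apply hS.nd
    intro w
    obtain ⟨w1, u, hw, hw1, hu⟩ := z_dec hef w
    have hu' : u ∈ Wp B e f := by rw [mem_Wp, ← z_fix_iff hef]; exact hu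
    rw [← l4, Submodule.mem_sup] at hu'
    obtain ⟨u1, hu1, u2, hu2, rfl⟩ := hu'
    rw [mem_Wm, ← z_neg_iff hef1, ← hz1] at hu1
    rw [mem_Wm, ← z_neg_iff hef2, ← hz2] at hu2
    rw [hw, map_add, map_add, fn_perp zss hw1, fn_perp h4 hu1, fn_perp k2 hu2]; simp

end base
end
end PSP

open Module
set_option linter.unusedSectionVars false
set_option linter.unusedVariables false
set_option linter.style.longLine false
set_option linter.unnecessarySimpa false
set_option linter.unusedSimpArgs false
namespace PSP
noncomputable section
section base
variable {F : Type*} {V : Type*} [Field F] [Fintype F] [AddCommGroup V] [Module F V] [FiniteDimensional F V]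
variable {B : V →ₗ[F] V →ₗ[F] F}
variable [hS : Sy B]

local notation "q" => Fintype.card F

theorem ex_perp {M : Submodule F V} (hM : M ≠ ⊤) : ∃ x, x ≠ 0 ∧ ∀ y ∈ M, B x y = 0 := by
  obtain ⟨f, hf, hle⟩ := Submodule.exists_le_ker_of_lt_top M (lt_top_iff_ne_top.2 hM)
  have hinj : Function.Injective B := by
    rw [← LinearMap.ker_eq_bot, LinearMap.ker_eq_bot']
    intro x hx
    apply hS.nd
    intro y; rw [hx]; rfl
  have hsurj := (LinearMap.injective_iff_surjective_of_finrank_eq_finrank (f := B) (Subspace.dual_finrank_eq (K := F) (V := V)).symm).1 hinj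
  obtain ⟨x, rfl⟩ := hsurj f
  refine ⟨x, ?_, fun y hy => hle hy⟩
  rintro rfl; simp at hf

def LI (g : Sp B) (x : V) : Prop := ∃ c : F, g • x = c • x

theorem RED {X : Subgroup (Sp B)} (hX : X ≠ ⊤) {s : Sp B} {e f : V} (hs : IsS s e f) (hsX : s ∈ X) {v : V}
    (hv : v ∈ Wm B e f) (hv0 : v ≠ 0) {a : F} (ha : a ≠ 0) (htX : t B v a ∈ X) (hzX : z B e f ∈ X) :
    (∃ x, x ≠ 0 ∧ ∀ g ∈ X, LI g x) ∨ (∀ g ∈ X, Inv g (Wm B e f)) := by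
  have hef := hs.hef
  have h1 : ¬ Irr X := fun h => hX (L1 h hs hsX hv hv0 ha htX hzX)
  unfold Irr at h1
  push Not at h1
  obtain ⟨M, hM, hb, ht⟩ := h1
  obtain ⟨M', hM', hb', hle⟩ : ∃ M' : Submodule F V, (∀ g ∈ X, Inv g M') ∧ M' ≠ ⊥ ∧ M' ≤ Wm B e f := by
    rcases hs.inv M (hM s hsX) with h | h
    · exact ⟨M, hM, hb, h⟩
    · obtain ⟨x, hx0, hx⟩ := ex_perp (B := B) ht
      let M' : Submodule F V :=
        { carrier := {x | ∀ y ∈ M, B x y = 0}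
          add_mem' := by
            intro a b ha hb y hy
            rw [map_add, LinearMap.add_apply, ha y hy, hb y hy, add_zero]
          zero_mem' := by intro y hy; simp
          smul_mem' := by
            intro c x hx y hy
            rw [map_smul, LinearMap.smul_apply, hx y hy, smul_zero] }
      refine ⟨M', ?_, ?_, ?_⟩
      · intro g hg x hx y hy
        rw [Bgi]
        exact hx _ (hM _ (X.inv_mem hg) y hy)
      · intro h0
        have : x ∈ M' := hx
        rw [h0] at this
        exact hx0 this
      · intro y hy
        obtain ⟨w, u, h1, h2, h3⟩ := z_dec hef y
        have hw := (z_neg_iff hef w).1 h2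
        have hu : u = 0 := by
          apply hS.nd
          intro y'
          obtain ⟨w', u', h1', h2', h3'⟩ := z_dec hef y'
          rw [h1', map_add, fn_perp h3 h2', zero_add]
          have hu' : u' ∈ M := h (by rw [mem_Wp, ← z_fix_iff hef]; exact h3')
          have := hy u' hu'
          rw [h1, map_add, LinearMap.add_apply, Bs w, fn_perp h3' h2] at this
          simpa using this
        rw [h1, hu, add_zero]; exact hw
  have hd := Submodule.finrank_mono hle
  rw [finrank_Wm hef] at hd
  have h0 : finrank F M' ≠ 0 := by
    rw [Ne, Submodule.finrank_eq_zero]; exact hb'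
  by_cases h2 : finrank F M' = 2
  · right
    have := Submodule.eq_of_le_of_finrank_eq hle (by rw [h2, finrank_Wm hef])
    rw [← this]; exact hM'
  · left
    have h1 : finrank F M' = 1 := by omega
    obtain ⟨x, hx, hx0⟩ := Submodule.exists_mem_ne_zero_of_ne_bot hb'
    refine ⟨x, hx0, fun g hg => ?_⟩
    obtain ⟨c, hc⟩ := exists_smul_eq_of_finrank_eq_one h1 (x := ⟨x, hx⟩) (by simpa [Subtype.ext_iff] using hx0) ⟨g • x, hM' g hg x hx⟩
    exact ⟨c, (congrArg Subtype.val hc).symm⟩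

/-- L3 -/
theorem L3 {a c : Sp B} {N M : ℕ} (hN : 2*N = q^3+1) (ha : PO a N) (hM : 2*M+1 = q^3) (hc : PO c M)
    {X : Subgroup (Sp B)} (haX : a ∈ X) (hcX : c ∈ X) (hnX : nu B ∈ X)
    {s : Sp B} {e f : V} (hs : IsS s e f) (hsX : s ∈ X) (hzX : z B e f ∈ X)
    {y : Sp B} (hyX : y ∈ X) {v : V} (hv0 : v ≠ 0) (hyv : y • v = v)
    (hyz : ∀ g : Sp B, IsZ g → y * g ≠ g * y) : X = ⊤ := by
  have hfin : Finite V := Module.finite_of_finite F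
  have hef := hs.hef
  obtain ⟨h, hh, hw⟩ : ∃ h ∈ X, h • v ∈ Wm B e f := by
    by_contra! hcon
    have h1 := free_dvd' (Subgroup.zpowers s) (MulAction.orbit X v) (by
      rintro g hg _ ⟨h, rfl⟩
      have : g ∈ X := (Subgroup.zpowers_le.2 hsX) hg
      exact ⟨⟨g, this⟩ * h, by simp only [mul_smul]; rfl⟩) (by
      rintro g hg _ ⟨h, rfl⟩ hgx
      obtain ⟨k, rfl⟩ := mem_powers_iff_mem_zpowers.2 hg
      by_contra hne
      exact hcon h.1 h.2 (hs.fixpow hne hgx))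
    obtain ⟨k, hk⟩ := ORB hN ha hM hc haX hcX hnX hv0
    rw [Nat.card_zpowers] at h1
    have ho := hs.ford
    have hq := q_five B
    have hle : Nat.card (MulAction.orbit X v) + 1 ≤ q^6 := by
      rw [Nat.card_coe_set_eq, ← card_V B, ← Set.ncard_univ]
      rw [← Set.ncard_insert_of_notMem (a := (0:V)) (s := MulAction.orbit X v)]
      · exact Set.ncard_le_ncard (Set.subset_univ _)
      · rintro ⟨g, hg⟩
        exact hv0 ((smul_eq_zero_iff_eq g).1 hg)
    have h0 : Nat.card (MulAction.orbit X v) ≠ 0 := by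
      rw [Nat.card_coe_set_eq]
      exact ((Set.ncard_pos (Set.toFinite _)).2 (MulAction.nonempty_orbit v)).ne'
    have hq6 : 1 ≤ q^6 := Nat.one_le_pow _ _ (by omega)
    obtain ⟨r, hr⟩ : ∃ r, q^6 = r + 1 := ⟨q^6-1, by omega⟩
    have hm : orderOf s ∣ 2 * (q^6 - 1) := by
      rw [hr] at hk hle ⊢
      simp only [Nat.add_sub_cancel] at hk ⊢
      have hk0 : k ≠ 0 := by rintro rfl; omega
      have hk2 : k ≤ 2 := by
        by_contra h3
        have : 3 * r ≤ k * r := Nat.mul_le_mul_right _ (by omega)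
        omega
      have : orderOf s ∣ k * r := by rw [← hk]; exact Dvd.dvd.mul_left h1 2
      interval_cases k
      · exact absurd rfl hk0
      · rw [one_mul] at this; exact Dvd.dvd.mul_left this 2
      · exact this
    have h6 : 2 * orderOf s ∣ q^6 + 1 := by
      rw [ho]; exact ⟨q^4 - q^2 + 1, by
        have : q^2 ≤ q^4 := Nat.pow_le_pow_right (by omega) (by norm_num)
        zify [this]; ring⟩
    have h7 : orderOf s ∣ 4 := by
      have h8 : orderOf s ∣ 2 * (q^6 + 1) := Dvd.dvd.mul_left ((Dvd.intro_left 2 rfl).trans h6) 2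
      have := (Nat.dvd_sub h8 hm)
      have e : 2 * (q^6+1) - 2 * (q^6-1) = 4 := by omega
      rwa [e] at this
    have := Nat.le_of_dvd (by norm_num) h7
    nlinarith
  set w := h • v with hwdef
  have hw0 : w ≠ 0 := (smul_ne_zero_iff_ne _).2 hv0
  set y' := h * y * h⁻¹ with hy'
  have hy'X : y' ∈ X := X.mul_mem (X.mul_mem hh hyX) (X.inv_mem hh)
  have hy'w : y' • w = w := by rw [hy', hwdef, mul_smul, mul_smul, inv_smul_smul, hyv]
  have hy'z : ∀ g : Sp B, IsZ g → y' * g ≠ g * y' := by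
    intro g hg hcomm
    apply hyz (h⁻¹ * g * h⁻¹⁻¹) (hg.conj _)
    have : y = h⁻¹ * y' * h := by rw [hy']; group
    rw [this]
    calc h⁻¹ * y' * h * (h⁻¹ * g * h⁻¹⁻¹) = h⁻¹ * (y' * g) * h := by group
      _ = h⁻¹ * (g * y') * h := by rw [hcomm]
      _ = _ := by group
  clear_value y' w
  set z0 := z B e f with hz0
  have iz : IsZ z0 := ⟨e, f, hef, rfl⟩
  have zw : z0 • w = -w := (z_neg_iff hef w).2 hw
  have hinv : z0⁻¹ = z0 := by rw [inv_eq_iff_mul_eq_one]; exact iz.sq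
  have iz' := iz.conj y'
  have zw' : (y' * z0 * y'⁻¹) • w = -w := by
    rw [mul_smul, mul_smul, show y'⁻¹ • w = w by rw [inv_smul_eq_iff, hy'w], zw, smul_neg, hy'w]
  set g := (y' * z0 * y'⁻¹) * z0 with hg
  have hgX : g ∈ X := X.mul_mem (X.mul_mem (X.mul_mem hy'X hzX) (X.inv_mem hy'X)) hzX
  obtain ⟨w', hww'⟩ := nd' (B := B) hw0
  obtain ⟨hd, hQ1⟩ := exQ (g := g) (v := w) (f := -w') (by simp [Bs w' w, hww'])
    (by rw [hg, mul_smul, zw, smul_neg, zw', neg_neg]) (by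
      intro x hx
      obtain ⟨k, hk⟩ := iz.perp zw hw0 hx
      obtain ⟨l, hl⟩ := iz'.perp zw' hw0 hx
      exact ⟨l - k, by rw [hg, mul_smul, hk, smul_add, hl, gc, zw']; module⟩)
  obtain ⟨k, hk⟩ := W_part hef hw hw0 hd
  have hQ2 := hQ1.shift k
  generalize g • -w' - -w' - k • w = n at hk hQ2
  generalize -(B (-w')) (g • -w' - -w') + 2 * k = b at hQ2
  by_cases hn : n = 0
  · exfalso
    rw [hn] at hQ2
    have h4 := hQ2.eq_t
    have h5 := t_conj z0 w b
    have h6 : t B (z0 • w) b = t B w b := by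
      rw [zw, show -w = (-1:F) • w by simp, t_smul_v]; congr 1; ring
    rw [h6, ← h4] at h5
    have h7 : g * g = 1 := by
      nth_rewrite 1 [← h5]
      rw [hinv, hg]
      calc z0 * (y' * z0 * y'⁻¹ * z0) * z0 * (y' * z0 * y'⁻¹ * z0)
          = z0 * (y' * z0 * y'⁻¹) * (z0 * z0) * (y' * z0 * y'⁻¹) * z0 := by group
        _ = z0 * ((y' * z0 * y'⁻¹) * (y' * z0 * y'⁻¹)) * z0 := by rw [iz.sq]; group
        _ = 1 := by rw [iz'.sq, mul_one, iz.sq]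
    rw [h4, t_mul] at h7
    have h8 := t_eq_one hw0 h7
    have h9 : b = 0 := by
      have : (2:F) * b = 0 := by linear_combination h8
      exact (mul_eq_zero.1 this).resolve_left hS.two
    rw [h9, t_zero, hg] at h4
    apply hy'z z0 iz
    have := eq_inv_of_mul_eq_one_left h4
    rw [hinv, mul_inv_eq_iff_eq_mul] at this
    exact this
  · have hPw : ∀ n ∈ Wp B e f, B n w = 0 := by
      intro n hn; rw [Bs, W_perp hw hn, neg_zero]
    have hsw : s • w = w := hs.fixW hw
    obtain ⟨k, hkn⟩ : ∃ k : ℕ, B (s^k • n) n ≠ 0 := by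
      by_contra! hcon
      let L : Submodule F V := Submodule.span F (Set.range (fun k : ℕ => s^k • n))
      have hL : Inv s L := by
        intro x hx
        induction hx using Submodule.span_induction with
        | mem x hx =>
          obtain ⟨k, rfl⟩ := hx
          apply Submodule.subset_span
          exact ⟨k+1, by simp only [pow_succ', mul_smul]⟩
        | zero => rw [smul_zero]; exact L.zero_mem
        | add x y _ _ hx hy => rw [smul_add]; exact L.add_mem hx hy
        | smul c x _ hx => rw [gc]; exact L.smul_mem _ hx
      have hle : L ≤ LinearMap.ker (B.flip n) := by
        rw [Submodule.span_le]
        rintro _ ⟨k, rfl⟩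
        exact hcon k
      have hnL : n ∈ L := Submodule.subset_span ⟨0, by simp⟩
      rcases hs.inv L hL with h1 | h1
      · have h3 : n ∈ Wm B e f ⊓ Wp B e f := ⟨h1 hnL, hk⟩
        rw [(W_compl hef).inf_eq_bot] at h3
        exact hn h3
      · apply hn
        apply hS.nd
        intro x
        obtain ⟨w1, u, h2, h3, h4⟩ := z_dec hef x
        have h5 : B u n = 0 := (h1.trans hle) (by rw [mem_Wp, ← z_fix_iff hef]; exact h4)
        rw [h2, map_add, Bs n u, h5, fn_perp ((z_fix_iff hef n).2 (mem_Wp.1 hk)) h3]; simp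
    have h1 := hQ2.conj (s^k)
    rw [fix_pow hsw] at h1
    have hsk : s^k ∈ X := X.pow_mem hsX k
    have := hQ2.comm h1 (hPw _ hk) (hPw _ (hs.invP.pow k _ hk)) hgX (X.mul_mem (X.mul_mem hsk hgX) (X.inv_mem hsk))
    exact ACT hN ha hM hc haX hcX hnX hw0 (mul_ne_zero hS.two hkn) this

end base
end
end PSP

open Module
set_option linter.unusedSectionVars false
set_option linter.unusedVariables false
set_option linter.style.longLine false
set_option linter.unnecessarySimpa false
set_option linter.unusedSimpArgs false
namespace PSP
noncomputable section
section base
variable {F : Type*} {V : Type*} [Field F] [Fintype F] [AddCommGroup V] [Module F V] [FiniteDimensional F V]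
variable {B : V →ₗ[F] V →ₗ[F] F}
variable [hS : Sy B]

local notation "q" => Fintype.card F

def En (g : Sp B) : Module.End F V := (g.1 : V →ₗ[F] V)
theorem En_apply (g : Sp B) (x : V) : En g x = g • x := rfl
theorem En_mul (g h : Sp B) : En (g * h) = En g * En h := rfl
theorem En_one : En (1 : Sp B) = 1 := rfl
theorem En_pow (g : Sp B) (n : ℕ) : En (g ^ n) = En g ^ n := by
  induction n with
  | zero => rfl
  | succ k ih => rw [pow_succ, pow_succ, En_mul, ih]
theorem En_inj {g h : Sp B} (H : En g = En h) : g = h := sp_ext (fun x => by rw [← En_apply, H, En_apply])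

def Ak (N : Module.End F V) (k : ℕ) (f : Module.End F V) : Prop := ∀ i x, (N^(i+k)) x = 0 → (N^i) (f x) = 0

variable {N : Module.End F V}

theorem Ak.mul {k l : ℕ} {f g : Module.End F V} (hf : Ak N k f) (hg : Ak N l g) : Ak N (k+l) (f * g) := by
  intro i x hx
  exact hf i _ (hg (i+k) x (by rwa [← add_assoc] at hx))
theorem Ak.mul' {k l m : ℕ} {f g : Module.End F V} (hf : Ak N k f) (hg : Ak N l g) (h : k + l = m) : Ak N m (f * g) := by
  rw [← h]; exact hf.mul hg
theorem Ak.add {k : ℕ} {f g : Module.End F V} (hf : Ak N k f) (hg : Ak N k g) : Ak N k (f + g) := by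
  intro i x hx
  rw [LinearMap.add_apply, map_add, hf i x hx, hg i x hx, add_zero]
theorem Ak.smul {k : ℕ} {f : Module.End F V} (hf : Ak N k f) (c : F) : Ak N k (c • f) := by
  intro i x hx
  rw [LinearMap.smul_apply, map_smul, hf i x hx, smul_zero]
theorem Ak.neg {k : ℕ} {f : Module.End F V} (hf : Ak N k f) : Ak N k (-f) := by
  intro i x hx
  rw [LinearMap.neg_apply, map_neg, hf i x hx, neg_zero]
theorem Ak.sub {k : ℕ} {f g : Module.End F V} (hf : Ak N k f) (hg : Ak N k g) : Ak N k (f - g) := by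
  rw [sub_eq_add_neg]; exact hf.add hg.neg
theorem Ak.mono {k l : ℕ} (h : l ≤ k) {f : Module.End F V} (hf : Ak N k f) : Ak N l f := by
  intro i x hx
  apply hf i x
  rw [show i + k = (k - l) + (i + l) by omega, pow_add, Module.End.mul_apply, hx, map_zero]
theorem Ak.npow (j : ℕ) : Ak N j (N^j) := by
  intro i x hx
  rwa [← Module.End.mul_apply, ← pow_add]
theorem Ak.one : Ak N 0 1 := by simpa using Ak.npow (N := N) 0
theorem Ak.six (h6 : N^6 = 0) {f : Module.End F V} (hf : Ak N 6 f) : f = 0 := by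
  ext x
  have := hf 0 x (by simp [h6])
  simpa using this

def Cg (N : Module.End F V) (k : ℕ) (f g : Module.End F V) : Prop := Ak N k f ∧ Ak N k g ∧ Ak N (k+1) (f - g)
theorem Cg.mul {k l : ℕ} {f g f' g' : Module.End F V} (h : Cg N k f g) (h' : Cg N l f' g') :
    Cg N (k+l) (f * f') (g * g') := by
  refine ⟨h.1.mul h'.1, h.2.1.mul h'.2.1, ?_⟩
  have : f * f' - g * g' = f * (f' - g') + (f - g) * g' := by noncomm_ring
  rw [this]
  exact (h.1.mul' h'.2.2 (by omega)).add (h.2.2.mul' h'.2.1 (by omega))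
theorem Cg.refl {k : ℕ} {f : Module.End F V} (h : Ak N k f) : Cg N k f f := ⟨h, h, by intro i x hx; simp⟩
theorem Cg.pow {f g : Module.End F V} (h : Cg N 1 f g) (n : ℕ) : Cg N n (f^n) (g^n) := by
  induction n with
  | zero => simpa using Cg.refl Ak.one
  | succ n ih => rw [pow_succ, pow_succ]; exact ih.mul h
theorem Cg.eq (h6 : N^6 = 0) {f g : Module.End F V} (h : Cg N 5 f g) : f = g := sub_eq_zero.1 (h.2.2.six h6)

structure Reg (N : Module.End F V) : Prop where
  n6 : N^6 = 0
  n5 : N^5 ≠ 0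
  k1 : ∀ x y, N x = 0 → N y = 0 → x ≠ 0 → ∃ c : F, y = c • x

theorem Reg.e6 (h : Reg N) : ∃ e, (N^5) e ≠ 0 := by
  by_contra! hc
  exact h.n5 (LinearMap.ext hc)

theorem Reg.line (h : Reg N) {e x : V} (he : (N^5) e ≠ 0) (hx : N x = 0) : ∃ c : F, x = c • (N^5) e := by
  refine h.k1 _ _ ?_ hx he
  rw [← Module.End.mul_apply, ← pow_succ', h.n6]; rfl

theorem Reg.range (h : Reg N) : ∀ j ≤ 6, ∀ x, (N^j) x = 0 → ∃ w, x = (N^(6-j)) w := by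
  obtain ⟨e, he⟩ := h.e6
  intro j
  induction j with
  | zero => intro _ x hx; exact ⟨0, by simpa using hx⟩
  | succ j ih =>
    intro hj x hx
    rw [pow_succ', Module.End.mul_apply] at hx
    obtain ⟨d, hd⟩ := h.line he hx
    obtain ⟨w, hw⟩ := ih (by omega) (x - d • (N^(5-j)) e) (by
      rw [map_sub, map_smul, ← Module.End.mul_apply, ← pow_add, show j + (5-j) = 5 by omega, hd, sub_self])
    refine ⟨d • e + N w, ?_⟩
    rw [show 6 - (j+1) = 5 - j by omega, map_add, map_smul, ← Module.End.mul_apply, ← pow_succ,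
      show 5 - j + 1 = 6 - j by omega, ← hw]; abel

theorem Reg.a5 (h : Reg N) {f : Module.End F V} (hf : Ak N 5 f) : ∃ c : F, f = c • N^5 := by
  obtain ⟨e, he⟩ := h.e6
  have h1 : ∀ x, N (f x) = 0 := by
    intro x
    have := hf 1 x (by simp [h.n6])
    simpa using this
  obtain ⟨c, hc⟩ := h.line he (h1 e)
  refine ⟨c, ?_⟩
  ext x
  obtain ⟨d, hd⟩ := h.line he (x := (N^5) x) (by
    rw [← Module.End.mul_apply, ← pow_succ', h.n6]; rfl)
  have h2 := hf 0 (x - d • e) (by rw [zero_add, map_sub, map_smul, hd, sub_self])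
  simp only [pow_zero, Module.End.one_apply, map_sub, map_smul, hc] at h2
  rw [LinearMap.smul_apply, hd, sub_eq_zero.1 h2, smul_comm]

theorem Reg.comm (h : Reg N) {f : Module.End F V} (hc : f * N = N * f) {j : ℕ} (hj : j ≤ 6) (hf : N^j * f = 0) :
    Ak N (6-j) f := by
  intro i x hx
  have hp : ∀ n, f * N^n = N^n * f := fun n => (show Commute f N from hc).pow_right n
  by_cases hi : j ≤ i
  · rw [← Module.End.mul_apply, show i = (i-j)+j by omega, pow_add, mul_assoc, hf, mul_zero]; rfl
  · obtain ⟨w, rfl⟩ := h.range _ (by omega) x hx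
    rw [show 6 - (i + (6 - j)) = j - i by omega, ← Module.End.mul_apply, ← Module.End.mul_apply, mul_assoc, hp,
      ← mul_assoc, ← pow_add, show i + (j-i) = j by omega, hf]; rfl

def Adj (B : V →ₗ[F] V →ₗ[F] F) (f f' : Module.End F V) : Prop := ∀ x y, B (f x) y = B x (f' y)
theorem Adj.mul {f f' g g' : Module.End F V} (h : Adj B f f') (h' : Adj B g g') : Adj B (f * g) (g' * f') := by
  intro x y; rw [Module.End.mul_apply, h, h']; rfl
theorem Adj.pow {f f' : Module.End F V} (h : Adj B f f') (n : ℕ) : Adj B (f^n) (f'^n) := by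
  induction n with
  | zero => intro x y; simp
  | succ n ih => rw [pow_succ, pow_succ']; exact ih.mul h
theorem Adj.sub1 (g : Sp B) : Adj B (En g - 1) (En g⁻¹ - 1) := by
  intro x y
  simp [En_apply, Bgi]
theorem Adj.smul {f f' : Module.End F V} (h : Adj B f f') (c : F) : Adj B (c • f) (c • f') := by
  intro x y; simp [h x y]
theorem Adj.uniq {f f' f'' : Module.End F V} (h : Adj B f f') (h' : Adj B f f'') : f' = f'' := by
  ext y
  rw [← sub_eq_zero]
  apply hS.nd
  intro x
  rw [Bs, map_sub, ← h, ← h', sub_self, neg_zero]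

theorem inv_sub (g : Sp B) : En g⁻¹ - 1 = -(En g - 1) * En g⁻¹ := by
  have : En g * En g⁻¹ = 1 := by rw [← En_mul, mul_inv_cancel, En_one]
  rw [neg_sub, sub_mul, this, one_mul]

theorem Cg_inv {k : ℕ} (g : Sp B) (h : Ak N k (En g - 1)) (h1 : Ak N 1 (En g⁻¹ - 1)) :
    Cg N k (En g⁻¹ - 1) (-(En g - 1)) := by
  have e : En g⁻¹ - 1 - -(En g - 1) = -(En g - 1) * (En g⁻¹ - 1) := by
    nth_rewrite 1 [inv_sub]; noncomm_ring
  have hk : Ak N (k+1) (En g⁻¹ - 1 - -(En g - 1)) := by rw [e]; exact h.neg.mul h1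
  refine ⟨?_, h.neg, hk⟩
  have := (hk.mono (Nat.le_succ k)).add h.neg
  simpa using this

theorem ADJ {u g : Sp B} (hr : Reg (En u - 1)) (hu : Ak (En u - 1) 1 (En u⁻¹ - 1)) {k : ℕ}
    (h : Ak (En u - 1) k (En g - 1)) (h1 : Ak (En u - 1) 1 (En g⁻¹ - 1)) {a b : ℕ} (hab : a + b + k = 5) :
    (En u - 1)^b * (En g - 1) * (En u - 1)^a = (-1 : F)^(a+b) • ((En u - 1)^a * (En g - 1) * (En u - 1)^b) := by
  have hN1 : Ak (En u - 1) 1 (En u - 1) := by simpa using Ak.npow (N := En u - 1) 1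
  have c1 := Cg_inv u hN1 hu
  have c2 := Cg_inv g h h1
  obtain ⟨c, hc⟩ := hr.a5 ((((Ak.npow a).mul h).mul (Ak.npow b)).mono (show 5 ≤ a + k + b by omega))
  have A1 := (((Adj.sub1 u).pow a).mul (Adj.sub1 g)).mul ((Adj.sub1 u).pow b)
  have A2 := ((Adj.sub1 u).pow 5).smul c
  rw [hc] at A1
  have e := A1.uniq A2
  have e1 := (c1.pow 5).eq hr.n6
  have e2 := (c1.pow b).mul (c2.mul (c1.pow a))
  rw [show b + (k + a) = 5 by omega] at e2
  have e2 := e2.eq hr.n6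
  rw [e, e1] at e2
  rw [hc]
  generalize En u - 1 = N at *
  generalize En g - 1 = C at *
  rw [neg_pow N 5, neg_pow N a, neg_pow N b] at e2
  have h5 : ((-1 : Module.End F V))^5 = -1 := by norm_num
  rw [h5] at e2
  rcases Nat.even_or_odd a with ha | ha <;> rcases Nat.even_or_odd b with hb | hb
  · rw [ha.neg_one_pow, hb.neg_one_pow] at e2
    rw [(ha.add hb).neg_one_pow, one_smul]
    simp [mul_assoc] at e2 ⊢
    exact e2.symm
  · rw [ha.neg_one_pow, hb.neg_one_pow] at e2
    rw [(ha.add_odd hb).neg_one_pow, neg_smul, one_smul]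
    simp [mul_assoc] at e2 ⊢
    exact e2.symm
  · rw [ha.neg_one_pow, hb.neg_one_pow] at e2
    rw [(ha.add_even hb).neg_one_pow, neg_smul, one_smul]
    simp [mul_assoc] at e2 ⊢
    exact e2.symm
  · rw [ha.neg_one_pow, hb.neg_one_pow] at e2
    rw [(ha.add_odd hb).neg_one_pow, one_smul]
    simp [mul_assoc] at e2 ⊢
    exact e2.symm

theorem CENT {u g : Sp B} (hr : Reg (En u - 1)) (hu : Ak (En u - 1) 1 (En u⁻¹ - 1))
    (h : Ak (En u - 1) 1 (En g - 1)) (h1 : Ak (En u - 1) 1 (En g⁻¹ - 1)) (hc : g * u = u * g) (hg : g ≠ 1) :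
    ∃ j, (j = 0 ∨ j = 2 ∨ j = 4) ∧ ∃ c : F, c ≠ 0 ∧ (En u - 1)^j * (En g - 1) = c • (En u - 1)^5 ∧
      (En u - 1)^(j+1) * (En g - 1) = 0 := by
  have hcm : (En g - 1) * (En u - 1) = (En u - 1) * (En g - 1) := by
    have : En g * En u = En u * En g := by rw [← En_mul, ← En_mul, hc]
    simp only [sub_mul, mul_sub, this, one_mul, mul_one]; abel
  have h5 : (En u - 1)^5 * (En g - 1) = 0 := by
    ext x
    exact h 5 x (by rw [hr.n6]; rfl)
  have hex : ∃ j, (En u - 1)^j * (En g - 1) = 0 := ⟨5, h5⟩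
  classical
  obtain ⟨j, hj⟩ : ∃ j, Nat.find hex = j + 1 := by
    apply Nat.exists_eq_succ_of_ne_zero
    intro h0
    have := Nat.find_spec hex
    rw [h0, pow_zero, one_mul, sub_eq_zero] at this
    exact hg (En_inj this)
  have s1 := Nat.find_spec hex
  rw [hj] at s1
  have s2 : (En u - 1)^j * (En g - 1) ≠ 0 := Nat.find_min hex (by omega)
  have s3 : j + 1 ≤ 5 := by rw [← hj]; exact Nat.find_min' hex h5
  have s4 := hr.comm hcm (by omega) s1
  obtain ⟨c, hcc⟩ := hr.a5 (((Ak.npow j).mul s4).mono (show 5 ≤ j + (6 - (j+1)) by omega))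
  have hc0 : c ≠ 0 := by rintro rfl; rw [zero_smul] at hcc; exact s2 hcc
  refine ⟨j, ?_, c, hc0, hcc, s1⟩
  by_contra hodd
  have hoj : Odd j := by
    have : j ≤ 4 := by omega
    interval_cases j
    · simp at hodd
    · decide
    · simp at hodd
    · decide
    · simp at hodd
  have := ADJ hr hu s4 h1 (a := j) (b := 0) (by omega)
  rw [pow_zero, one_mul, mul_one, add_zero, hoj.neg_one_pow, (show Commute (En g - 1) (En u - 1) from hcm).pow_right j,
    hcc, neg_smul, one_smul] at this
  obtain ⟨e, he⟩ := hr.e6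
  have h2 := congrArg (fun f : Module.End F V => f e) this
  simp at h2
  exact (smul_ne_zero hc0 he) (eq_zero_of_neg B h2)

theorem STEP {P : Subgroup (Sp B)} {u c : Sp B} (hu : u ∈ P) (hc : c ∈ P) (hr : Reg (En u - 1))
    (hP : ∀ g ∈ P, Ak (En u - 1) 1 (En g - 1)) {k : ℕ} (h : Ak (En u - 1) k (En c - 1)) :
    ∃ c' ∈ P, Ak (En u - 1) (k+1) (En c' - 1) ∧ ∀ a b, a + b + k = 4 →
      (En u - 1)^a * (En c' - 1) * (En u - 1)^b =
      (En u - 1)^a * (En c - 1) * (En u - 1)^(b+1) - (En u - 1)^(a+1) * (En c - 1) * (En u - 1)^b := by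
  have hm : c⁻¹ * u⁻¹ ∈ P := P.mul_mem (P.inv_mem hc) (P.inv_mem hu)
  refine ⟨c * u * (c⁻¹ * u⁻¹), P.mul_mem (P.mul_mem hc hu) hm, ?_⟩
  have h1 := hP _ hm
  have e : En (c * u * (c⁻¹ * u⁻¹)) - 1 = ((En c - 1) * (En u - 1) - (En u - 1) * (En c - 1)) * En (c⁻¹ * u⁻¹) := by
    have : (En u * En c) * En (c⁻¹ * u⁻¹) = 1 := by
      rw [← En_mul, ← En_mul, ← En_one (B := B)]; congr 1; group
    have e0 : En (c * u * (c⁻¹ * u⁻¹)) - 1 = (En c * En u) * En (c⁻¹ * u⁻¹) - (En u * En c) * En (c⁻¹ * u⁻¹) := by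
      rw [this, En_mul (c * u), En_mul c u]
    rw [e0]; noncomm_ring
  have hN1 : Ak (En u - 1) 1 (En u - 1) := by simpa using Ak.npow (N := En u - 1) 1
  have hA : Ak (En u - 1) (k+1) ((En c - 1) * (En u - 1) - (En u - 1) * (En c - 1)) :=
    (h.mul hN1).sub (hN1.mul' h (add_comm _ _))
  have e2 : En (c * u * (c⁻¹ * u⁻¹)) - 1 - ((En c - 1) * (En u - 1) - (En u - 1) * (En c - 1)) =
    ((En c - 1) * (En u - 1) - (En u - 1) * (En c - 1)) * (En (c⁻¹ * u⁻¹) - 1) := by rw [e]; noncomm_ring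
  have hB : Ak (En u - 1) (k+1+1) (En (c * u * (c⁻¹ * u⁻¹)) - 1 - ((En c - 1) * (En u - 1) - (En u - 1) * (En c - 1))) := by
    rw [e2]; exact hA.mul h1
  have hC : Ak (En u - 1) (k+1) (En (c * u * (c⁻¹ * u⁻¹)) - 1) := by
    have := (hB.mono (Nat.le_succ _)).add hA
    simpa using this
  refine ⟨hC, ?_⟩
  intro a b hab
  have hcg : Cg (En u - 1) (k+1) _ _ := ⟨hC, hA, hB⟩
  have := ((Cg.refl (Ak.npow (N := En u - 1) a)).mul hcg).mul (Cg.refl (Ak.npow (N := En u - 1) b))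
  rw [show a + (k+1) + b = 5 by omega] at this
  rw [this.eq hr.n6, pow_succ', pow_succ]; noncomm_ring

end base
end
end PSP

open Module
set_option linter.unusedSectionVars false
set_option linter.unusedVariables false
set_option linter.style.longLine false
set_option linter.unnecessarySimpa false
set_option linter.unusedSimpArgs false
namespace PSP
noncomputable section
section base
variable {F : Type*} {V : Type*} [Field F] [Fintype F] [AddCommGroup V] [Module F V] [FiniteDimensional F V]
variable {B : V →ₗ[F] V →ₗ[F] F}
variable [hS : Sy B]

local notation "q" => Fintype.card F

theorem FP {p : ℕ} (hp : p.Prime) [CharP F p] {P : Subgroup (Sp B)} (hP : IsPGroup p P) {M : Submodule F V}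
    (hM : ∀ g ∈ P, Inv g M) (ht : M ≠ ⊤) : ∃ x, x ∉ M ∧ ∀ g ∈ P, g • x - x ∈ M := by
  have : Fact p.Prime := ⟨hp⟩
  have hfin : Finite V := Module.finite_of_finite F
  have hle : ∀ g : P, M ≤ M.comap (En g.1) := fun g x hx => hM g.1 g.2 x hx
  let act : MulAction P (V ⧸ M) :=
    { smul := fun g => M.mapQ M (En g.1) (hle g)
      one_smul := by
        intro b
        induction b using Submodule.Quotient.induction_on with
        | _ x => show M.mapQ M (En (1 : P).1) (hle 1) (Submodule.Quotient.mk x) = _; rw [Submodule.mapQ_apply]; simp [En_apply]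
      mul_smul := by
        intro a b c
        induction c using Submodule.Quotient.induction_on with
        | _ x =>
          show M.mapQ M (En (a * b).1) (hle _) (Submodule.Quotient.mk x) = M.mapQ M (En a.1) (hle a) (M.mapQ M (En b.1) (hle b) (Submodule.Quotient.mk x))
          rw [Submodule.mapQ_apply, Submodule.mapQ_apply, Submodule.mapQ_apply]; rfl }
  have hfq : Finite (V ⧸ M) := Quotient.finite _
  have hd : p ∣ Nat.card (V ⧸ M) := by
    rw [Module.natCard_eq_pow_finrank (K := F), Nat.card_eq_fintype_card]
    obtain ⟨n, _, hn⟩ := FiniteField.card F p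
    rw [hn, ← pow_mul]
    apply dvd_pow_self
    apply mul_ne_zero n.2.ne'
    have h1 := Submodule.finrank_quotient_add_finrank M
    have h2 := Submodule.finrank_lt ht
    omega
  obtain ⟨b, hb, hne⟩ := hP.exists_fixed_point_of_prime_dvd_card_of_fixed_point (α := V ⧸ M) hd (a := 0) (by
    intro g
    show M.mapQ M (En g.1) (hle g) 0 = 0
    simp)
  induction b using Submodule.Quotient.induction_on with
  | _ x =>
    refine ⟨x, ?_, ?_⟩
    · intro hx
      exact hne ((Submodule.Quotient.mk_eq_zero M).2 hx).symm
    · intro g hg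
      have h1 : M.mapQ M (En g) (hle ⟨g, hg⟩) (Submodule.Quotient.mk x) = Submodule.Quotient.mk x := hb ⟨g, hg⟩
      rw [Submodule.mapQ_apply, Submodule.Quotient.eq] at h1
      exact h1

theorem FLAG {p : ℕ} (hp : p.Prime) [CharP F p] {P : Subgroup (Sp B)} (hP : IsPGroup p P) {u : Sp B} (hu : u ∈ P)
    (hr : Reg (En u - 1)) : ∀ g ∈ P, Ak (En u - 1) 1 (En g - 1) := by
  have hNu : ∀ x, (En u - 1) x = u • x - x := fun x => rfl
  generalize En u - 1 = N at hr hNu ⊢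
  have hinv : ∀ i, (∀ g ∈ P, Inv g (LinearMap.ker (N^i))) →
       ∀ g ∈ P, ∀ x, (N^(i+1)) x = 0 → (N^i) ((En g - 1) x) = 0 := by
      intro i hinv
      by_cases ht : LinearMap.ker (N^i) = ⊤
      · intro g hg x hx
        have : (En g - 1) x ∈ LinearMap.ker (N^i) := by rw [ht]; trivial
        exact this
      obtain ⟨x0, hx0, h0⟩ := FP hp hP hinv ht
      rw [LinearMap.mem_ker] at hx0
      have h1 : N ((N^i) x0) = 0 := by
        have := h0 u hu
        rw [LinearMap.mem_ker] at this
        rw [← Module.End.mul_apply, ← pow_succ', pow_succ, Module.End.mul_apply, hNu]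
        exact this
      intro g hg x hx
      rw [pow_succ', Module.End.mul_apply] at hx
      obtain ⟨c, hc⟩ := hr.k1 _ _ h1 hx hx0
      have h2 : x - c • x0 ∈ LinearMap.ker (N^i) := by
        rw [LinearMap.mem_ker, map_sub, map_smul, hc, sub_self]
      have h3 := hinv g hg _ h2
      have h4 := h0 g hg
      rw [LinearMap.mem_ker] at h2 h3 h4
      have e : (En g - 1) x = (g • (x - c • x0) - (x - c • x0)) + c • (g • x0 - x0) := by
        rw [smul_sub, gc, LinearMap.sub_apply, En_apply, Module.End.one_apply, smul_sub]; abel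
      rw [e, map_add, map_sub, h2, h3, LinearMap.map_smul, h4]; simp
  have key : ∀ i, ∀ g ∈ P, ∀ x, (N^(i+1)) x = 0 → (N^i) ((En g - 1) x) = 0 := by
    intro i
    apply hinv
    induction i with
    | zero =>
      intro g hg x hx
      rw [LinearMap.mem_ker, pow_zero, Module.End.one_apply] at *
      rw [hx, smul_zero]
    | succ i ih =>
      intro g hg x hx
      rw [LinearMap.mem_ker] at *
      have := hinv i ih g hg x hx
      have e : g • x = x + (En g - 1) x := by rw [LinearMap.sub_apply, En_apply, Module.End.one_apply]; abel
      rw [e, map_add, hx, pow_succ', Module.End.mul_apply, this]; simp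
  exact fun g hg i x hx => key i g hg x hx

theorem reg_of {p : ℕ} (hp : p.Prime) [CharP F p] {u : Sp B} {k : ℕ} (hu : u^(p^k) = 1) (h1 : finrank F (Fx u) = 1) :
    Reg (En u - 1) := by
  have : Fact p.Prime := ⟨hp⟩
  have hker : ∀ x, (En u - 1) x = 0 ↔ x ∈ Fx u := by
    intro x; rw [LinearMap.sub_apply, En_apply, Module.End.one_apply, sub_eq_zero, mem_Fx]
  have hke : LinearMap.ker (En u - 1) = Fx u := by ext x; rw [LinearMap.mem_ker, hker]
  have hnt : Nontrivial V := by
    obtain ⟨x, hx⟩ := ex_ne B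
    exact ⟨x, 0, hx⟩
  have hch : CharP (Module.End F V) p := charP_of_injective_algebraMap (algebraMap F (Module.End F V)).injective p
  have hnil : (En u - 1)^(p^k) = 0 := by
    rw [sub_pow_char_pow_of_commute p k (Commute.one_right (En u)), ← En_pow, hu, En_one, one_pow, sub_self]
  refine ⟨?_, ?_, ?_⟩
  · have h2 : (En u - 1)^(p^k + 6) = 0 := by rw [pow_add, hnil, zero_mul]
    have h3 := Module.End.ker_pow_eq_ker_pow_finrank_of_le (f := En u - 1) (m := p^k+6) (by rw [hS.fd]; omega)
    rw [hS.fd, h2, LinearMap.ker_zero] at h3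
    exact LinearMap.ker_eq_top.1 h3.symm
  · intro h5
    have hd : ∀ j, finrank F (LinearMap.ker ((En u - 1)^j)) ≤ j := by
      intro j
      induction j with
      | zero => rw [pow_zero, Module.End.one_eq_id, LinearMap.ker_id]; simp
      | succ j ih =>
        have hle : ∀ x : LinearMap.ker ((En u - 1)^(j+1)), ((En u - 1)^j) x.1 ∈ LinearMap.ker (En u - 1) := by
          intro x
          have : ((En u - 1)^(j+1)) x.1 = 0 := x.2
          show (En u - 1) (((En u - 1)^j) x.1) = 0
          rw [← Module.End.mul_apply, ← pow_succ', this]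
        let φ : LinearMap.ker ((En u - 1)^(j+1)) →ₗ[F] LinearMap.ker (En u - 1) :=
          LinearMap.codRestrict _ (((En u - 1)^j).domRestrict _) hle
        have e1 := LinearMap.finrank_range_add_finrank_ker φ
        have e2 : finrank F (LinearMap.range φ) ≤ 1 := by
          have h1' : finrank F (LinearMap.ker (En u - 1)) = 1 := by rw [hke, h1]
          exact (Submodule.finrank_le _).trans h1'.le
        have e3 : finrank F (LinearMap.ker φ) ≤ finrank F (LinearMap.ker ((En u - 1)^j)) := by
          let ψ : LinearMap.ker φ →ₗ[F] LinearMap.ker ((En u - 1)^j) :=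
            LinearMap.codRestrict _ ((Submodule.subtype _).comp (Submodule.subtype _)) (by
              intro x
              have := x.2
              rw [LinearMap.mem_ker] at this
              have := congrArg Subtype.val this
              exact this)
          apply LinearMap.finrank_le_finrank_of_injective (f := ψ)
          intro x y hxy
          have := congrArg Subtype.val hxy
          exact Subtype.ext (Subtype.ext this)
        omega
    have := hd 5
    rw [h5, LinearMap.ker_zero, finrank_top, hS.fd] at this
    omega
  · intro x y hx hy h0
    rw [hker] at hx hy
    obtain ⟨c, hc⟩ := exists_smul_eq_of_finrank_eq_one h1 (x := ⟨x, hx⟩) (by simpa [Subtype.ext_iff] using h0) ⟨y, hy⟩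
    exact ⟨c, (congrArg Subtype.val hc).symm⟩

theorem QUAD {y : Sp B} (hy : (En y - 1) * (En y - 1) = 0) : ∃ g : Sp B, IsZ g ∧ y * g = g * y := by
  set Y := En y - 1 with hY
  have hyx : ∀ x, y • x = x + Y x := by intro x; rw [hY, LinearMap.sub_apply, En_apply, Module.End.one_apply]; abel
  have hYY : ∀ x, Y (Y x) = 0 := fun x => congrArg (fun f : Module.End F V => f x) hy
  clear_value Y
  have h1 : ∀ x x', B (Y x) (Y x') = 0 := by
    intro x x'
    have a1 := Bg y x (Y x')
    have a2 := Bg y (Y x) (x')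
    have a3 := Bg y x x'
    rw [hyx, hyx, hYY] at a1
    simp at a1
    exact a1
  have h2 : ∀ x x', B x (Y x') = B x' (Y x) := by
    intro x x'
    have a3 := Bg y x x'
    rw [hyx, hyx] at a3
    simp [h1] at a3
    rw [Bs x' (Y x)]; linear_combination a3
  by_cases h3 : ∃ x, B x (Y x) ≠ 0
  · obtain ⟨x, hx⟩ := h3
    have hef : B x ((B x (Y x))⁻¹ • Y x) = 1 := by simp [hx]
    refine ⟨z B x ((B x (Y x))⁻¹ • Y x), ⟨_, _, hef, rfl⟩, ?_⟩
    rw [← mul_inv_eq_iff_eq_mul, z_conj y hef]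
    have hef' : B (y • x) (y • ((B x (Y x))⁻¹ • Y x)) = 1 := by rw [Bg, hef]
    apply sp_ext
    intro w
    rw [z_smul hef, z_smul hef', gc, hyx, hyx, hYY]
    simp only [map_add, map_smul, smul_eq_mul, add_zero]
    module
  · push Not at h3
    have hY0 : ∀ x, Y x = 0 := by
      intro x
      apply hS.nd
      intro w
      have := h3 (w + x)
      simp [h3] at this
      rw [h2 x w] at this
      rw [Bs]
      have : (2:F) * B w (Y x) = 0 := by linear_combination this
      rw [(mul_eq_zero.1 this).resolve_left hS.two, neg_zero]
    have : y = 1 := sp_ext (by intro x; rw [hyx, hY0]; simp)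
    obtain ⟨x, hx⟩ := ex_ne B
    obtain ⟨f, hf⟩ := nd' (B := B) hx
    exact ⟨z B x f, ⟨x, f, hf, rfl⟩, by rw [this]; simp⟩

theorem TR {g : Sp B} (hg : g ≠ 1) {v : V} (hv : v ≠ 0) (hgv : g • v = v) (h : ∀ x, ∃ c : F, g • x = x + c • v) :
    ∃ b : F, b ≠ 0 ∧ g = t B v b := by
  obtain ⟨f, hf⟩ := nd' (B := B) hv
  obtain ⟨h1, h2⟩ := exQ (g := g) (v := v) (f := -f) (by simp [Bs f v, hf]) hgv (fun x _ => h x)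
  obtain ⟨k, hk⟩ := h (-f)
  have h3 := h2.shift k
  rw [hk, add_sub_cancel_left, sub_self] at h3
  refine ⟨_, ?_, h3.eq_t⟩
  intro h0
  rw [h0] at h3
  exact hg (by rw [h3.eq_t, t_zero])

end base
end
end PSP

open Module
set_option linter.unusedSectionVars false
set_option linter.unusedVariables false
set_option linter.style.longLine false
set_option linter.unnecessarySimpa false
set_option linter.unusedSimpArgs false
namespace PSP
noncomputable section
section base
variable {F : Type*} {V : Type*} [Field F] [Fintype F] [AddCommGroup V] [Module F V] [FiniteDimensional F V]
variable {B : V →ₗ[F] V →ₗ[F] F}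
variable [hS : Sy B]

local notation "q" => Fintype.card F

theorem KL {N f : Module.End F V} (hr : Reg N) {c : F} (hc : c ≠ 0) (h : ∀ b ≤ 4, N^(4-b) * f * N^b = c • N^5) {x : V}
    (hx : f x = 0) : N x = 0 := by
  by_contra h0
  have hex : ∃ i, (N^i) x = 0 := ⟨6, by rw [hr.n6]; rfl⟩
  classical
  obtain ⟨i, hi⟩ : ∃ i, Nat.find hex = i := ⟨_, rfl⟩
  have h1 := Nat.find_spec hex
  have h6 : Nat.find hex ≤ 6 := Nat.find_min' hex (by rw [hr.n6]; rfl)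
  have hmin : ∀ m < Nat.find hex, (N^m) x ≠ 0 := fun m hm => Nat.find_min hex hm
  rw [hi] at h1 h6 hmin
  have h2 : 2 ≤ i := by
    by_contra hlt
    have : i = 0 ∨ i = 1 := by omega
    rcases this with rfl | rfl
    · apply h0
      have : x = 0 := by simpa using h1
      rw [this, map_zero]
    · exact h0 (by simpa using h1)
  obtain ⟨w, hw⟩ := hr.range i h6 x h1
  have h3 := congrArg (fun f : Module.End F V => f w) (h (6 - i) (by omega))
  simp only [Module.End.mul_apply, LinearMap.smul_apply] at h3
  rw [← hw, hx, map_zero] at h3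
  apply hmin (i-1) (by omega)
  rw [hw, ← Module.End.mul_apply, ← pow_add, show i - 1 + (6 - i) = 5 by omega]
  exact (smul_eq_zero.1 h3.symm).resolve_left hc

theorem SQ0 {N f : Module.End F V} (hr : Reg N) (h : N^3 * f = 0) (h' : f * N^3 = 0) : f * f = 0 := by
  ext x
  obtain ⟨w, hw⟩ := hr.range 3 (by omega) (f x) (by rw [← Module.End.mul_apply, h]; rfl)
  rw [Module.End.mul_apply, hw, ← Module.End.mul_apply, h']; rfl

theorem TRV {N : Module.End F V} (hr : Reg N) {g : Sp B} (hg : g ≠ 1) {c : F} (h : En g - 1 = c • N^5) :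
    ∃ v : V, v ≠ 0 ∧ ∃ b : F, b ≠ 0 ∧ g = t B v b := by
  obtain ⟨e, he⟩ := hr.e6
  have hN : ∀ x, N ((N^5) x) = 0 := by intro x; rw [← Module.End.mul_apply, ← pow_succ', hr.n6]; rfl
  have hgx : ∀ x, g • x = x + c • (N^5) x := by
    intro x
    have := congrArg (fun f : Module.End F V => f x) h
    simp only [LinearMap.sub_apply, En_apply, Module.End.one_apply, LinearMap.smul_apply] at this
    rw [← this]; abel
  refine ⟨_, he, TR hg he ?_ ?_⟩
  · rw [hgx, ← Module.End.mul_apply, ← pow_add, show 5 + 5 = 4 + 6 by rfl, pow_add, hr.n6]; simp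
  · intro x
    obtain ⟨d, hd⟩ := hr.line he (hN x)
    exact ⟨c * d, by rw [hgx, hd, smul_smul]⟩

theorem KFx {u y : Sp B} (h1 : finrank F (Fx u) = 1) (h2 : 2 ≤ finrank F (Fx y)) (h : ∀ x, (En y - 1) x = 0 → (En u - 1) x = 0) : False := by
  have : Fx y ≤ Fx u := by
    intro x hx
    rw [mem_Fx] at hx ⊢
    have := h x (by rw [LinearMap.sub_apply, En_apply, hx]; simp)
    rw [LinearMap.sub_apply, En_apply] at this
    exact sub_eq_zero.1 this
  have := Submodule.finrank_mono this
  omega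

theorem pgk {p : ℕ} {P : Subgroup (Sp B)} (hP : IsPGroup p P) {u : Sp B} (hu : u ∈ P) : ∃ k, u^(p^k) = 1 := by
  obtain ⟨k, hk⟩ := hP ⟨u, hu⟩
  exact ⟨k, congrArg Subtype.val hk⟩

theorem Ecomm {g u : Sp B} (hc : g * u = u * g) : (En g - 1) * (En u - 1) = (En u - 1) * (En g - 1) := by
  have : En g * En u = En u * En g := by rw [← En_mul, ← En_mul, hc]
  simp only [sub_mul, mul_sub, this, one_mul, mul_one]; abel

theorem UYa {p : ℕ} (hp : p.Prime) [CharP F p] {P : Subgroup (Sp B)} (hP : IsPGroup p P) {u y : Sp B} (hu : u ∈ P)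
    (hy : y ∈ P) (h1 : finrank F (Fx u) = 1) (h2 : 2 ≤ finrank F (Fx y)) (hyz : ∀ g : Sp B, IsZ g → y * g ≠ g * y)
    (hc : y * u = u * y) : False := by
  obtain ⟨k, hk⟩ := pgk hP hu
  have hr := reg_of hp hk h1
  have hA := FLAG hp hP hu hr
  have hy1 : y ≠ 1 := by
    rintro rfl
    obtain ⟨x, hx⟩ := ex_ne B
    obtain ⟨f, hf⟩ := nd' (B := B) hx
    exact hyz _ ⟨x, f, hf, rfl⟩ (by simp)
  have hcm := Ecomm hc
  have hp' : ∀ n, (En y - 1) * (En u - 1)^n = (En u - 1)^n * (En y - 1) := fun n => (show Commute (En y - 1) (En u - 1) from hcm).pow_right n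
  obtain ⟨j, hj, c, hc0, e1, e2⟩ := CENT hr (hA _ (P.inv_mem hu)) (hA _ hy) (hA _ (P.inv_mem hy)) hc hy1
  by_cases h4 : j = 4
  · subst h4
    refine KFx h1 h2 fun x hx => KL hr hc0 (fun b hb => ?_) hx
    rw [mul_assoc, hp', ← mul_assoc, ← pow_add, show 4 - b + b = 4 by omega, e1]
  · have h3 : (En u - 1)^3 * (En y - 1) = 0 := by
      rw [show 3 = (2 - j) + (j+1) by omega, pow_add, mul_assoc, e2, mul_zero]
    obtain ⟨g, hg, hgy⟩ := QUAD (SQ0 hr h3 (by rw [hp', h3]))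
    exact hyz g hg hgy

theorem UY {p : ℕ} (hp : p.Prime) [CharP F p] {P : Subgroup (Sp B)} (hP : IsPGroup p P) {u y : Sp B} (hu : u ∈ P)
    (hy : y ∈ P) (h1 : finrank F (Fx u) = 1) (h2 : 2 ≤ finrank F (Fx y)) (hyz : ∀ g : Sp B, IsZ g → y * g ≠ g * y) :
    ∃ v : V, v ≠ 0 ∧ ∃ b : F, b ≠ 0 ∧ t B v b ∈ P := by
  have hpf : Fact p.Prime := ⟨hp⟩
  obtain ⟨k, hk⟩ := pgk hP hu
  have hr := reg_of hp hk h1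
  have hA := FLAG hp hP hu hr
  obtain ⟨x0, hx0, hfx⟩ := FP hp hP (M := ⊥) (by
    intro g hg x hx; rw [Submodule.mem_bot] at *; rw [hx, smul_zero]) (by
    intro hb
    obtain ⟨x, hx⟩ := ex_ne B
    exact hx (by have : x ∈ (⊥ : Submodule F V) := by rw [hb]; trivial
                 simpa using this))
  have hu1 : u ≠ 1 := by
    rintro rfl
    apply hr.n5; rw [En_one]; simp
  have hnt : Nontrivial P := ⟨⟨u, hu⟩, 1, fun h => hu1 (congrArg Subtype.val h)⟩
  have := hP.center_nontrivial
  obtain ⟨⟨⟨ζ, hζP⟩, hζ⟩, hne⟩ := exists_ne (1 : Subgroup.center P)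
  have hz1 : ζ ≠ 1 := fun h => hne (Subtype.ext (Subtype.ext h))
  have hcen : ∀ g ∈ P, ζ * g = g * ζ := fun g hg => (congrArg Subtype.val (Subgroup.mem_center_iff.1 hζ ⟨g, hg⟩)).symm
  have hcm := Ecomm (hcen u hu)
  have hyc := Ecomm (hcen y hy)
  have hp' : ∀ n, (En ζ - 1) * (En u - 1)^n = (En u - 1)^n * (En ζ - 1) := fun n => (show Commute (En ζ - 1) (En u - 1) from hcm).pow_right n
  obtain ⟨j, hj, c, hc0, e1, e2⟩ := CENT hr (hA _ (P.inv_mem hu)) (hA _ hζP) (hA _ (P.inv_mem hζP)) (hcen u hu) hz1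
  rcases hj with rfl | rfl | rfl
  · obtain ⟨v, hv, b, hb, rfl⟩ := TRV hr hz1 (c := c) (by rw [← e1]; simp)
    exact ⟨v, hv, b, hb, hζP⟩
  · have e0 : ∀ k, k = 1 → (En u - 1)^k = En u - 1 := by rintro k rfl; simp
    have hD : Ak (En u - 1) 4 ((En ζ - 1) - c • (En u - 1)^3) := by
      refine hr.comm (j := 2) ?_ (by omega) ?_
      · rw [sub_mul (En ζ - 1), mul_sub (En u - 1) (En ζ - 1), hcm, smul_mul_assoc, mul_smul_comm, ← pow_succ, ← pow_succ']
      · rw [mul_sub, e1, mul_smul_comm, ← pow_add, sub_self]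
    have hY1 := hA y hy
    have adj : ∀ {a b k : ℕ}, a + b + k = 5 → Ak (En u - 1) k (En y - 1) → (En u - 1)^b * (En y - 1) * (En u - 1)^a =
        (-1 : F)^(a+b) • ((En u - 1)^a * (En y - 1) * (En u - 1)^b) :=
      fun hab hk => ADJ hr (hA _ (P.inv_mem hu)) hk (hA _ (P.inv_mem hy)) hab
    obtain ⟨c1, hc1, a1, s1⟩ := STEP hu hy hr hA hY1
    obtain ⟨c2, hc2, a2, s2⟩ := STEP hu hc1 hr hA a1
    obtain ⟨c3, hc3, a3, s3⟩ := STEP hu hc2 hr hA a2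
    obtain ⟨c4, hc4, a4, s4⟩ := STEP hu hc3 hr hA a3
    have b0 := adj (a := 0) (b := 4) rfl hY1
    have b1 := adj (a := 1) (b := 3) rfl hY1
    have n1 : Ak (En u - 1) 1 (En u - 1) := by simpa using Ak.npow (N := En u - 1) 1
    have f1 := ((n1.mul hY1).mul hD).six hr.n6
    have f2 := ((n1.mul hD).mul' hY1 (m := 6) rfl).six hr.n6
    have f3 := ((hY1.mul hD).mul n1).six hr.n6
    have f4 := ((hD.mul hY1).mul n1).six hr.n6
    have f5 : Ak (En u - 1) 2 (En y - 1) → (En y - 1) * (En u - 1)^3 = (En u - 1)^3 * (En y - 1) := by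
      intro hY2
      have f6 := (hY2.mul hD).six hr.n6
      have f7 := (hD.mul hY2).six hr.n6
      rw [mul_sub (En y - 1), sub_eq_zero, mul_smul_comm] at f6
      rw [sub_mul (En ζ - 1), sub_eq_zero, smul_mul_assoc] at f7
      rw [← hyc, f7] at f6
      exact (smul_right_injective _ hc0 f6).symm
    have ker : ∀ τ : F, τ ≠ 0 → (∀ b ≤ 4, (En u - 1)^(4-b) * (En y - 1) * (En u - 1)^b = τ • (En u - 1)^5) → False :=
      fun τ hτ h => KFx h1 h2 fun x hx => KL hr hτ h hx
    have quad : (En u - 1)^3 * (En y - 1) = 0 → (En y - 1) * (En u - 1)^3 = 0 → False := by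
      intro h h'
      obtain ⟨g, hg, hgy⟩ := QUAD (SQ0 hr h h')
      exact hyz g hg hgy
    have t1 := s1 0 3 rfl
    have t2 := s1 1 2 rfl
    have t3 := s1 2 1 rfl
    have t4 := s1 3 0 rfl
    have t5 := s2 0 2 rfl
    have t6 := s2 1 1 rfl
    have t7 := s2 2 0 rfl
    have t8 := s3 0 1 rfl
    have t9 := s3 1 0 rfl
    have t10 := s4 0 0 rfl
    have trv : c4 ≠ 1 → ∃ v : V, v ≠ 0 ∧ ∃ b : F, b ≠ 0 ∧ t B v b ∈ P := by
      intro h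
      obtain ⟨d, hd⟩ := hr.a5 a4
      obtain ⟨v, hv, b, hb, rfl⟩ := TRV hr h hd
      exact ⟨v, hv, b, hb, hc4⟩
    by_cases h41 : c4 = 1
    swap
    · exact trv h41
    exfalso
    rw [h41, En_one, sub_self] at t10
    have hr5 := fun (b : ℕ) (hb : b ≤ 4) => hr.a5 ((((Ak.npow (4-b)).mul hY1).mul (Ak.npow b)).mono (show 5 ≤ 4 - b + 1 + b by omega))
    have hr2 : (∀ b ≤ 4, (En u - 1)^(4-b) * (En y - 1) * (En u - 1)^b = 0) → Ak (En u - 1) 2 (En y - 1) := by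
      intro h0 i x hx
      by_cases hi : 5 ≤ i
      · have := hY1 5 x (by rw [hr.n6]; rfl)
        rw [show i = (i - 5) + 5 by omega, pow_add, Module.End.mul_apply, this, map_zero]
      · obtain ⟨w, rfl⟩ := hr.range (i+2) (by omega) x hx
        have := congrArg (fun f : Module.End F V => f w) (h0 (4 - i) (by omega))
        simp only [Module.End.mul_apply] at this
        rw [show 4 - (4 - i) = i by omega] at this
        rw [show 6 - (i+2) = 4 - i by omega, this]; rfl
    have adj2 := fun h => adj (a := 0) (b := 3) rfl (hr2 h)
    obtain ⟨s, hs2⟩ := hr5 0 (by omega)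
    clear adj s1 s2 s3 s4
    simp only [Nat.sub_zero, pow_zero, one_mul, mul_one, zero_add, pow_one, Nat.reduceAdd] at b0 b1 f1 f2 f3 f4 t1 t2 t3 t4 t5 t6 t7 t8 t9 t10 hs2 adj2
    generalize En u - 1 = N at *
    generalize En y - 1 = Y at *
    generalize En ζ - 1 = Z at *
    rw [mul_sub, sub_eq_zero, mul_smul_comm] at f1
    rw [mul_sub, sub_mul, sub_eq_zero, mul_smul_comm, smul_mul_assoc] at f2
    rw [mul_sub, sub_mul, sub_eq_zero, mul_smul_comm, smul_mul_assoc] at f3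
    rw [sub_mul, sub_mul, sub_eq_zero, smul_mul_assoc, smul_mul_assoc] at f4
    have g1 : N * Y * N^3 = N^4 * Y := by
      apply smul_right_injective _ hc0
      show c • _ = c • _
      rw [← f1, mul_assoc, ← hyc, ← mul_assoc, f2, ← pow_succ']
    have g2 : Y * N^4 = N^3 * Y * N := by
      apply smul_right_injective _ hc0
      show c • _ = c • _
      rw [← f4, hyc, f3, mul_assoc, ← pow_succ]
    rw [show (-1:F)^4 = 1 by norm_num, one_smul] at b0 b1
    rw [g1] at b1
    rw [b1] at g2
    rw [t8, t9, t5, t6, t7, t1, t2, t3, t4, g2, b1, g1] at t10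
    have g3 : (6:F) • (N^2 * Y * N^2 - N^4 * Y) = 0 := by
      rw [t10]; module
    have h6 : (6:F) ≠ 0 := by
      rw [show (6:F) = 2 * 3 by norm_num]; exact mul_ne_zero hS.two hS.three
    have g4 := sub_eq_zero.1 ((smul_eq_zero.1 g3).resolve_left h6)
    have all : ∀ b ≤ 4, N^(4-b) * Y * N^b = s • N^5 := by
      intro b hb
      rw [← hs2]
      interval_cases b
      · simp
      · simpa using b1
      · simpa using g4
      · simpa using g1
      · simpa using g2
    by_cases hs0 : s = 0
    · subst hs0
      simp only [zero_smul] at all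
      have g5 := adj2 all
      have g6 := f5 (hr2 all)
      rw [g6] at g5
      have g7 : (2:F) • (N^3 * Y) = 0 := by
        rw [two_smul]; nth_rw 1 [g5]; module
      have g8 := (smul_eq_zero.1 g7).resolve_left hS.two
      exact quad g8 (by rw [g6, g8])
    · exact ker s hs0 all
  · refine (UYa hp hP hζP hy ?_ h2 hyz (hcen y hy).symm).elim
    have hle : Fx ζ ≤ Fx u := by
      intro x hx
      rw [mem_Fx] at hx ⊢
      have : (En u - 1) x = 0 := by
        refine KL hr hc0 (f := En ζ - 1) (fun b hb => ?_) (by rw [LinearMap.sub_apply, En_apply, hx]; simp)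
        rw [mul_assoc, hp', ← mul_assoc, ← pow_add, show 4 - b + b = 4 by omega, e1]
      exact sub_eq_zero.1 this
    have h3 := Submodule.finrank_mono hle
    have h4 : Fx ζ ≠ ⊥ := by
      intro hb
      apply hx0
      rw [← hb, mem_Fx]
      simpa [sub_eq_zero] using hfx ζ hζP
    have := Submodule.one_le_finrank_iff.2 h4
    omega

end base
end
end PSP

open Module
set_option linter.unusedSectionVars false
set_option linter.unusedVariables false
set_option linter.style.longLine false
set_option linter.unnecessarySimpa false
set_option linter.unusedSimpArgs false
namespace PSP
noncomputable section
section base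
variable {F : Type*} {V : Type*} [Field F] [Fintype F] [AddCommGroup V] [Module F V] [FiniteDimensional F V]
variable {B : V →ₗ[F] V →ₗ[F] F}
variable [hS : Sy B]

local notation "q" => Fintype.card F

theorem Inv.wp {g : Sp B} {e f : V} (hef : B e f = 1) (h : Inv g (Wm B e f)) : Inv g (Wp B e f) := by
  intro x hx
  have h1 := h.inv e (InW_e hef)
  have h2 := h.inv f (InW_f hef)
  rw [mem_Wp, Bgi, Bgi, Bs, W_perp h1 hx, Bs, W_perp h2 hx]; simp

theorem Inv.zc {g : Sp B} {e f : V} (hef : B e f = 1) (h : Inv g (Wm B e f)) : g * z B e f = z B e f * g := by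
  apply sp_ext
  intro x
  obtain ⟨w, u, rfl, h1, h2⟩ := z_dec hef x
  have h3 := (z_neg_iff hef _).2 (h w ((z_neg_iff hef w).1 h1))
  have h4 := (z_fix_iff hef _).2 (mem_Wp.1 (h.wp hef u (mem_Wp.2 ((z_fix_iff hef u).1 h2))))
  simp only [mul_smul, smul_add, h1, h2, h3, h4, smul_neg]

theorem IsS.ne1 {s : Sp B} {e f : V} (h : IsS s e f) : s ≠ 1 := by
  intro h1
  have := h.ford
  have := q_five B
  rw [h1, orderOf_one] at *
  nlinarith

theorem IsS.odd {s : Sp B} {e f : V} (h : IsS s e f) : Odd (orderOf s) := by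
  have h1 := h.ford
  obtain ⟨k, hk⟩ : ∃ k, q = 2*k+1 := ⟨q/2, by have := q_odd B; omega⟩
  rw [hk] at h1
  refine ⟨k^2+k, by nlinarith⟩

theorem IsS.wm {s g : Sp B} {e f : V} (h : IsS s e f) (hc : g * s = s * g) : Inv g (Wm B e f) := by
  have hF : Fx s = Wm B e f := by
    ext x
    refine ⟨fun hx => h.fixpow (k := 1) (by rw [pow_one]; exact h.ne1) (by rw [pow_one]; exact hx), fun hx => h.fixW hx⟩
  rw [← hF]
  exact Inv_Fx hc

theorem Z1 {s h : Sp B} {e f : V} (hs : IsS s e f) (hc : h * s = s * h) (hh : h * h = 1) {v : V} (hv : v ∈ Wm B e f)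
    (hv0 : v ≠ 0) (hhv : h • v = -v) (hn : h ≠ nu B) : h = z B e f := by
  have hef := hs.hef
  have hW := hs.wm hc
  have hP := hW.wp hef
  have hhx : ∀ x : V, h • h • x = x := fun x => by rw [← mul_smul, hh, one_smul]
  have h1 : ∀ w ∈ Wm B e f, h • w = -w := by
    intro w hw
    have h2 : B v (h • w + w) = 0 := by
      have := Bg h v w
      rw [hhv] at this
      simp at this
      rw [map_add, ← this]; simp
    obtain ⟨c, hc⟩ := W_dep hv ((Wm B e f).add_mem (hW w hw) hw) hv0 h2
    have h3 : h • (h • w + w) = h • w + w := by rw [smul_add, hhx, add_comm]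
    rw [hc, gc, hhv] at h3
    have h4 := eq_zero_of_neg B (x := c • v) (by rw [smul_neg] at h3; exact h3.symm)
    rw [h4] at hc
    exact eq_neg_of_add_eq_zero_left hc
  have fin : (∀ u ∈ Wp B e f, h • u = u) → h = z B e f := by
    intro h5
    apply sp_ext
    intro x
    obtain ⟨w, u, rfl, h6, h7⟩ := z_dec hef x
    rw [smul_add, smul_add, h6, h7, h1 w ((z_neg_iff hef w).1 h6), h5 u (mem_Wp.2 ((z_fix_iff hef u).1 h7))]
  rcases hs.inv _ (Inv_Fx hc.symm) with h8 | h8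
  · exfalso
    apply hn
    apply sp_ext
    intro x
    obtain ⟨w, u, rfl, h6, h7⟩ := z_dec hef x
    have hu := mem_Wp.2 ((z_fix_iff hef u).1 h7)
    have h9 : u + h • u ∈ Wm B e f := h8 (by rw [mem_Fx, smul_add, hhx, add_comm])
    have h10 := Submodule.disjoint_def.1 (W_compl hef).disjoint _ h9 ((Wp B e f).add_mem hu (hP u hu))
    rw [smul_add, nu_smul, h1 w ((z_neg_iff hef w).1 h6), eq_neg_of_add_eq_zero_right h10]; abel
  · exact fin fun u hu => h8 hu

theorem T1 {p : ℕ} (hp : p.Prime) [CharP F p] {s g : Sp B} {e f : V} (hs : IsS s e f) (hc : g * s = s * g) {k : ℕ}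
    (hg : g^(p^k) = 1) (h1 : g ≠ 1) : ∃ v ∈ Wm B e f, v ≠ 0 ∧ ∃ b : F, b ≠ 0 ∧ g = t B v b := by
  have hef := hs.hef
  have hW := hs.wm hc
  have hP := hW.wp hef
  have hpf : Fact p.Prime := ⟨hp⟩
  have hpg : IsPGroup p (Subgroup.zpowers g) := by
    rintro ⟨x, n, rfl⟩
    refine ⟨k, Subtype.ext ?_⟩
    show (g^n)^(p^k) = 1
    rw [← zpow_natCast, ← zpow_mul, mul_comm, zpow_mul, zpow_natCast, hg, one_zpow]
  have hI : ∀ {M : Submodule F V}, Inv g M → ∀ x ∈ Subgroup.zpowers g, Inv x M := by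
    intro M hM x hx
    obtain ⟨n, rfl⟩ := (mem_powers_iff_mem_zpowers (x := g)).2 hx
    exact hM.pow n
  have hg1 := Subgroup.mem_zpowers g
  have e4 := finrank_Wp hef
  have e2 := finrank_Wm hef
  have dj := Submodule.disjoint_def.1 (W_compl hef).disjoint
  obtain ⟨x, hx, hxg⟩ := FP hp hpg (hI hW) (fun h => by rw [h, finrank_top, hS.fd] at e2; omega)
  obtain ⟨y, hy, hyg⟩ := FP hp hpg (hI hP) (fun h => by rw [h, finrank_top, hS.fd] at e4; omega)
  have h2 : Wp B e f ≤ Fx g := by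
    rcases hs.inv _ (Inv_Fx hc.symm) with h8 | h8
    · exfalso
      obtain ⟨w, u, rfl, h6, h7⟩ := z_dec hef x
      have hw : w ∈ Wm B e f := (z_neg_iff hef w).1 h6
      have hu := mem_Wp.2 ((z_fix_iff hef u).1 h7)
      apply hx
      apply Submodule.add_mem _ hw
      apply h8
      rw [mem_Fx, ← sub_eq_zero]
      refine dj _ ?_ (Submodule.sub_mem _ (hP u hu) hu)
      have := Submodule.sub_mem _ (hxg g hg1) (Submodule.sub_mem _ (hW w hw) hw)
      rw [smul_add] at this
      convert this using 1; abel
    · exact h8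
  obtain ⟨w, u, rfl, h6, h7⟩ := z_dec hef y
  have hw : w ∈ Wm B e f := (z_neg_iff hef w).1 h6
  have hu := mem_Wp.2 ((z_fix_iff hef u).1 h7)
  have hw0 : w ≠ 0 := by rintro rfl; apply hy; simpa using hu
  have hgw : g • w = w := by
    rw [← sub_eq_zero]
    refine dj _ (Submodule.sub_mem _ (hW w hw) hw) ?_
    have := Submodule.sub_mem _ (hyg g hg1) (Submodule.sub_mem _ (hP u hu) hu)
    rw [smul_add] at this
    convert this using 1; abel
  refine ⟨w, hw, hw0, TR h1 hw0 hgw ?_⟩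
  intro x
  obtain ⟨w', u', rfl, h6', h7'⟩ := z_dec hef x
  have hw' : w' ∈ Wm B e f := (z_neg_iff hef w').1 h6'
  have hu' := mem_Wp.2 ((z_fix_iff hef u').1 h7')
  obtain ⟨c, hc⟩ := W_dep hw (Submodule.sub_mem _ (hW w' hw') hw') hw0 (by
    have := Bg g w w'
    rw [hgw] at this
    rw [map_sub, this, sub_self])
  refine ⟨c, ?_⟩
  rw [smul_add, mem_Fx.1 (h2 hu'), ← hc]; abel

theorem tr1 {x y : V} (h : B x y ≠ 0) : ∃ a : F, t B (y - x) a • x = y := by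
  refine ⟨(B x y)⁻¹, ?_⟩
  rw [t_smul, map_sub, hS.alt, sub_zero, inv_mul_cancel₀ h]; simp

theorem ex_ne0 {x y : V} (hx : x ≠ 0) (hy : y ≠ 0) : ∃ w, B x w ≠ 0 ∧ B w y ≠ 0 := by
  obtain ⟨a, ha⟩ := nd' (B := B) hx
  obtain ⟨b, hb⟩ := nd' (B := B) hy
  by_cases h1 : B a y = 0
  · by_cases h2 : B x b = 0
    · refine ⟨a + b, ?_, ?_⟩
      · rw [map_add, ha, h2]; simp
      · rw [map_add, LinearMap.add_apply, h1, Bs b y, hb]; simp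
    · exact ⟨b, h2, by rw [Bs, hb]; simp⟩
  · exact ⟨a, by rw [ha]; simp, h1⟩

theorem trans1 {x y : V} (hx : x ≠ 0) (hy : y ≠ 0) : ∃ g : Sp B, g • x = y := by
  obtain ⟨w, h1, h2⟩ := ex_ne0 (B := B) hx hy
  obtain ⟨a, ha⟩ := tr1 h1
  obtain ⟨b, hb⟩ := tr1 h2
  exact ⟨_, by rw [← hb, ← ha, ← mul_smul]⟩

theorem ne_of_pair {e f : V} (h : B e f = 1) : e ≠ 0 := by rintro rfl; simp at h

theorem trans2 {e f e' f' : V} (h : B e f = 1) (h' : B e' f' = 1) : ∃ g : Sp B, g • e = e' ∧ g • f = f' := by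
  obtain ⟨g, hg⟩ := trans1 (B := B) (ne_of_pair h) (ne_of_pair h')
  have h1 : B e' (g • f) = 1 := by rw [← hg, Bg, h]
  have key : ∀ x y : V, B e' x = 1 → B e' y = 1 → B x y ≠ 0 → ∃ k : Sp B, k • e' = e' ∧ k • x = y := by
    intro x y hx hy hxy
    obtain ⟨a, ha⟩ := tr1 hxy
    exact ⟨_, by rw [t_smul, map_sub, hx, hy]; simp, ha⟩
  by_cases h2 : B (g • f) f' = 0
  · obtain ⟨k, k1, k2⟩ := key (g • f) (g • f + e') h1 (by rw [map_add, h1, hS.alt, add_zero]) (by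
      rw [map_add, hS.alt, Bs, h1]; simp)
    obtain ⟨l, l1, l2⟩ := key (g • f + e') f' (by rw [map_add, h1, hS.alt, add_zero]) h' (by
      rw [map_add, LinearMap.add_apply, h2, h']; simp)
    exact ⟨l * k * g, by rw [mul_smul, mul_smul, hg, k1, l1], by rw [mul_smul, mul_smul, k2, l2]⟩
  · obtain ⟨k, k1, k2⟩ := key (g • f) f' h1 h' h2
    exact ⟨k * g, by rw [mul_smul, hg, k1], by rw [mul_smul, k2]⟩

end base
end
end PSP

open Module
set_option linter.unusedSectionVars false
set_option linter.unusedVariables false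
set_option linter.style.longLine false
set_option linter.unnecessarySimpa false
set_option linter.unusedSimpArgs false
namespace PSP
noncomputable section
section base
variable {F : Type*} {V : Type*} [Field F] [Fintype F] [AddCommGroup V] [Module F V] [FiniteDimensional F V]
variable {B : V →ₗ[F] V →ₗ[F] F}
variable [hS : Sy B]

local notation "q" => Fintype.card F

theorem Fx_conj (g y : Sp B) : finrank F (Fx y) ≤ finrank F (Fx (g * y * g⁻¹)) := by
  let φ : Fx y →ₗ[F] Fx (g * y * g⁻¹) := LinearMap.codRestrict _ ((En g).comp (Submodule.subtype _)) (by
    intro x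
    have := mem_Fx.1 x.2
    show (g * y * g⁻¹) • (g • x.1) = g • x.1
    rw [mul_smul, inv_smul_smul, mul_smul, this])
  apply LinearMap.finrank_le_finrank_of_injective (f := φ)
  intro x x' h
  have : g • x.1 = g • x'.1 := congrArg Subtype.val h
  exact Subtype.ext (MulAction.injective g this)

theorem pg_of {p k : ℕ} {X : Subgroup (Sp B)} (y : X) (hy : y.1^(p^k) = 1) : IsPGroup p (Subgroup.zpowers y) := by
  rintro ⟨x, n, rfl⟩
  refine ⟨k, Subtype.ext ?_⟩
  show (y^n)^(p^k) = 1
  have : y^(p^k) = 1 := Subtype.ext hy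
  rw [← zpow_natCast, ← zpow_mul, mul_comm, zpow_mul, zpow_natCast, this, one_zpow]

theorem L4 {a c : Sp B} {N M : ℕ} (hN : 2*N = q^3+1) (ha : PO a N) (hM : 2*M+1 = q^3) (hc : PO c M)
    {X : Subgroup (Sp B)} (haX : a ∈ X) (hcX : c ∈ X) (hnX : nu B ∈ X) {p : ℕ} (hp : p.Prime) [CharP F p]
    {u y : Sp B} (huX : u ∈ X) (hyX : y ∈ X) {k l : ℕ} (hu : u^(p^k) = 1) (hy : y^(p^l) = 1)
    (h1 : finrank F (Fx u) = 1) (h2 : 2 ≤ finrank F (Fx y)) (hyz : ∀ g : Sp B, IsZ g → y * g ≠ g * y) : X = ⊤ := by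
  have hpf : Fact p.Prime := ⟨hp⟩
  obtain ⟨P, hP⟩ := (pg_of ⟨u, huX⟩ hu).exists_le_sylow
  obtain ⟨Q, hQ⟩ := (pg_of ⟨y, hyX⟩ hy).exists_le_sylow
  obtain ⟨g, hg⟩ := MulAction.exists_smul_eq X Q P
  have hm : g * ⟨y, hyX⟩ * g⁻¹ ∈ P := by
    rw [← hg]
    exact Subgroup.smul_mem_pointwise_smul _ (MulAut.conj g) _ (hQ (Subgroup.mem_zpowers _))
  have hPg : IsPGroup p (P.1.map X.subtype) := P.2.map _
  obtain ⟨v, hv, b, hb, x, hx, hxv⟩ := UY hp hPg (u := u) (y := g.1 * y * g.1⁻¹)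
    ⟨⟨u, huX⟩, hP (Subgroup.mem_zpowers _), rfl⟩ ⟨_, hm, rfl⟩ h1 (h2.trans (Fx_conj _ _)) (by
      intro w hw hcw
      refine hyz _ (hw.conj g.1⁻¹) ?_
      calc y * (g.1⁻¹ * w * g.1⁻¹⁻¹) = g.1⁻¹ * (g.1 * y * g.1⁻¹ * w) * g.1 := by group
        _ = g.1⁻¹ * (w * (g.1 * y * g.1⁻¹)) * g.1 := by rw [hcw]
        _ = _ := by group)
  exact ACT hN ha hM hc haX hcX hnX hv hb (by rw [← hxv]; exact x.2)

section lift
variable {G : Type*} [Group G] {π : Sp B →* G}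

structure Prj (π : Sp B →* G) : Prop where
  sur : Function.Surjective π
  ker : ∀ g, π g = 1 ↔ g = 1 ∨ g = nu B

def Lf (π : Sp B →* G) (φ : G ≃* G) (g g' : Sp B) : Prop := π g' = φ (π g)

variable {φ : G ≃* G}

theorem Lf.mul {g g' h h' : Sp B} (hg : Lf π φ g g') (hh : Lf π φ h h') : Lf π φ (g * h) (g' * h') := by
  unfold Lf at *; rw [map_mul, map_mul, map_mul, hg, hh]
theorem Lf.inv {g g' : Sp B} (hg : Lf π φ g g') : Lf π φ g⁻¹ g'⁻¹ := by
  unfold Lf at *; rw [map_inv, map_inv, map_inv, hg]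
theorem Lf.pow {g g' : Sp B} (hg : Lf π φ g g') (n : ℕ) : Lf π φ (g^n) (g'^n) := by
  unfold Lf at *; rw [map_pow, map_pow, map_pow, hg]
theorem Lf.symm {g g' : Sp B} (hg : Lf π φ g g') : Lf π φ.symm g' g := by
  unfold Lf at *; rw [hg]; simp

theorem Prj.eq (h : Prj π) {g g' : Sp B} (e : π g = π g') : g = g' ∨ g = nu B * g' := by
  have : π (g * g'⁻¹) = 1 := by rw [map_mul, map_inv, e, mul_inv_cancel]
  rcases (h.ker _).1 this with h | h
  · left; exact mul_inv_eq_one.1 h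
  · right; rw [← h]; group

theorem Prj.nu (h : Prj π) : π (nu B) = 1 := (h.ker _).2 (Or.inr rfl)

theorem Prj.ex (h : Prj π) (φ : G ≃* G) (g : Sp B) : ∃ g', Lf π φ g g' := h.sur _

theorem Lf.nu (h : Prj π) {g g' : Sp B} (hg : Lf π φ g g') : Lf π φ g (PSP.nu B * g') := by
  unfold Lf at *; rw [map_mul, h.nu, one_mul, hg]

theorem Lf.one (h : Prj π) {g g' : Sp B} (hg : Lf π φ g g') : (g' = 1 ∨ g' = PSP.nu B) ↔ (g = 1 ∨ g = PSP.nu B) := by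
  rw [← h.ker, ← h.ker, hg]; simp

theorem nu_odd {n : ℕ} (hn : Odd n) : (nu B)^n = nu B := by
  obtain ⟨k, rfl⟩ := hn
  rw [pow_succ, nu_pow, one_mul]

theorem nuc (g : Sp B) : Commute (nu B) g := (nu_comm g).symm

theorem Prj.odd (h : Prj π) (φ : G ≃* G) {n : ℕ} (hn : Odd n) {g : Sp B} (hg : g^n = 1) : ∃ g', Lf π φ g g' ∧ g'^n = 1 := by
  obtain ⟨g', hg'⟩ := h.ex φ g
  rcases ((hg'.pow n).one h).2 (Or.inl hg) with h1 | h1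
  · exact ⟨g', hg', h1⟩
  · refine ⟨_, hg'.nu h, ?_⟩
    rw [(nuc g').mul_pow, h1, nu_odd hn, nu_sq]

theorem Lf.comm (h : Prj π) {g g' k k' : Sp B} (hg : Lf π φ g g') (hk : Lf π φ k k') (hc : g * k = k * g) {n : ℕ}
    (hn : Odd n) (hgn : g'^n = 1) : g' * k' = k' * g' := by
  have h1 : π (k' * g' * k'⁻¹) = π g' := by
    have := (hk.mul hg).mul hk.inv
    rw [this, hg]
    congr 2
    rw [← hc]; group
  rcases h.eq h1 with h2 | h2
  · rw [← h2]; simp [mul_assoc, h2]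
    rw [mul_inv_eq_iff_eq_mul] at h2; rw [h2]
  · exfalso
    have h3 : (k' * g' * k'⁻¹)^n = 1 := by rw [conj_pow, hgn]; group
    rw [h2, (nuc g').mul_pow, hgn, nu_odd hn, mul_one] at h3
    exact nu_ne h3

theorem Lf.po (h : Prj π) {a a' : Sp B} (hl : Lf π φ a a') {N : ℕ} (ha : PO a N) : PO a' N := by
  intro k
  rw [(hl.pow k).one h, ha k]

theorem Prj.S (h : Prj π) (φ : G ≃* G) {s : Sp B} {e f : V} (hs : IsS s e f) :
    ∃ s' e' f', Lf π φ s s' ∧ IsS s' e' f' := by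
  obtain ⟨s', hl, hs'⟩ := h.odd φ hs.odd (pow_orderOf_eq_one s)
  have : orderOf s' = orderOf s := by
    apply Nat.dvd_antisymm
    · exact orderOf_dvd_of_pow_eq_one hs'
    · apply orderOf_dvd_of_pow_eq_one
      rcases ((hl.pow (orderOf s')).one h).1 (Or.inl (pow_orderOf_eq_one s')) with h1 | h1
      · exact h1
      · exfalso
        have h2 : (s^orderOf s')^(orderOf s) = 1 := by rw [← pow_mul, mul_comm, pow_mul, pow_orderOf_eq_one, one_pow]
        rw [h1, nu_odd hs.odd] at h2
        exact nu_ne h2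
  obtain ⟨e', f', hs''⟩ := exS (s := s') (by rw [this]; exact hs.ford)
  exact ⟨s', e', f', hl, hs''⟩

end lift
end base
end
end PSP

open Module
set_option linter.unusedSectionVars false
set_option linter.unusedVariables false
set_option linter.style.longLine false
set_option linter.unnecessarySimpa false
set_option linter.unusedSimpArgs false
namespace PSP
noncomputable section
section base
variable {F : Type*} {V : Type*} [Field F] [Fintype F] [AddCommGroup V] [Module F V] [FiniteDimensional F V]
variable {B : V →ₗ[F] V →ₗ[F] F}
variable [hS : Sy B]

local notation "q" => Fintype.card F

section lift
variable {G : Type*} [Group G] {π : Sp B →* G} {φ : G ≃* G}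

def TT (π : Sp B →* G) (φ : G ≃* G) (v v' : V) : Prop :=
  v' ≠ 0 ∧ ∀ a : F, ∃ a' : F, (a ≠ 0 → a' ≠ 0) ∧ Lf π φ (t B v a) (t B v' a')

theorem t_ne {v : V} {a : F} (hv : v ≠ 0) (ha : a ≠ 0) : ¬ (t B v a = 1 ∨ t B v a = nu B) := by
  rintro (h | h)
  · exact ha (t_eq_one hv h)
  · apply hv
    apply eq_zero_of_neg B
    have := congrArg (fun g : Sp B => g • v) h
    simp only [t_smul, nu_smul, hS.alt, mul_zero, zero_smul, add_zero] at this
    exact this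

theorem TZ (hπ : Prj π) (φ : G ≃* G) {s : Sp B} {e f : V} (hs : IsS s e f) : ∃ s' e' f' v', Lf π φ s s' ∧ IsS s' e' f' ∧
    v' ∈ Wm B e' f' ∧ TT π φ e v' ∧ Lf π φ (z B e f) (z B e' f') := by
  obtain ⟨p, n, hp, hch, h5, -, -⟩ := q_pf B
  have hodd : Odd p := hp.odd_of_ne_two (by omega)
  have hef := hs.hef
  have he0 := ne_of_pair hef
  obtain ⟨s', e', f', hl, hs'⟩ := hπ.S φ hs
  have hst : ∀ a, s * t B e a = t B e a * s := fun a => by rw [t_conj', hs.se]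
  have key : ∀ a : F, a ≠ 0 → ∃ v ∈ Wm B e' f', v ≠ 0 ∧ ∃ b : F, b ≠ 0 ∧ Lf π φ (t B e a) (t B v b) := by
    intro a ha
    obtain ⟨t', hlt, htp⟩ := hπ.odd φ hodd (g := t B e a) (by rw [t_pow, CharP.cast_eq_zero, zero_mul, t_zero])
    have hc : s' * t' = t' * s' := hl.comm hπ hlt (hst a) hs'.odd (pow_orderOf_eq_one _)
    obtain ⟨v, hv, hv0, b, hb, rfl⟩ := T1 hp hs' hc.symm (k := 1) (by rw [pow_one, htp]) (by
      rintro rfl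
      exact t_ne he0 ha ((hlt.one hπ).1 (Or.inl rfl)))
    exact ⟨v, hv, hv0, b, hb, hlt⟩
  have tp : ∀ (v : V) (b : F), (t B v b)^p = 1 := by intro v b; rw [t_pow, CharP.cast_eq_zero, zero_mul, t_zero]
  obtain ⟨v, hv, hv0, b, hb, hlb⟩ := key 1 one_ne_zero
  have hTT : TT π φ e v := by
    refine ⟨hv0, fun a => ?_⟩
    by_cases ha : a = 0
    · refine ⟨0, fun h => (h ha).elim, ?_⟩
      rw [ha, t_zero, t_zero, Lf]; simp
    obtain ⟨w, hw, hw0, d, hd, hld⟩ := key a ha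
    have hc := hlb.comm hπ hld (by rw [t_mul, t_mul, add_comm]) hodd (tp _ _)
    rw [t_conj'] at hc
    have h1 := mul_right_cancel hc
    obtain ⟨c, hc0, hcw⟩ := t_eq (v := w) hw0 hd h1.symm
    have hBvw : B v w = 0 := by
      by_contra hne
      rw [t_smul] at hcw
      have h3 := congrArg (fun x => B v x) hcw
      simp only [map_add, map_smul, hS.alt, smul_eq_mul, mul_zero, add_zero] at h3
      have hc1 : c = 1 := by
        apply mul_right_cancel₀ hne
        rw [one_mul]; linear_combination -h3
      rw [hc1, one_smul, add_eq_left, smul_eq_zero] at hcw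
      rcases hcw with h6 | h6
      · exact (mul_ne_zero hb (by rw [Bs]; exact neg_ne_zero.2 hne)) h6
      · exact hv0 h6
    obtain ⟨k, rfl⟩ := W_dep hv hw hv0 hBvw
    refine ⟨k^2*d, fun _ => mul_ne_zero (pow_ne_zero 2 ?_) hd, by rw [← t_smul_v]; exact hld⟩
    rintro rfl; exact hw0 (zero_smul _ _)
  refine ⟨s', e', f', v, hl, hs', hv, hTT, ?_⟩
  have hsz : s * z B e f = z B e f * s := Inv.zc hef (hs.wm rfl)
  have hze : z B e f • e = -e := (z_neg_iff hef e).2 (InW_e hef)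
  have fin : ∀ h : Sp B, Lf π φ (z B e f) h → h • v = -v → Lf π φ (z B e f) (z B e' f') := by
    intro h hh hhv
    rw [← Z1 hs' (hl.comm hπ hh hsz hs'.odd (pow_orderOf_eq_one _)).symm ?_ hv hv0 hhv ?_]
    · exact hh
    · have h1 := hh.mul hh
      rw [z_sq hef] at h1
      rcases (h1.one hπ).2 (Or.inl rfl) with h2 | h2
      · exact h2
      · exfalso
        have := congrArg (fun g : Sp B => g • v) h2
        simp only [mul_smul, hhv, smul_neg, neg_neg, nu_smul] at this
        exact hv0 (eq_zero_of_neg B this)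
    · intro h1
      rcases (hh.one hπ).1 (Or.inr h1) with h2 | h2
      · rw [h2, one_smul] at hze
        exact he0 (eq_zero_of_neg B hze)
      · obtain ⟨x, hx0, hx⟩ := ex_perp (B := B) (M := Wm B e f) (by
          intro hT
          have := finrank_Wm hef
          rw [hT, finrank_top, hS.fd] at this; omega)
        have h3 := (z_fix_iff hef x).2 ⟨hx e (InW_e hef), hx f (InW_f hef)⟩
        rw [h2, nu_smul] at h3
        exact hx0 (eq_zero_of_neg B h3.symm)
  obtain ⟨h, hh⟩ := hπ.ex φ (z B e f)
  have hc := hlb.comm hπ hh (by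
    rw [t_conj' (z B e f), hze, ← neg_one_smul F, t_smul_v]; norm_num) hodd (tp _ _)
  rw [t_conj'] at hc
  have h1 := mul_right_cancel hc
  obtain ⟨c, hc0, hcw⟩ := t_eq hv0 hb h1
  rw [hcw, t_smul_v] at h1
  have h2 : c^2 = 1 := by
    have h3 : t B v (b - c^2*b) = 1 := by
      rw [sub_eq_add_neg, ← t_mul, ← t_inv, ← h1, mul_inv_cancel]
    have h4 := t_eq_one hv0 h3
    apply mul_right_cancel₀ hb; linear_combination -h4
  rcases sq_eq_one_iff.1 h2 with h3 | h3
  · refine fin _ (hh.nu hπ) ?_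
    rw [mul_smul, nu_smul, hcw, h3, one_smul]
  · exact fin _ hh (by rw [hcw, h3, neg_one_smul])

theorem Prj.T (hπ : Prj π) (φ : G ≃* G) {s : Sp B} {e f : V} (hs : IsS s e f) {v : V} (hv : v ≠ 0) : ∃ v', TT π φ v v' := by
  obtain ⟨s', e', f', w, -, -, -, h, -⟩ := TZ hπ φ hs
  obtain ⟨g, rfl⟩ := trans1 (B := B) (ne_of_pair hs.hef) hv
  obtain ⟨g', hg⟩ := hπ.ex φ g
  refine ⟨g' • w, ?_, fun a => ?_⟩
  · intro h0
    exact h.1 (by rw [← inv_smul_smul g' w, h0, smul_zero])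
  · obtain ⟨a', h1, h2⟩ := h.2 a
    refine ⟨a', h1, ?_⟩
    rw [← t_conj, ← t_conj]
    exact (hg.mul h2).mul hg.inv

theorem Prj.Z (hπ : Prj π) (φ : G ≃* G) {s : Sp B} {e f : V} (hs : IsS s e f) {g : Sp B} (hg : IsZ g) :
    ∃ g', IsZ g' ∧ Lf π φ g g' := by
  obtain ⟨s', e', f', w, -, hs', -, -, h⟩ := TZ hπ φ hs
  obtain ⟨e1, f1, h1, rfl⟩ := hg
  obtain ⟨g, rfl, rfl⟩ := trans2 hs.hef h1
  obtain ⟨g', hg⟩ := hπ.ex φ g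
  refine ⟨g' * z B e' f' * g'⁻¹, IsZ.conj ⟨_, _, hs'.hef, rfl⟩ _, ?_⟩
  rw [← z_conj g hs.hef]
  exact (hg.mul h).mul hg.inv

/-- equal images of transvections -/
theorem TT.par (hπ : Prj π) {v w : V} {a b : F} (hv : v ≠ 0) (ha : a ≠ 0) (h : π (t B v a) = π (t B w b)) :
    ∃ c : F, c ≠ 0 ∧ w = c • v := by
  rcases hπ.eq h with h1 | h1
  · exact t_eq hv ha h1
  · exfalso
    obtain ⟨x, hx0, hx⟩ := ex_perp (B := B) (M := Submodule.span F {v, w}) (by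
      intro hT
      classical
      have h2 := finrank_span_finset_le_card (R := F) ({v, w} : Finset V)
      rw [Finset.coe_pair, Set.finrank, hT, finrank_top, hS.fd] at h2
      have h3 := Finset.card_le_two (a := v) (b := w)
      omega)
    have h2 := congrArg (fun g : Sp B => g • x) h1
    simp only [mul_smul, t_smul, nu_smul, hx v (Submodule.subset_span (by simp)), hx w (Submodule.subset_span (by simp)),
      mul_zero, zero_smul, add_zero] at h2
    exact hx0 (eq_zero_of_neg B h2)

theorem TT.li (hπ : Prj π) {v v' : V} (h : TT π φ v v') {k k' : Sp B} (hk : Lf π φ k k') (hl : LI k v) : LI k' v' := by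
  obtain ⟨c, hc⟩ := hl
  obtain ⟨a, ha, h1⟩ := h.2 1
  obtain ⟨b, hb, h2⟩ := h.2 (c^2 * 1)
  have h3 := (hk.mul h1).mul hk.inv
  rw [t_conj, t_conj, hc, t_smul_v] at h3
  have h4 : π (t B v' b) = π (t B (k' • v') a) := Eq.trans h2 (Eq.symm h3)
  obtain ⟨d, -, hd⟩ := TT.par hπ (v := k' • v') (w := v') (a := a) (b := b) (by
    intro h0
    exact h.1 (by rw [← inv_smul_smul k' v', h0, smul_zero])) (ha one_ne_zero) h4.symm
  have hd0 : d ≠ 0 := by rintro rfl; rw [zero_smul] at hd; exact h.1 hd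
  exact ⟨d⁻¹, by nth_rw 2 [hd]; rw [smul_smul, inv_mul_cancel₀ hd0, one_smul]⟩

theorem TT.inj (hπ : Prj π) {s : Sp B} {e f : V} (hs : IsS s e f) {v w v' w' : V} (hv0 : v ≠ 0) (hv : TT π φ v v')
    (hw : TT π φ w w') (hw0 : w ≠ 0) {c : F} (h : w' = c • v') : ∃ d : F, w = d • v := by
  obtain ⟨x, hx⟩ := hπ.T φ.symm hs hv.1
  obtain ⟨a, ha, h1⟩ := hv.2 1
  obtain ⟨b, hb, h2⟩ := hw.2 1
  rw [h, t_smul_v] at h2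
  obtain ⟨a', -, h3⟩ := hx.2 a
  obtain ⟨b', -, h4⟩ := hx.2 (c^2*b)
  obtain ⟨d1, hd1, e1⟩ := TT.par hπ hv0 one_ne_zero (Eq.trans h1.symm (Eq.symm h3) : π (t B v 1) = π (t B x a'))
  obtain ⟨d2, hd2, e2⟩ := TT.par hπ hw0 one_ne_zero (Eq.trans h2.symm (Eq.symm h4) : π (t B w 1) = π (t B x b'))
  refine ⟨d2⁻¹ * d1, ?_⟩
  rw [mul_smul, ← e1, e2, smul_smul, inv_mul_cancel₀ hd2, one_smul]

end lift
end base
end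
end PSP

open Module
set_option linter.unusedSectionVars false
set_option linter.unusedVariables false
set_option linter.style.longLine false
set_option linter.unnecessarySimpa false
set_option linter.unusedSimpArgs false
namespace PSP
noncomputable section
section base
variable {F : Type*} {V : Type*} [Field F] [Fintype F] [AddCommGroup V] [Module F V] [FiniteDimensional F V]
variable {B : V →ₗ[F] V →ₗ[F] F}
variable [hS : Sy B]

local notation "q" => Fintype.card F

/-- the elements needed for the main argument -/
structure Dat (B : V →ₗ[F] V →ₗ[F] F) [hS : Sy B] (p : ℕ) (a c s b E D y u : Sp B) (N M : ℕ) (e f : V) : Prop where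
  hN : 2*N = q^3+1
  ha : PO a N
  hM : 2*M+1 = q^3
  hc : PO c M
  hs : IsS s e f
  b1 : ∃ i, b^i = s
  b2 : ∃ i, b^i = t B e 1
  b3 : ∃ i, b^i = z B e f
  E1 : ∃ i, E^i = s
  E2 : ∃ i, E^i = z B e f
  E3 : ∀ x, x ≠ 0 → ¬ LI E x
  D1 : ∃ i, D^i = y
  D2 : ∀ x, x ≠ 0 → ¬ LI D x
  y1 : ∃ k, y^(p^k) = 1
  y2 : 2 ≤ finrank F (Fx y)
  y3 : ∀ g : Sp B, IsZ g → y * g ≠ g * y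
  u1 : ∃ k, u^(p^k) = 1
  u2 : finrank F (Fx u) = 1
  u3 : ∀ g : Sp B, IsZ g → u * g ≠ g * u

theorem LI.inv {g : Sp B} {x : V} (h : LI g x) : Inv g (Submodule.span F {x}) := by
  obtain ⟨c, hc⟩ := h
  intro y hy
  obtain ⟨d, rfl⟩ := Submodule.mem_span_singleton.1 hy
  rw [gc, hc, smul_smul]
  exact Submodule.smul_mem _ _ (Submodule.mem_span_singleton_self x)

theorem LI.pow {g : Sp B} {x : V} (h : LI g x) (n : ℕ) : ∃ c : F, g • x = c • x ∧ g^n • x = c^n • x := by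
  obtain ⟨c, hc⟩ := h
  refine ⟨c, hc, ?_⟩
  induction n with
  | zero => simp
  | succ n ih => rw [pow_succ, mul_smul, hc, gc, ih, smul_smul, pow_succ, mul_comm]

section lift
variable {G : Type*} [Group G] {π : Sp B →* G} {φ : G ≃* G}

theorem Lf.nli (hπ : Prj π) {s : Sp B} {e f : V} (hs : IsS s e f) {g g' : Sp B} (h : Lf π φ g g') (hn : ∀ x, x ≠ 0 → ¬ LI g x) :
    ∀ x, x ≠ 0 → ¬ LI g' x := by
  intro x hx hl
  obtain ⟨w, hw⟩ := hπ.T φ.symm hs hx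
  exact hn w hw.1 (hw.li hπ h.symm hl)

theorem Lf.nz (hπ : Prj π) {s : Sp B} {e f : V} (hs : IsS s e f) {g g' : Sp B} (h : Lf π φ g g') {n : ℕ} (hn : Odd n)
    (hg : g^n = 1) (hz : ∀ k : Sp B, IsZ k → g * k ≠ k * g) {n' : ℕ} (hn' : Odd n') (hg' : g'^n' = 1) :
    ∀ k : Sp B, IsZ k → g' * k ≠ k * g' := by
  intro k hk hc
  obtain ⟨k', hk', hl⟩ := hπ.Z φ.symm hs hk
  exact hz k' hk' (h.symm.comm hπ hl hc hn hg)

theorem fix_of_li {p : ℕ} (hp : p.Prime) [CharP F p] {g : Sp B} {x : V} (hx : x ≠ 0) (h : LI g x) {k : ℕ} (hg : g^(p^k) = 1) :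
    g • x = x := by
  have : Fact p.Prime := ⟨hp⟩
  obtain ⟨c, h1, h2⟩ := h.pow (p^k)
  rw [hg, one_smul] at h2
  have h3 : c^(p^k) = 1 := by
    have : (c^(p^k) - 1) • x = 0 := by rw [sub_smul, ← h2, one_smul, sub_self]
    exact sub_eq_zero.1 ((smul_eq_zero.1 this).resolve_right hx)
  have h4 : (c - 1)^(p^k) = 0 := by rw [sub_pow_char_pow, h3, one_pow, sub_self]
  have h5 := sub_eq_zero.1 (eq_zero_of_pow_eq_zero h4)
  rw [h1, h5, one_smul]

theorem Lf.fx2 (hπ : Prj π) {s : Sp B} {e f : V} (hs : IsS s e f) {p : ℕ} (hp : p.Prime) [CharP F p] {g g' : Sp B}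
    (h : Lf π φ g g') {l : ℕ} (hg' : g'^(p^l) = 1)
    (h2 : 2 ≤ finrank F (Fx g)) : 2 ≤ finrank F (Fx g') := by
  have lem : ∀ v ∈ Fx g, v ≠ 0 → ∀ w, TT π φ v w → w ∈ Fx g' := by
    intro v hv hv0 w hw
    exact fix_of_li hp hw.1 (hw.li hπ h ⟨1, by rw [one_smul]; exact hv⟩) hg'
  by_contra hlt
  have hne : Fx g ≠ ⊥ := by intro h0; rw [h0, finrank_bot] at h2; omega
  obtain ⟨v, hv, hv0⟩ := Submodule.exists_mem_ne_zero_of_ne_bot hne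
  obtain ⟨v', hv'⟩ := hπ.T φ hs hv0
  have m1 := lem v hv hv0 v' hv'
  have h1 : finrank F (Fx g') = 1 := by
    have : Fx g' ≠ ⊥ := by intro h0; rw [h0] at m1; exact hv'.1 (by simpa using m1)
    have := Submodule.one_le_finrank_iff.2 this
    omega
  have hle : Fx g ≤ Submodule.span F {v} := by
    intro w hw
    by_cases hw0 : w = 0
    · rw [hw0]; exact Submodule.zero_mem _
    obtain ⟨w', hw'⟩ := hπ.T φ hs hw0
    have m2 := lem w hw hw0 w' hw'
    obtain ⟨c, hc⟩ := exists_smul_eq_of_finrank_eq_one h1 (x := ⟨v', m1⟩) (by simpa [Subtype.ext_iff] using hv'.1) ⟨w', m2⟩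
    obtain ⟨d, hd⟩ := TT.inj hπ hs hv0 hv' hw' hw0 (congrArg Subtype.val hc).symm
    rw [hd]
    exact Submodule.smul_mem _ _ (Submodule.mem_span_singleton_self v)
  have := Submodule.finrank_mono hle
  rw [finrank_span_singleton hv0] at this
  omega

theorem Lf.fx1 (hπ : Prj π) {s : Sp B} {e f : V} (hs : IsS s e f) {p : ℕ} (hp : p.Prime) [CharP F p] {g g' : Sp B}
    (h : Lf π φ g g') {k l : ℕ} (hg : g^(p^k) = 1) (hg' : g'^(p^l) = 1)
    (h2 : finrank F (Fx g) = 1) : finrank F (Fx g') = 1 := by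
  have hne : Fx g ≠ ⊥ := by intro h0; rw [h0, finrank_bot] at h2; omega
  obtain ⟨v, hv, hv0⟩ := Submodule.exists_mem_ne_zero_of_ne_bot hne
  obtain ⟨w, hw⟩ := hπ.T φ hs hv0
  have m1 : w ∈ Fx g' := fix_of_li hp hw.1 (hw.li hπ h ⟨1, by rw [one_smul]; exact hv⟩) hg'
  have : Fx g' ≠ ⊥ := by intro h0; rw [h0] at m1; exact hw.1 (by simpa using m1)
  have h3 := Submodule.one_le_finrank_iff.2 this
  by_contra h4
  have := h.symm.fx2 hπ hs hp hg (by omega)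
  omega

def In (π : Sp B →* G) (Y : Subgroup G) (g : Sp B) : Prop := ∃ φ : G ≃* G, φ (π g) ∈ Y

theorem mem_of_lf {Y : Subgroup G} {g g' k : Sp B} (hg : φ (π g) ∈ Y) (hk : ∃ i, g^i = k) (h : Lf π φ k g') : g' ∈ Y.comap π := by
  obtain ⟨i, rfl⟩ := hk
  rw [Subgroup.mem_comap, h, map_pow, map_pow]
  exact Y.pow_mem hg i

theorem MAIN (hπ : Prj π) {p : ℕ} (hp : p.Prime) [CharP F p] (hodd : Odd p) {a c s b E D y u : Sp B} {N M : ℕ} {e f : V}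
    (d : Dat B p a c s b E D y u N M e f) (H K : Subgroup G) (hH : H ≠ ⊤) (hK : K ≠ ⊤) :
    ∃ g : G, ∀ φ : G ≃* G, φ g ∉ H ∧ φ g ∉ K := by
  have hX : ∀ Y : Subgroup G, Y ≠ ⊤ → Y.comap π ≠ ⊤ := by
    intro Y hY h
    apply hY
    rw [eq_top_iff]
    intro x _
    obtain ⟨g, rfl⟩ := hπ.sur x
    have : g ∈ Y.comap π := by rw [h]; trivial
    exact this
  have hnu : ∀ Y : Subgroup G, nu B ∈ Y.comap π := by
    intro Y; rw [Subgroup.mem_comap, hπ.nu]; exact Y.one_mem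
  have inA : ∀ Y, In π Y a → ∃ a' ∈ Y.comap π, PO a' N := by
    rintro Y ⟨φ, h⟩
    obtain ⟨a', ha'⟩ := hπ.ex φ a
    exact ⟨a', mem_of_lf h ⟨1, pow_one _⟩ ha', ha'.po hπ d.ha⟩
  have inC : ∀ Y, In π Y c → ∃ c' ∈ Y.comap π, PO c' M := by
    rintro Y ⟨φ, h⟩
    obtain ⟨a', ha'⟩ := hπ.ex φ c
    exact ⟨a', mem_of_lf h ⟨1, pow_one _⟩ ha', ha'.po hπ d.hc⟩
  have inB : ∀ Y, Y ≠ ⊤ → In π Y b → (∃ x, x ≠ 0 ∧ ∀ g ∈ Y.comap π, LI g x) ∨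
      (∃ e f, B e f = 1 ∧ ∀ g ∈ Y.comap π, Inv g (Wm B e f)) := by
    rintro Y hY ⟨φ, h⟩
    obtain ⟨s', e', f', v', l1, hs', hv, hT, l2⟩ := TZ hπ φ d.hs
    obtain ⟨a', ha', l3⟩ := hT.2 1
    rcases RED (hX Y hY) hs' (mem_of_lf h d.b1 l1) hv hT.1 (ha' one_ne_zero) (mem_of_lf h d.b2 l3) (mem_of_lf h d.b3 l2) with h1 | h1
    · exact Or.inl h1
    · exact Or.inr ⟨e', f', hs'.hef, h1⟩
  have inE : ∀ Y, In π Y E → ∃ s' e' f', IsS s' e' f' ∧ s' ∈ Y.comap π ∧ z B e' f' ∈ Y.comap π ∧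
      ∃ E' ∈ Y.comap π, ∀ x, x ≠ 0 → ¬ LI E' x := by
    rintro Y ⟨φ, h⟩
    obtain ⟨s', e', f', v', l1, hs', hv, hT, l2⟩ := TZ hπ φ d.hs
    obtain ⟨E', l3⟩ := hπ.ex φ E
    exact ⟨s', e', f', hs', mem_of_lf h d.E1 l1, mem_of_lf h d.E2 l2, E', mem_of_lf h ⟨1, pow_one _⟩ l3, l3.nli hπ d.hs d.E3⟩
  have inD : ∀ Y, In π Y D → ∃ y' ∈ Y.comap π, (∃ k, y'^(p^k) = 1) ∧ 2 ≤ finrank F (Fx y') ∧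
      (∀ g : Sp B, IsZ g → y' * g ≠ g * y') ∧ ∃ D' ∈ Y.comap π, ∀ x, x ≠ 0 → ¬ LI D' x := by
    rintro Y ⟨φ, h⟩
    obtain ⟨k, hk⟩ := d.y1
    obtain ⟨y', l1, h1⟩ := hπ.odd φ (hodd.pow (n := k)) hk
    obtain ⟨D', l2⟩ := hπ.ex φ D
    exact ⟨y', mem_of_lf h d.D1 l1, ⟨k, h1⟩, l1.fx2 hπ d.hs hp h1 d.y2, l1.nz hπ d.hs hodd.pow hk d.y3 hodd.pow h1,
      D', mem_of_lf h ⟨1, pow_one _⟩ l2, l2.nli hπ d.hs d.D2⟩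
  have inU : ∀ Y, In π Y u → ∃ u' ∈ Y.comap π, (∃ k, u'^(p^k) = 1) ∧ finrank F (Fx u') = 1 ∧
      (∀ g : Sp B, IsZ g → u' * g ≠ g * u') := by
    rintro Y ⟨φ, h⟩
    obtain ⟨k, hk⟩ := d.u1
    obtain ⟨u', l1, h1⟩ := hπ.odd φ (hodd.pow (n := k)) hk
    exact ⟨u', mem_of_lf h ⟨1, pow_one _⟩ l1, ⟨k, h1⟩, l1.fx1 hπ d.hs hp hk h1 d.u2, l1.nz hπ d.hs hodd.pow hk d.u3 hodd.pow h1⟩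
  have rAB : ∀ Y, Y ≠ ⊤ → In π Y a → In π Y b → False := by
    intro Y hY h1 h2
    obtain ⟨a', h3, h4⟩ := inA Y h1
    have key : ∀ M : Submodule F V, Inv a' M → finrank F M ≠ 1 ∧ finrank F M ≠ 2 := by
      intro M hM
      rcases structA d.hN h4 M hM with h | h
      · rw [h, finrank_bot]; omega
      · rw [h, finrank_top, hS.fd]; omega
    rcases inB Y hY h2 with ⟨x, hx, h⟩ | ⟨e', f', hef, h⟩
    · exact (key _ (h a' h3).inv).1 (finrank_span_singleton hx)
    · exact (key _ (h a' h3)).2 (finrank_Wm hef)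
  have rCB : ∀ Y, Y ≠ ⊤ → In π Y c → In π Y b → False := by
    intro Y hY h1 h2
    obtain ⟨a', h3, h4⟩ := inC Y h1
    have key : ∀ M : Submodule F V, Inv a' M → finrank F M ≠ 1 ∧ finrank F M ≠ 2 := by
      intro M hM
      have := structC d.hM h4 M hM
      omega
    rcases inB Y hY h2 with ⟨x, hx, h⟩ | ⟨e', f', hef, h⟩
    · exact (key _ (h a' h3).inv).1 (finrank_span_singleton hx)
    · exact (key _ (h a' h3)).2 (finrank_Wm hef)
  have rDB : ∀ Y, Y ≠ ⊤ → In π Y D → In π Y b → False := by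
    intro Y hY h1 h2
    obtain ⟨y', h3, -, -, h4, D', h5, h6⟩ := inD Y h1
    rcases inB Y hY h2 with ⟨x, hx, h⟩ | ⟨e', f', hef, h⟩
    · exact h6 x hx (h _ h5)
    · exact h4 _ ⟨e', f', hef, rfl⟩ ((h _ h3).zc hef)
  have rBEU : ∀ Y, Y ≠ ⊤ → In π Y b → In π Y E → In π Y u → False := by
    intro Y hY h1 h2 h3
    obtain ⟨-, -, -, -, -, -, E', h5, h6⟩ := inE Y h2
    obtain ⟨u', h7, -, -, h8⟩ := inU Y h3
    rcases inB Y hY h1 with ⟨x, hx, h⟩ | ⟨e', f', hef, h⟩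
    · exact h6 x hx (h _ h5)
    · exact h8 _ ⟨e', f', hef, rfl⟩ ((h _ h7).zc hef)
  have rACDE : ∀ Y, Y ≠ ⊤ → In π Y a → In π Y c → In π Y D → In π Y E → False := by
    intro Y hY h1 h2 h3 h4
    obtain ⟨a', a1, a2⟩ := inA Y h1
    obtain ⟨c', c1, c2⟩ := inC Y h2
    obtain ⟨y', y1, -, y2, y3, -⟩ := inD Y h3
    obtain ⟨s', e', f', s1, s2, s3, -⟩ := inE Y h4
    have hne : Fx y' ≠ ⊥ := by intro h0; rw [h0, finrank_bot] at y2; omega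
    obtain ⟨v, hv, hv0⟩ := Submodule.exists_mem_ne_zero_of_ne_bot hne
    exact hX Y hY (L3 d.hN a2 d.hM c2 a1 c1 (hnu Y) s1 s2 s3 y1 hv0 hv y3)
  have rACDU : ∀ Y, Y ≠ ⊤ → In π Y a → In π Y c → In π Y D → In π Y u → False := by
    intro Y hY h1 h2 h3 h4
    obtain ⟨a', a1, a2⟩ := inA Y h1
    obtain ⟨c', c1, c2⟩ := inC Y h2
    obtain ⟨y', y1, ⟨k, hk⟩, y2, y3, -⟩ := inD Y h3
    obtain ⟨u', u1, ⟨l, hl⟩, u2, -⟩ := inU Y h4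
    exact hX Y hY (L4 d.hN a2 d.hM c2 a1 c1 (hnu Y) hp u1 y1 hl hk u2 y2 y3)
  by_contra hcon
  push Not at hcon
  have cov : ∀ g : Sp B, In π H g ∨ In π K g := by
    intro g
    obtain ⟨φ, h⟩ := hcon (π g)
    by_cases h1 : φ (π g) ∈ H
    · exact Or.inl ⟨φ, h1⟩
    · exact Or.inr ⟨φ, h h1⟩
  have fin : ∀ Y Z : Subgroup G, Y ≠ ⊤ → Z ≠ ⊤ → (∀ g : Sp B, In π Y g ∨ In π Z g) → In π Y a → False := by
    intro Y Z hY hZ hc h1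
    have hb := (hc b).resolve_left fun h => rAB Y hY h1 h
    have h2 := (hc c).resolve_right fun h => rCB Z hZ h hb
    have h3 := (hc D).resolve_right fun h => rDB Z hZ h hb
    have h4 := (hc E).resolve_left fun h => rACDE Y hY h1 h2 h3 h
    have h5 := (hc u).resolve_left fun h => rACDU Y hY h1 h2 h3 h
    exact rBEU Z hZ hb h4 h5
  rcases cov a with h | h
  · exact fin H K hH hK cov h
  · exact fin K H hK hH (fun g => (cov g).symm) h

end lift
end base
end
end PSP

open Module
set_option linter.unusedSectionVars false
set_option linter.unusedVariables false
set_option linter.style.longLine false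
set_option linter.unnecessarySimpa false
set_option linter.unusedSimpArgs false
namespace PSP
noncomputable section
section base
variable {F : Type*} {V : Type*} [Field F] [Fintype F] [AddCommGroup V] [Module F V] [FiniteDimensional F V]
variable {B : V →ₗ[F] V →ₗ[F] F}
variable [hS : Sy B]

local notation "q" => Fintype.card F

theorem half {L : Type*} [Field L] {x : L} {k : ℕ} (hk : 0 < k) (h : orderOf x = 2*k) : x^k = -1 := by
  have h1 : (x^k)^2 = 1 := by rw [← pow_mul, mul_comm, ← h, pow_orderOf_eq_one]
  rcases sq_eq_one_iff.1 h1 with h2 | h2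
  · have := Nat.le_of_dvd hk (orderOf_dvd_of_pow_eq_one h2); omega
  · exact h2

theorem ext_gen (F L : Type*) [Field F] [Fintype F] [Field L] [Algebra F L] [FiniteDimensional F L] : ∃ g : L, g ≠ 0 ∧ orderOf g = (Fintype.card F)^(finrank F L) - 1 := by
  have : Finite L := Module.finite_of_finite F
  obtain ⟨g, hg⟩ := (isCyclic_iff_exists_orderOf_eq_natCard (α := Lˣ)).1 inferInstance
  refine ⟨g, g.ne_zero, ?_⟩
  rw [orderOf_units, hg, Nat.card_units, Module.natCard_eq_pow_finrank (K := F) (V := L), Nat.card_eq_fintype_card]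

theorem tr_nd {F L : Type*} [Field F] [Fintype F] [Field L] [Algebra F L] [FiniteDimensional F L] {x : L} (h : ∀ y, Algebra.trace F L (x * y) = 0) : x = 0 := by
  have : Finite L := Module.finite_of_finite F
  have htr := (traceForm_nondegenerate F L).1 x
  simp_rw [Algebra.traceForm_apply] at htr
  exact htr h

theorem fm (h2 : (2:F) ≠ 0) (hq : Fintype.card F % 2 = 1) (d : ℕ) (hd : 0 < d) (L : Type) [Field L] [Algebra F L] [FiniteDimensional F L] (hfr : finrank F L = 2*d) :
    ∃ β : L →ₗ[F] L →ₗ[F] F, (∀ x, β x x = 0) ∧ (∀ x, (∀ y, β x y = 0) → x = 0) ∧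
      ∃ w : L, w ≠ 0 ∧ orderOf w = (Fintype.card F)^d+1 ∧ ∀ x y, β (w*x) (w*y) = β x y := by
  obtain ⟨g, hg0, hg⟩ := ext_gen F L
  obtain ⟨k, hk⟩ : ∃ k, q^d = 2*k+1 := ⟨q^d/2, by have : q^d % 2 = 1 := (by simp [Nat.pow_mod, hq]); omega⟩
  have hk0 : 0 < k := by
    have : 1 < q^d := Nat.one_lt_pow hd.ne' Fintype.one_lt_card
    omega
  have hg' : orderOf g = 2*(k*(q^d+1)) := by
    rw [hg, hfr, mul_comm 2 d, pow_mul, hk]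
    have : (2*k+1)^2 = 2*(k*(2*k+1+1)) + 1 := by ring
    omega
  set σ : L ≃ₐ[F] L := (FiniteField.frobeniusAlgEquivOfAlgebraic F L)^d with hσ
  have hσa : ∀ x, σ x = x^(q^d) := by
    intro x
    rw [hσ, AlgEquiv.coe_pow, FiniteField.coe_frobeniusAlgEquivOfAlgebraic_iterate]
  have hh := half (by positivity) hg'
  have hσσ : ∀ x, σ (σ x) = x := by
    intro x
    rw [hσa, hσa, ← pow_mul, ← pow_add, ← two_mul, ← hfr]
    have : Fintype L := @Fintype.ofFinite L (Module.finite_of_finite F)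
    rw [← Module.card_eq_pow_finrank (K := F) (V := L), FiniteField.pow_card]
  set δ := g^(k+1) with hδ
  have hδ0 : δ ≠ 0 := pow_ne_zero _ hg0
  have hδσ : σ δ = -δ := by
    rw [hσa, hδ, ← pow_mul, show (k+1)*q^d = k*(q^d+1) + (k+1) by rw [hk]; ring, pow_add, hh]; ring
  have hn : (g^(2*k)) * σ (g^(2*k)) = 1 := by
    rw [hσa, ← pow_succ', ← pow_mul, show 2*k*(q^d+1) = 2*(k*(q^d+1)) by ring, ← hg', pow_orderOf_eq_one]
  refine ⟨((Algebra.traceForm F L).comp (LinearMap.mulLeft F δ) σ.toLinearMap), ?_, ?_, g^(2*k), pow_ne_zero _ hg0, ?_, ?_⟩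
  · intro x
    have h1 : Algebra.trace F L (δ * x * σ x) = - Algebra.trace F L (δ * x * σ x) := by
      nth_rewrite 1 [← Algebra.trace_eq_of_algEquiv σ]
      rw [map_mul σ, map_mul σ, hσσ, hδσ, ← map_neg]
      congr 1; ring
    have h3 : (2:F) * Algebra.trace F L (δ * x * σ x) = 0 := by linear_combination h1
    simpa [LinearMap.BilinForm.comp, Algebra.traceForm_apply] using (mul_eq_zero.1 h3).resolve_left h2
  · intro x hx
    have : δ * x = 0 := by
      apply tr_nd (F := F)
      intro y
      have := hx (σ.symm y)
      simpa using this
    exact (mul_eq_zero.1 this).resolve_left hδ0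
  · rw [orderOf_pow_of_dvd (by omega) (by rw [hg']; exact ⟨q^d+1, by ring⟩), hg', ← mul_assoc, Nat.mul_div_cancel_left _ (by omega)]
  · intro x y
    have : ∀ w : L, w * σ w = 1 → δ * (w*x) * σ (w*y) = δ * x * σ y := by
      intro w hw
      rw [map_mul]; linear_combination δ * x * σ y * hw
    simp [LinearMap.BilinForm.comp, Algebra.traceForm_apply, - map_mul, this _ hn]

theorem field_model (h2 : (2:F) ≠ 0) (hq : Fintype.card F % 2 = 1) (d : ℕ) (hd : 0 < d) : ∃ (L : Type) (_ : Field L) (_ : Algebra F L) (_ : FiniteDimensional F L), finrank F L = 2*d ∧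
    ∃ β : L →ₗ[F] L →ₗ[F] F, (∀ x, β x x = 0) ∧ (∀ x, (∀ y, β x y = 0) → x = 0) ∧
      ∃ w : L, w ≠ 0 ∧ orderOf w = (Fintype.card F)^d+1 ∧ ∀ x y, β (w*x) (w*y) = β x y := by
  obtain ⟨p, hp⟩ := CharP.exists F
  have : Fact p.Prime := ⟨(FiniteField.card F p).choose_spec.1⟩
  have : NeZero (2*d) := ⟨by omega⟩
  have hfr := FiniteField.finrank_extension F p (2*d)
  exact ⟨FiniteField.Extension F p (2*d), inferInstance, inferInstance, inferInstance, hfr, fm h2 hq d hd _ hfr⟩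
end base
end
end PSP

open Module
set_option linter.unusedSectionVars false
set_option linter.unusedVariables false
set_option linter.style.longLine false
set_option linter.unnecessarySimpa false
set_option linter.unusedSimpArgs false
namespace PSP
noncomputable section
section base
variable {F : Type*} {V : Type*} [Field F] [Fintype F] [AddCommGroup V] [Module F V] [FiniteDimensional F V]
variable {B : V →ₗ[F] V →ₗ[F] F}
variable [hS : Sy B]

local notation "q" => Fintype.card F

theorem symp_basis (B : V →ₗ[F] V →ₗ[F] F) [hS : Sy B] (n : ℕ) (hn : n ≤ 3) : ∃ e f : Fin n → V, (∀ i j, B (e i) (e j) = 0) ∧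
    (∀ i j, B (f i) (f j) = 0) ∧ (∀ i j, B (e i) (f j) = if i = j then 1 else 0) := by
  induction n with
  | zero => exact ⟨0, 0, fun i => i.elim0, fun i => i.elim0, fun i => i.elim0⟩
  | succ n ih =>
    obtain ⟨e, f, h1, h2, h3⟩ := ih (by omega)
    have h3' : ∀ i j, B (f i) (e j) = if i = j then -1 else 0 := by
      intro i j; rw [Bs, h3]; by_cases h : i = j
      · simp [h]
      · simp [h, Ne.symm h]
    have hM : Submodule.span F (Set.range (Sum.elim e f)) ≠ ⊤ := by
      intro h
      have := finrank_range_le_card (R := F) (Sum.elim e f)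
      rw [Set.finrank, h, finrank_top, hS.fd] at this
      simp at this; omega
    obtain ⟨x, hx, hx'⟩ := ex_perp (B := B) hM
    have hxe : ∀ i, B x (e i) = 0 := fun i => hx' _ (Submodule.subset_span ⟨Sum.inl i, rfl⟩)
    have hxf : ∀ i, B x (f i) = 0 := fun i => hx' _ (Submodule.subset_span ⟨Sum.inr i, rfl⟩)
    obtain ⟨y, hy⟩ := nd' (B := B) hx
    obtain ⟨y', hy1, hy2, hy3⟩ : ∃ y', B x y' = 1 ∧ (∀ j, B y' (e j) = 0) ∧ ∀ j, B y' (f j) = 0 := by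
      refine ⟨y - ∑ i, B y (f i) • e i + ∑ i, B y (e i) • f i, ?_, ?_, ?_⟩
      · simp [hy, hxe, hxf]
      · intro j; simp [h1, h3']
      · intro j; simp [h2, h3]
    refine ⟨Fin.cons x e, Fin.cons y' f, ?_, ?_, ?_⟩
    · intro i j
      refine Fin.cases ?_ (fun i => ?_) i <;> refine Fin.cases ?_ (fun j => ?_) j <;> simp [hS.alt, hxe, h1]
      rw [Bs, hxe, neg_zero]
    · intro i j
      refine Fin.cases ?_ (fun i => ?_) i <;> refine Fin.cases ?_ (fun j => ?_) j <;> simp [hS.alt, hy3, h2]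
      rw [Bs, hy3, neg_zero]
    · intro i j
      refine Fin.cases ?_ (fun i => ?_) i <;> refine Fin.cases ?_ (fun j => ?_) j <;> simp [hy1, hxf, h3, Fin.succ_ne_zero, (Fin.succ_ne_zero _).symm]
      rw [Bs, hy2, neg_zero]

abbrev V0 (F : Type*) := (Fin 3 ⊕ Fin 3 → F)
theorem fr0 : finrank F (V0 F) = 6 := by
  simp

def B0 (F : Type*) [Field F] : V0 F →ₗ[F] V0 F →ₗ[F] F := LinearMap.mk₂ F (fun (x y : Fin 3 ⊕ Fin 3 → F) => ∑ i, (x (.inl i) * y (.inr i) - x (.inr i) * y (.inl i)))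
  (by intro a b c; rw [← Finset.sum_add_distrib]; refine Finset.sum_congr rfl fun i _ => ?_; show (a _ + b _) * _ - (a _ + b _) * _ = _; ring)
  (by intro r a b; rw [smul_eq_mul, Finset.mul_sum]; refine Finset.sum_congr rfl fun i _ => ?_; show (r * a _) * _ - (r * a _) * _ = _; ring)
  (by intro a b c; rw [← Finset.sum_add_distrib]; refine Finset.sum_congr rfl fun i _ => ?_; show _ * (b _ + c _) - _ * (b _ + c _) = _; ring)
  (by intro r a b; rw [smul_eq_mul, Finset.mul_sum]; refine Finset.sum_congr rfl fun i _ => ?_; show _ * (r * b _) - _ * (r * b _) = _; ring)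

theorem B0_apply (x y : V0 F) : B0 F x y = ∑ i, (x (.inl i) * y (.inr i) - x (.inr i) * y (.inl i)) := rfl

theorem iso0 (B : V →ₗ[F] V →ₗ[F] F) [hS : Sy B] : ∃ T : V0 F ≃ₗ[F] V, ∀ x y, B (T x) (T y) = B0 F x y := by
  obtain ⟨e, f, h1, h2, h3⟩ := symp_basis B 3 le_rfl
  have h3' : ∀ i j, B (f i) (e j) = if i = j then -1 else 0 := by
    intro i j; rw [Bs, h3]; by_cases h : i = j
    · simp [h]
    · simp [h, Ne.symm h]
  let T : (Fin 3 ⊕ Fin 3 → F) →ₗ[F] V := Fintype.linearCombination F (Sum.elim e f)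
  have hT : ∀ x, T x = ∑ i, x (.inl i) • e i + ∑ i, x (.inr i) • f i := by
    intro x; simp [T, Fintype.linearCombination_apply, Fintype.sum_sum_type]
  have hi : Function.Injective T := by
    rw [← LinearMap.ker_eq_bot, LinearMap.ker_eq_bot']
    intro x hx
    ext i
    rcases i with i | i
    · have : B (T x) (f i) = 0 := by rw [hx]; simp
      simpa [hT, h2, h3] using this
    · have : B (T x) (e i) = 0 := by rw [hx]; simp
      simpa [hT, h1, h3'] using this
  refine ⟨LinearEquiv.ofInjectiveOfFinrankEq T hi (by rw [hS.fd]; exact fr0), ?_⟩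
  intro x y
  show B (T x) (T y) = _
  rw [hT, hT, B0_apply]
  simp [h1, h2, h3, h3', Finset.sum_sub_distrib, sub_eq_add_neg, Finset.sum_add_distrib]

theorem Sy0 (h2 : (2:F) ≠ 0) (h3 : (3:F) ≠ 0) : Sy (B0 F) where
  alt x := by rw [B0_apply]; exact Finset.sum_eq_zero fun i _ => by ring
  nd x h := by
    funext i
    rcases i with i | i
    · have := h (Pi.single (.inr i) 1)
      rw [B0_apply] at this
      simpa [Pi.single_apply] using this
    · have := h (Pi.single (.inl i) 1)
      rw [B0_apply] at this
      simpa [Pi.single_apply] using this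
  two := h2
  three := h3
  fd := fr0

section tr
variable {V' : Type*} [AddCommGroup V'] [Module F V'] [FiniteDimensional F V'] {B' : V' →ₗ[F] V' →ₗ[F] F} [hS' : Sy B']

theorem iso2 (B : V →ₗ[F] V →ₗ[F] F) [hS : Sy B] (B' : V' →ₗ[F] V' →ₗ[F] F) [hS' : Sy B'] :
    ∃ T : V ≃ₗ[F] V', ∀ x y, B' (T x) (T y) = B x y := by
  obtain ⟨T, hT⟩ := iso0 B
  obtain ⟨U, hU⟩ := iso0 B'
  exact ⟨T.symm.trans U, fun x y => by simp [hU, ← hT]⟩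

/-- transport along an isometry -/
def ka (T : V ≃ₗ[F] V') (hT : ∀ x y, B' (T x) (T y) = B x y) : Sp B ≃* Sp B' where
  toFun g := ⟨T.symm.trans (g.1.trans T), fun x y => by simp [hT, g.2 _ _, ← hT]⟩
  invFun g := ⟨T.trans (g.1.trans T.symm), fun x y => by simp [← hT, g.2 _ _]⟩
  left_inv g := Subtype.ext (LinearEquiv.ext fun x => by simp)
  right_inv g := Subtype.ext (LinearEquiv.ext fun x => by simp)
  map_mul' g h := Subtype.ext (LinearEquiv.ext fun x => by simp)

variable (T : V ≃ₗ[F] V') (hT : ∀ x y, B' (T x) (T y) = B x y)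

theorem ka_smul (g : Sp B) (x : V) : (ka T hT g) • (T x) = T (g • x) := by
  show T (g.1 (T.symm (T x))) = T (g.1 x)
  simp

theorem ka_nu : ka T hT (nu B) = nu B' := sp_ext fun x => by
  obtain ⟨x, rfl⟩ := T.surjective x; simp [ka_smul]

theorem ka_PO {a : Sp B} {N : ℕ} (h : PO a N) : PO (ka T hT a) N := by
  intro k
  rw [← h, ← map_pow, ← ka_nu T hT, EmbeddingLike.map_eq_one_iff, EmbeddingLike.apply_eq_iff_eq]

theorem ka_LI {g : Sp B} (h : ∀ x, x ≠ 0 → ¬ LI g x) : ∀ x, x ≠ 0 → ¬ LI (ka T hT g) x := by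
  intro x hx
  obtain ⟨x, rfl⟩ := T.surjective x
  rintro ⟨c, hc⟩
  refine h x (by rintro rfl; simp at hx) ⟨c, T.injective ?_⟩
  rw [← ka_smul T hT, hc, map_smul]

theorem ka_Fx (g : Sp B) : finrank F (Fx (ka T hT g)) = finrank F (Fx g) := by
  have : Fx (ka T hT g) = (Fx g).map T.toLinearMap := by
    ext x
    obtain ⟨x, rfl⟩ := T.surjective x
    rw [mem_Fx, ka_smul]
    simp [mem_Fx]
  rw [this]
  exact LinearEquiv.finrank_map_eq T _

theorem ka_IsZ {g : Sp B} (h : IsZ (ka T hT g)) : IsZ g := by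
  obtain ⟨e, f, hef, h⟩ := h
  obtain ⟨e, rfl⟩ := T.surjective e
  obtain ⟨f, rfl⟩ := T.surjective f
  have hef' := hef
  rw [hT] at hef'
  refine ⟨e, f, hef', sp_ext fun x => T.injective ?_⟩
  rw [← ka_smul T hT, h, z_smul hef, z_smul hef']
  simp [hT]

theorem ka_cz {y : Sp B} (h : ∀ g : Sp B, IsZ g → y * g ≠ g * y) : ∀ g : Sp B', IsZ g → (ka T hT y) * g ≠ g * (ka T hT y) := by
  intro g
  obtain ⟨g, rfl⟩ := (ka T hT).surjective g
  intro hg h'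
  rw [← map_mul, ← map_mul] at h'
  exact h g (ka_IsZ T hT hg) ((ka T hT).injective h')

end tr
end base
end
end PSP

open Module
set_option linter.unusedSectionVars false
set_option linter.unusedVariables false
set_option linter.style.longLine false
set_option linter.unnecessarySimpa false
set_option linter.unusedSimpArgs false
namespace PSP
noncomputable section
section base
variable {F : Type*} {V : Type*} [Field F] [Fintype F] [AddCommGroup V] [Module F V] [FiniteDimensional F V]
variable {B : V →ₗ[F] V →ₗ[F] F}
variable [hS : Sy B]

local notation "q" => Fintype.card F

theorem PO_of {a : Sp B} {N : ℕ} (h1 : ∀ k, a^k = 1 → 2*N ∣ k) (h2 : a^N = nu B) : PO a N := by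
  intro k
  constructor
  · rintro (h | h)
    · exact (Dvd.intro_left 2 rfl).trans (h1 k h)
    · have h3 := (Dvd.intro_left 2 rfl).trans (h1 (k+N) (by rw [pow_add, h, h2, nu_sq]))
      exact (Nat.dvd_add_left dvd_rfl).1 h3
  · rintro ⟨j, rfl⟩
    rw [pow_mul, h2]
    rcases Nat.even_or_odd' j with ⟨i, rfl | rfl⟩
    · exact Or.inl (nu_pow i)
    · right; rw [pow_succ, nu_pow, one_mul]

theorem mkS_pow (f : V →ₗ[F] V) (h : ∀ x y, B (f x) (f y) = B x y) (k : ℕ) (x : V) : (mkS B f h)^k • x = (f^k) x := by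
  induction k generalizing x with
  | zero => simp
  | succ n ih => rw [pow_succ, mul_smul, mkS_smul, ih, pow_succ]; rfl

theorem exA (B : V →ₗ[F] V →ₗ[F] F) [hS : Sy B] : ∃ a : Sp B, ∃ N, 2*N = q^3+1 ∧ PO a N := by
  obtain ⟨L, _, _, _, hfr, β, alt, nd, w, hw0, hw, hb⟩ := field_model hS.two (q_odd B) 3 (by norm_num)
  have hSy : Sy β := ⟨alt, nd, hS.two, hS.three, hfr⟩
  obtain ⟨T, hT⟩ := iso2 β B
  obtain ⟨N, hN⟩ : ∃ N, 2*N = q^3+1 := ⟨(q^3+1)/2, by have : q^3 % 2 = 1 := (by simp [Nat.pow_mod, q_odd B]); omega⟩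
  have hb' : ∀ x y, β (LinearMap.mulLeft F w x) (LinearMap.mulLeft F w y) = β x y := hb
  refine ⟨ka T hT (mkS β (LinearMap.mulLeft F w) hb'), N, hN, ka_PO T hT (PO_of ?_ ?_)⟩
  · intro k hk
    have := mkS_pow (B := β) (LinearMap.mulLeft F w) hb' k 1
    rw [hk, LinearMap.pow_mulLeft] at this
    rw [hN, ← hw]
    exact orderOf_dvd_of_pow_eq_one (by simpa using this.symm)
  · apply sp_ext
    intro x
    rw [mkS_pow, LinearMap.pow_mulLeft, half (by by_contra h; simp at h; simp [h] at hN) (hw.trans hN.symm)]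
    simp

theorem exC (B : V →ₗ[F] V →ₗ[F] F) [hS : Sy B] : ∃ a : Sp B, ∃ N, 2*N+1 = q^3 ∧ PO a N := by
  obtain ⟨p, hp⟩ := CharP.exists F
  have : Fact p.Prime := ⟨(FiniteField.card F p).choose_spec.1⟩
  have hfr := FiniteField.finrank_extension F p 3
  obtain ⟨L, _, _, _, hfr⟩ : ∃ (L : Type) (_ : Field L) (_ : Algebra F L) (_ : FiniteDimensional F L), finrank F L = 3 :=
    ⟨FiniteField.Extension F p 3, inferInstance, inferInstance, inferInstance, hfr⟩
  obtain ⟨g, hg0, hg⟩ := ext_gen F L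
  let fst := LinearMap.fst F L L
  let snd := LinearMap.snd F L L
  let τ := Algebra.traceForm F L
  let β : (L × L) →ₗ[F] (L × L) →ₗ[F] F := τ.compl₁₂ fst snd - τ.compl₁₂ snd fst
  have hβ : ∀ x y : L × L, β x y = Algebra.trace F L (x.1 * y.2) - Algebra.trace F L (x.2 * y.1) := fun x y => rfl
  have hSy : Sy β := by
    refine ⟨?_, ?_, hS.two, hS.three, by simp [hfr]⟩
    · intro x; rw [hβ, mul_comm, sub_self]
    · intro x hx
      ext
      · exact tr_nd (F := F) fun y => by simpa [hβ] using hx (0, y)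
      · exact tr_nd (F := F) fun y => by simpa [hβ] using hx (y, 0)
  obtain ⟨T, hT⟩ := iso2 β B
  obtain ⟨N, hN⟩ : ∃ N, 2*N+1 = q^3 := ⟨q^3/2, by have : q^3 % 2 = 1 := (by simp [Nat.pow_mod, q_odd B]); omega⟩
  have hN0 : 0 < N := by
    have := Nat.pow_le_pow_left (q_five B) 3
    omega
  rw [hfr] at hg
  have hg' : orderOf g = 2*N := by omega
  let f : (L × L) →ₗ[F] (L × L) := (LinearMap.mulLeft F g).prodMap (LinearMap.mulLeft F g⁻¹)
  have hb : ∀ x y, β (f x) (f y) = β x y := by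
    intro x y
    simp only [hβ, f, LinearMap.prodMap_apply, LinearMap.mulLeft_apply]
    congr 2 <;> field_simp
  have hf : ∀ (k : ℕ) (x : L × L), (f^k) x = (g^k * x.1, (g⁻¹)^k * x.2) := by
    intro k
    induction k with
    | zero => intro x; simp
    | succ n ih => intro x; rw [pow_succ, Module.End.mul_apply, ih]; simp [f, pow_succ]; constructor <;> ring
  refine ⟨ka T hT (mkS β f hb), N, hN, ka_PO T hT (PO_of ?_ ?_)⟩
  · intro k hk
    have := mkS_pow (B := β) f hb k (1, 0)
    rw [hk, hf] at this
    rw [← hg']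
    exact orderOf_dvd_of_pow_eq_one (by simpa using (congrArg Prod.fst this).symm)
  · apply sp_ext
    intro x
    rw [mkS_pow, hf, inv_pow, half hN0 hg']
    ext <;> simp

theorem CR {G : Type*} [Group G] {a b : G} {m n : ℕ} (hc : a * b = b * a) (ha : a^m = 1) (hb : b^n = 1) (hmn : m.Coprime n) :
    ∃ i, (a*b)^i = a := by
  obtain ⟨k, h1, h2⟩ := Nat.chineseRemainder hmn 1 0
  refine ⟨k, ?_⟩
  have hc' : Commute a b := hc
  rw [hc'.mul_pow, pow_eq_pow_mod k ha, h1, ← pow_eq_pow_mod 1 ha, pow_one, pow_eq_pow_mod k hb, h2, ← pow_eq_pow_mod 0 hb, pow_zero, mul_one]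

/-- unipotent elements -/
theorem unip {p : ℕ} (hp : p.Prime) [CharP F p] (N : V →ₗ[F] V) {n : ℕ} (hN : N^n = 0) (h : ∀ x y, B ((1+N) x) ((1+N) y) = B x y) :
    ∃ k, (mkS B (1+N) h)^(p^k) = 1 := by
  have : Fact p.Prime := ⟨hp⟩
  refine ⟨n, sp_ext fun x => ?_⟩
  have : Nontrivial V := Module.nontrivial_of_finrank_pos (R := F) (by rw [hS.fd]; norm_num)
  have : CharP (Module.End F V) p := charP_of_injective_algebraMap (FaithfulSMul.algebraMap_injective F (Module.End F V)) p
  have h1 : (1 + N : Module.End F V)^(p^n) = 1 + N^(p^n) := by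
    rw [add_pow_char_pow_of_commute _ _ (Commute.one_left _), one_pow]
  have h2 : N^(p^n) = 0 := by
    rw [← Nat.add_sub_cancel' (Nat.lt_pow_self hp.one_lt).le, pow_add, hN, zero_mul]
  rw [mkS_pow, h1, h2]; simp

theorem noZ (N : V →ₗ[F] V) {n : ℕ} (hN : N^n = 0) (h : ∀ x y, B ((1+N) x) ((1+N) y) = B x y) (hk : ∀ x, N (N x) = 0 → ∃ y, N y = x) :
    ∀ g : Sp B, IsZ g → (mkS B (1+N) h) * g ≠ g * (mkS B (1+N) h) := by
  rintro g ⟨e, f, hef, rfl⟩ hc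
  have hg : ∀ x, N (z B e f • x) = z B e f • N x := by
    intro x
    have := congrArg (fun g : Sp B => g • x) hc
    simp only [mul_smul, mkS_smul, LinearMap.add_apply, Module.End.one_apply, smul_add] at this
    exact add_left_cancel this
  have hW : ∀ x, InW B e f x → InW B e f (N x) := by
    intro x hx
    rw [← z_neg_iff hef] at hx ⊢
    rw [← hg, hx, map_neg]
  have h0 : ∃ w, InW B e f w ∧ w ≠ 0 ∧ N w = 0 := by
    by_contra! hcon
    have : ∀ k, InW B e f ((N^k) e) ∧ (N^k) e ≠ 0 := by
      intro k
      induction k with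
      | zero => exact ⟨InW_e hef, fun h => by simp at h; simp [h] at hef⟩
      | succ k ih => rw [pow_succ', Module.End.mul_apply]; exact ⟨hW _ ih.1, hcon _ ih.1 ih.2⟩
    exact (this n).2 (by rw [hN]; rfl)
  obtain ⟨w, hw, hw0, hNw⟩ := h0
  have him : ∀ x, InW B e f x → ∃ c : F, N x = c • w := by
    intro x hx
    apply W_dep hw (hW x hx) hw0
    have := h w x
    simpa [hNw] using this
  have hsur : ∀ x, InW B e f x → ∃ c : F, x = c • w := by
    intro x hx
    obtain ⟨y, rfl⟩ := hk x (by obtain ⟨c, hc⟩ := him x hx; rw [hc, map_smul, hNw, smul_zero])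
    obtain ⟨v, u, rfl, hv, hu⟩ := z_dec hef y
    obtain ⟨c, hc⟩ := him v ((z_neg_iff hef v).1 hv)
    refine ⟨c, ?_⟩
    rw [← z_neg_iff hef, ← hg, smul_add, hv, hu, map_add, map_add, map_neg] at hx
    have : N u = - N u := by
      have h5 : -N v + N u = -N v + (-N u) := by rw [hx]; abel
      exact add_left_cancel h5
    rw [map_add, eq_zero_of_neg B this, hc, add_zero]
  obtain ⟨c, hc⟩ := hsur e (InW_e hef)
  obtain ⟨d, hd⟩ := hsur f (InW_f hef)
  rw [hc, hd] at hef
  simp [hS.alt] at hef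

theorem exU {p : ℕ} (hp : p.Prime) [CharP F p] (B : V →ₗ[F] V →ₗ[F] F) [hS : Sy B] :
    ∃ u : Sp B, (∃ k, u^(p^k) = 1) ∧ finrank F (Fx u) = 1 ∧ ∀ g : Sp B, IsZ g → u * g ≠ g * u := by
  have hSy := Sy0 hS.two hS.three
  obtain ⟨T, hT⟩ := iso2 (B0 F) B
  let N : V0 F →ₗ[F] V0 F :=
    { toFun := fun x => Sum.elim ![x (.inl 1), x (.inl 2) + x (.inr 2), x (.inr 2)] ![0, - x (.inr 0), x (.inr 0) - x (.inr 1)]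
      map_add' := by
        intro x y; ext i; rcases i with i | i <;> fin_cases i <;> simp <;> ring
      map_smul' := by
        intro r x; ext i; rcases i with i | i <;> fin_cases i <;> simp <;> ring }
  have hN : ∀ x, N x = Sum.elim ![x (.inl 1), x (.inl 2) + x (.inr 2), x (.inr 2)] ![0, - x (.inr 0), x (.inr 0) - x (.inr 1)] := fun x => rfl
  have hN6 : N^6 = 0 := by
    ext1 i
    ext j
    simp only [pow_succ, pow_zero, one_mul, Module.End.mul_apply, LinearMap.comp_apply, LinearMap.zero_apply, hN]
    rcases j with j | j <;> fin_cases j <;> simp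
  have h : ∀ x y, B0 F ((1+N) x) ((1+N) y) = B0 F x y := by
    intro x y
    rw [B0_apply, B0_apply]
    simp [Fin.sum_univ_three, hN]
    ring
  have h0 : ∀ x, N x = 0 ↔ x = x (.inl 0) • Pi.single (.inl 0) 1 := by
    intro x
    constructor
    · intro hx
      have h1 := congrFun hx (.inl 0)
      have h2 := congrFun hx (.inl 1)
      have h3 := congrFun hx (.inl 2)
      have h4 := congrFun hx (.inr 1)
      have h5 := congrFun hx (.inr 2)
      simp [hN] at h1 h2 h3 h4 h5
      simp [h3, h4] at h2 h5
      ext i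
      rcases i with i | i <;> fin_cases i <;> simp [*]
    · intro hx
      rw [hx, map_smul]
      have : N (Pi.single (.inl 0) 1) = 0 := by
        ext i; rcases i with i | i <;> fin_cases i <;> simp [hN]
      rw [this, smul_zero]
  refine ⟨ka T hT (mkS (B0 F) (1+N) h), ?_, ?_, ka_cz T hT (noZ N hN6 h ?_)⟩
  · obtain ⟨k, hk⟩ := unip (B := B0 F) hp N hN6 h
    exact ⟨k, by rw [← map_pow, hk, map_one]⟩
  · rw [ka_Fx]
    have : Fx (mkS (B0 F) (1+N) h) = Submodule.span F {Pi.single (.inl 0) 1} := by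
      ext x
      rw [mem_Fx, mkS_smul, Submodule.mem_span_singleton, LinearMap.add_apply, Module.End.one_apply, add_eq_left, h0]
      constructor
      · intro hx; exact ⟨_, hx.symm⟩
      · rintro ⟨a, rfl⟩; simp
    rw [this, finrank_span_singleton]
    intro h; simpa using congrFun h (.inl 0)
  · intro x hx
    have h1 := congrFun hx (.inl 0)
    have h2 := congrFun hx (.inl 1)
    have h3 := congrFun hx (.inl 2)
    have h5 := congrFun hx (.inr 2)
    simp [hN] at h1 h2 h3 h5
    simp [h5] at h3
    simp [h3, h5] at h2
    simp [h2] at h1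
    refine ⟨Sum.elim ![0, x (.inl 0), x (.inl 1)] 0, ?_⟩
    ext i
    rcases i with i | i <;> fin_cases i <;> simp [hN, *]

theorem notF {L : Type*} [Field L] [Algebra F L] {w x : L} {c : F} (hw : w ≠ 0) (hx : x ≠ 0) (h : w * x = c • x) : orderOf w ∣ q - 1 := by
  have h1 : w = algebraMap F L c := by
    rw [Algebra.smul_def] at h; exact mul_right_cancel₀ hx h
  have hc : c ≠ 0 := by rintro rfl; simp at h1; exact hw h1
  apply orderOf_dvd_of_pow_eq_one
  rw [h1, ← map_pow, FiniteField.pow_card_sub_one_eq_one c hc, map_one]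

theorem LI.of {g h : Sp B} {x : V} (hg : LI g x) (hh : ∃ i, g^i = h) : LI h x := by
  obtain ⟨i, rfl⟩ := hh
  obtain ⟨c, -, h⟩ := hg.pow i
  exact ⟨_, h⟩

theorem exD {p : ℕ} (hp : p.Prime) [CharP F p] (B : V →ₗ[F] V →ₗ[F] F) [hS : Sy B] :
    ∃ D y : Sp B, (∃ i, D^i = y) ∧ (∀ x, x ≠ 0 → ¬ LI D x) ∧ (∃ k, y^(p^k) = 1) ∧ 2 ≤ finrank F (Fx y) ∧
      ∀ g : Sp B, IsZ g → y * g ≠ g * y := by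
  obtain ⟨L, _, _, _, hfr, β, alt, nd, w, hw0, hw, hb⟩ := field_model hS.two (q_odd B) 1 (by norm_num)
  have sk : ∀ x y, β x y = - β y x := by
    intro x y
    have := alt (x + y)
    simp only [map_add, LinearMap.add_apply, alt] at this
    linear_combination this
  let p0 := LinearMap.fst F L (L × L)
  let p1 := LinearMap.fst F L L ∘ₗ LinearMap.snd F L (L × L)
  let p2 := LinearMap.snd F L L ∘ₗ LinearMap.snd F L (L × L)
  let γ : (L × L × L) →ₗ[F] (L × L × L) →ₗ[F] F := β.compl₁₂ p0 p2 - β.compl₁₂ p1 p1 + β.compl₁₂ p2 p0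
  have hγ : ∀ x y : L × L × L, γ x y = β x.1 y.2.2 - β x.2.1 y.2.1 + β x.2.2 y.1 := fun x y => rfl
  have hSy : Sy γ := by
    refine ⟨?_, ?_, hS.two, hS.three, by simp [hfr]⟩
    · intro x; rw [hγ, alt, sk x.1]; ring
    · intro x hx
      ext
      · exact nd _ fun y => by simpa [hγ] using hx (0, 0, y)
      · exact nd _ fun y => by simpa [hγ] using hx (0, y, 0)
      · exact nd _ fun y => by simpa [hγ] using hx (y, 0, 0)
  obtain ⟨T, hT⟩ := iso2 γ B
  let h2 : F := 1/2
  have hh2 : h2 * 2 = 1 := by simp [h2, hS.two]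
  let N : (L × L × L) →ₗ[F] (L × L × L) := (p1 + h2 • p2).prod (p2.prod 0)
  have hN : ∀ x : L × L × L, N x = (x.2.1 + h2 • x.2.2, x.2.2, 0) := fun x => rfl
  have hN3 : N^3 = 0 := by
    refine LinearMap.ext fun x => ?_
    simp only [pow_succ, pow_zero, one_mul, Module.End.mul_apply, LinearMap.zero_apply, hN]
    simp
  have h : ∀ x y, γ ((1+N) x) ((1+N) y) = γ x y := by
    intro x y
    simp [hγ, hN]
    linear_combination (β x.2.2 y.2.2) * hh2
  let W : (L × L × L) →ₗ[F] (L × L × L) := (LinearMap.mulLeft F w).prodMap ((LinearMap.mulLeft F w).prodMap (LinearMap.mulLeft F w))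
  have hW : ∀ x : L × L × L, W x = (w * x.1, w * x.2.1, w * x.2.2) := fun x => rfl
  have hWb : ∀ x y, γ (W x) (W y) = γ x y := by
    intro x y
    simp only [hγ, hW, hb]
  have hWp : ∀ (k : ℕ) (x : L × L × L), (W^k) x = (w^k * x.1, w^k * x.2.1, w^k * x.2.2) := by
    intro k
    induction k with
    | zero => intro x; simp
    | succ n ih => intro x; rw [pow_succ, Module.End.mul_apply, ih, hW]; ext <;> simp only <;> ring
  obtain ⟨k, hk⟩ := unip (B := γ) hp N hN3 h
  have hor : (mkS γ W hWb)^(q^1+1) = 1 := sp_ext fun x => by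
    rw [mkS_pow, hWp, ← hw, pow_orderOf_eq_one]; simp
  have hcm : mkS γ (1+N) h * mkS γ W hWb = mkS γ W hWb * mkS γ (1+N) h := sp_ext fun x => by
    simp only [mul_smul, mkS_smul, LinearMap.add_apply, Module.End.one_apply, hW, hN]
    ext <;> simp [mul_add]
  have hcop : (p^k).Coprime (q^1+1) := by
    apply Nat.Coprime.pow_left
    rw [hp.coprime_iff_not_dvd]
    intro hd
    obtain ⟨n, -, hn⟩ := FiniteField.card F p
    have : p ∣ q^1 := by rw [pow_one, hn]; exact dvd_pow_self p n.2.ne'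
    exact hp.one_lt.ne' (Nat.dvd_one.1 ((Nat.dvd_add_right this).1 hd))
  have c1 := CR hcm hk hor hcop
  have c2 := CR hcm.symm hor hk hcop.symm
  rw [← hcm] at c2
  refine ⟨ka T hT (mkS γ (1+N) h * mkS γ W hWb), ka T hT (mkS γ (1+N) h), ?_, ka_LI T hT ?_, ⟨k, by rw [← map_pow, hk, map_one]⟩, ?_, ka_cz T hT (noZ N hN3 h ?_)⟩
  · obtain ⟨i, hi⟩ := c1
    exact ⟨i, by rw [← map_pow, hi]⟩
  · intro x hx hL
    obtain ⟨c, hc⟩ := hL.of c2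
    rw [mkS_smul, hW] at hc
    have : orderOf w ∣ q - 1 := by
      by_contra hno
      apply hx
      ext
      · by_contra h0; exact hno (notF hw0 h0 (congrArg Prod.fst hc))
      · by_contra h0; exact hno (notF hw0 h0 (congrArg (fun v => v.2.1) hc))
      · by_contra h0; exact hno (notF hw0 h0 (congrArg (fun v => v.2.2) hc))
    have h5 := q_five B
    have := Nat.le_of_dvd (by omega) this
    rw [hw, pow_one] at this
    omega
  · rw [ka_Fx]
    have : LinearMap.range (LinearMap.inl F L (L × L)) ≤ Fx (mkS γ (1+N) h) := by
      rintro _ ⟨x, rfl⟩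
      rw [mem_Fx, mkS_smul]
      simp [hN]
    have := Submodule.finrank_mono this
    rw [LinearMap.finrank_range_of_inj LinearMap.inl_injective, hfr] at this
    exact this
  · intro x hx
    simp [hN] at hx
    exact ⟨(0, x.1 - h2 • x.2.1, x.2.1), by rw [hN]; ext <;> simp [hx]⟩
end base
end
end PSP

open Module
set_option linter.unusedSectionVars false
set_option linter.unusedVariables false
set_option linter.style.longLine false
set_option linter.unnecessarySimpa false
set_option linter.unusedSimpArgs false
namespace PSP
noncomputable section
section base
variable {F : Type*} {V : Type*} [Field F] [Fintype F] [AddCommGroup V] [Module F V] [FiniteDimensional F V]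
variable {B : V →ₗ[F] V →ₗ[F] F}
variable [hS : Sy B]

local notation "q" => Fintype.card F

theorem exb {p : ℕ} (hp : p.Prime) [CharP F p] {s : Sp B} {e f : V} (hs : IsS s e f) :
    ∃ b : Sp B, (∃ i, b^i = s) ∧ (∃ i, b^i = t B e 1) ∧ (∃ i, b^i = z B e f) := by
  have hef := hs.hef
  have h1 : s * z B e f = z B e f * s := Inv.zc hef (hs.wm rfl)
  have h2 : s * t B e 1 = t B e 1 * s := by rw [t_conj', hs.se]
  have h3 : z B e f * t B e 1 = t B e 1 * z B e f := by
    rw [t_conj', (z_neg_iff hef e).2 (InW_e hef), ← neg_one_smul F e, t_smul_v]; norm_num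
  have o1 : s^(orderOf s) = 1 := pow_orderOf_eq_one s
  have o2 : (t B e 1)^p = 1 := by rw [t_pow]; simp [t_zero]
  have o3 : (z B e f)^2 = 1 := by rw [pow_two, z_sq hef]
  have hpq : p ∣ q^2 := by
    obtain ⟨n, -, hn⟩ := FiniteField.card F p
    rw [hn]; exact dvd_pow (dvd_pow_self p n.2.ne') (by norm_num)
  have hp2 : p.Coprime 2 := by
    rw [Nat.coprime_primes hp Nat.prime_two]
    rintro rfl
    exact hS.two (by exact_mod_cast CharP.cast_eq_zero F 2)
  have c1 : (orderOf s).Coprime p := by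
    rw [Nat.coprime_comm, hp.coprime_iff_not_dvd]
    intro hd
    have : p ∣ q^2+1 := by rw [← hs.ford]; exact dvd_mul_of_dvd_right hd 2
    exact hp.one_lt.ne' (Nat.dvd_one.1 ((Nat.dvd_add_right hpq).1 this))
  have c2 : (orderOf s).Coprime 2 := Nat.coprime_two_right.2 hs.odd
  have e1 : s * (t B e 1 * z B e f) = (t B e 1 * z B e f) * s := by
    rw [← mul_assoc, h2, mul_assoc, h1, mul_assoc]
  have o4 : (t B e 1 * z B e f)^(p*2) = 1 := by
    have : Commute (t B e 1) (z B e f) := h3.symm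
    rw [this.mul_pow, pow_mul, o2, one_pow, one_mul, mul_comm, pow_mul, o3, one_pow]
  have c3 := c1.mul_right c2
  have r1 := CR e1 o1 o4 c3
  have r2 := CR e1.symm o4 o1 c3.symm
  rw [← e1] at r2
  obtain ⟨i, hi⟩ := r2
  obtain ⟨j, hj⟩ := CR h3.symm o2 o3 hp2
  obtain ⟨k, hk⟩ := CR h3 o3 o2 hp2.symm
  rw [h3] at hk
  exact ⟨s * (t B e 1 * z B e f), r1, ⟨i*j, by rw [pow_mul, hi, hj]⟩, ⟨i*k, by rw [pow_mul, hi, hk]⟩⟩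

theorem exSm (B : V →ₗ[F] V →ₗ[F] F) [hS : Sy B] : ∃ (V' : Type) (_ : AddCommGroup V') (_ : Module F V') (_ : FiniteDimensional F V')
    (γ : V' →ₗ[F] V' →ₗ[F] F) (_ : Sy γ) (s E : Sp γ) (e f : V'), IsS s e f ∧ (∃ i, E^i = s) ∧ (∃ i, E^i = z γ e f) ∧
      ∀ x, x ≠ 0 → ¬ LI E x := by
  have h5 := q_five B
  have hqo := q_odd B
  obtain ⟨L, _, _, _, hfr, β, alt, nd, w, hw0, hw, hb⟩ := field_model hS.two (q_odd B) 2 (by norm_num)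
  obtain ⟨K, _, _, _, kfr, κ, kalt, knd, v, hv0, hv, kb⟩ := field_model hS.two (q_odd B) 1 (by norm_num)
  rw [pow_one] at hv
  let γ : (L × K) →ₗ[F] (L × K) →ₗ[F] F := β.compl₁₂ (LinearMap.fst F L K) (LinearMap.fst F L K) + κ.compl₁₂ (LinearMap.snd F L K) (LinearMap.snd F L K)
  have hγ : ∀ x y : L × K, γ x y = β x.1 y.1 + κ x.2 y.2 := fun x y => rfl
  have hSy : Sy γ := by
    refine ⟨?_, ?_, hS.two, hS.three, by simp [hfr, kfr]⟩
    · intro x; rw [hγ, alt, kalt, add_zero]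
    · intro x hx
      ext
      · exact nd _ fun y => by simpa [hγ] using hx (y, 0)
      · exact knd _ fun y => by simpa [hγ] using hx (0, y)
  have key : ∀ (a : L) (c : K), (∀ x y, β (a*x) (a*y) = β x y) → (∀ x y, κ (c*x) (c*y) = κ x y) →
      ∃ g : Sp γ, ∀ (k : ℕ) (x : L × K), g^k • x = (a^k * x.1, c^k * x.2) := by
    intro a c ha hc
    let W : (L × K) →ₗ[F] (L × K) := (LinearMap.mulLeft F a).prodMap (LinearMap.mulLeft F c)
    have hW : ∀ x : L × K, W x = (a * x.1, c * x.2) := fun x => rfl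
    have hWb : ∀ x y, γ (W x) (W y) = γ x y := by
      intro x y
      simp only [hγ, hW, ha, hc]
    refine ⟨mkS γ W hWb, fun k x => ?_⟩
    rw [mkS_pow]
    induction k generalizing x with
    | zero => simp
    | succ n ih => rw [pow_succ, Module.End.mul_apply, ih, hW]; ext <;> simp only <;> ring
  obtain ⟨s, hs⟩ := key (w^2) 1 (by intro x y; rw [pow_two, mul_assoc, mul_assoc, hb, hb]) (by intro x y; rw [one_mul, one_mul])
  obtain ⟨d, hd⟩ := key 1 v (by intro x y; rw [one_mul, one_mul]) kb
  obtain ⟨n, hn⟩ : ∃ n, q = 2*n+1 := ⟨q/2, by omega⟩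
  have hm : q^2+1 = 2*(2*(n^2+n)+1) := by rw [hn]; ring
  have hom : orderOf (w^2) = 2*(n^2+n)+1 := by
    rw [orderOf_pow_of_dvd (by norm_num) (by rw [hw, hm]; exact ⟨_, rfl⟩), hw, hm]; omega
  have hos : orderOf s = 2*(n^2+n)+1 := by
    rw [← hom]
    apply Nat.dvd_antisymm
    · apply orderOf_dvd_of_pow_eq_one
      exact sp_ext fun x => by rw [hs, pow_orderOf_eq_one]; simp
    · apply orderOf_dvd_of_pow_eq_one
      have := hs (orderOf s) (1, 0)
      rw [pow_orderOf_eq_one, one_smul] at this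
      simpa using (congrArg Prod.fst this).symm
  obtain ⟨e, f, hS1⟩ := exS (s := s) (by rw [hos, hm])
  have hd1 : d^(2*(n+1)) = 1 := sp_ext fun x => by
    rw [hd, show 2*(n+1) = orderOf v by rw [hv, hn]; ring, pow_orderOf_eq_one]; simp
  have hz : d^(n+1) = z γ e f := sp_ext fun x => by
    have hef := hS1.hef
    have g1 : ∀ y : K, z γ e f • ((0, y) : L × K) = - (0, y) := by
      intro y
      rw [z_neg_iff hef]
      refine hS1.fixpow (k := 1) (by rw [pow_one]; exact hS1.ne1) ?_
      rw [hs]; simp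
    have g3 : ∀ y : L × K, s • y = y → y.1 = 0 := by
      intro y hy
      by_contra h0
      have h1 := hs 1 y
      rw [pow_one, hy, pow_one] at h1
      have h2 : w^2 = 1 := mul_right_cancel₀ h0 (by rw [one_mul]; exact (congrArg Prod.fst h1).symm)
      rw [h2, orderOf_one] at hom
      have : n ≠ 0 := by rintro rfl; omega
      have : 0 < n^2 := by positivity
      omega
    have g2 : ∀ y : L, z γ e f • ((y, 0) : L × K) = (y, 0) := by
      intro y
      rw [z_fix_iff hef, hγ, hγ, g3 e hS1.se, g3 f hS1.sf]
      simp
    have : x = (x.1, 0) + (0, x.2) := by simp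
    rw [hd, half (by omega) (by rw [hv, hn]; ring : orderOf v = 2*(n+1)), this, smul_add, g1, g2]
    simp
  have hcm : s * d = d * s := sp_ext fun x => by
    have a1 := hs 1
    have a2 := hd 1
    simp only [pow_one] at a1 a2
    rw [mul_smul, mul_smul, a1, a2, a2, a1]; simp
  have hcop : (2*(n^2+n)+1).Coprime (2*(n+1)) := by
    rw [Nat.coprime_iff_gcd_eq_one] 
    have : 2*(n^2+n)+1 = 1 + n*(2*(n+1)) := by ring
    rw [this]; simp
  rw [hos.symm] at hcop
  have c1 := CR hcm (pow_orderOf_eq_one s) hd1 hcop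
  have c2 := CR hcm.symm hd1 (pow_orderOf_eq_one s) hcop.symm
  rw [← hcm] at c2
  refine ⟨L × K, inferInstance, inferInstance, inferInstance, γ, hSy, s, s*d, e, f, hS1, c1, ?_, ?_⟩
  · obtain ⟨i, hi⟩ := c2
    exact ⟨i*(n+1), by rw [pow_mul, hi, hz]⟩
  · intro x hx hL
    obtain ⟨c, hc⟩ := hL.of c1
    obtain ⟨c', hc'⟩ := hL.of c2
    have a1 := hs 1 x
    have a2 := hd 1 x
    rw [pow_one, hc, pow_one] at a1
    rw [pow_one, hc', pow_one, pow_one] at a2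
    apply hx
    ext
    · by_contra h0
      have := notF (pow_ne_zero 2 hw0) h0 (congrArg Prod.fst a1).symm
      rw [hom] at this
      have := Nat.le_of_dvd (by omega) this
      have : n ≤ n^2 := Nat.le_self_pow (by norm_num) n
      omega
    · by_contra h0
      have := notF hv0 h0 (congrArg Prod.snd a2).symm
      rw [hv] at this
      have := Nat.le_of_dvd (by omega) this
      omega
end base
end
end PSP

open Module
set_option linter.unusedSectionVars false
set_option linter.unusedVariables false
set_option linter.style.longLine false
set_option linter.unnecessarySimpa false
set_option linter.unusedSimpArgs false
namespace PSP
noncomputable section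
section base
variable {F : Type*} {V : Type*} [Field F] [Fintype F] [AddCommGroup V] [Module F V] [FiniteDimensional F V]
variable {B : V →ₗ[F] V →ₗ[F] F}
variable [hS : Sy B]

local notation "q" => Fintype.card F

theorem cen {g : Sp B} : g ∈ Subgroup.center (Sp B) ↔ g = 1 ∨ g = nu B := by
  rw [Subgroup.mem_center_iff]
  constructor
  · intro h
    have h1 : ∀ v : V, g • v = v ∨ g • v = -v := by
      intro v
      by_cases hv : v = 0
      · left; simp [hv]
      have h2 : t B v 1 = t B (g • v) 1 := by rw [← t_conj, ← h]; group
      obtain ⟨c, hc0, hc⟩ := t_eq hv one_ne_zero h2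
      rw [hc, t_smul_v] at h2
      have h3 : t B v (1 + -(c^2*1)) = 1 := by rw [← t_mul, ← t_inv, ← h2]; group
      have h4 := t_eq_one hv h3
      have h5 : c^2 = 1 := by linear_combination -h4
      rcases sq_eq_one_iff.1 h5 with rfl | rfl
      · left; simpa using hc
      · right; simpa using hc
    by_contra! hcon
    obtain ⟨x, hx⟩ : ∃ x : V, g • x ≠ x := by
      by_contra! h; exact hcon.1 (sp_ext fun x => by rw [h, one_smul])
    obtain ⟨y, hy⟩ : ∃ x : V, g • x ≠ -x := by
      by_contra! h; exact hcon.2 (sp_ext fun x => by rw [h, nu_smul])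
    have hx' := (h1 x).resolve_left hx
    have hy' := (h1 y).resolve_right hy
    rcases h1 (x + y) with h2 | h2 <;> rw [smul_add, hx', hy'] at h2
    · have := eq_zero_of_neg B (add_right_cancel h2).symm
      simp [this] at hx
    · rw [neg_add] at h2
      have := eq_zero_of_neg B (add_left_cancel h2)
      simp [this] at hy
  · rintro (rfl | rfl) h
    · simp
    · rw [nu_comm]

theorem B0J (x y : V0 F) : B0 F x y = - (x ⬝ᵥ (Matrix.J (Fin 3) F).mulVec y) := by
  rw [B0_apply]
  simp [Matrix.J, dotProduct, Fintype.sum_sum_type, Matrix.fromBlocks_mulVec, Matrix.neg_mulVec, Finset.sum_sub_distrib]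
  ring

theorem memJ (A : Matrix (Fin 3 ⊕ Fin 3) (Fin 3 ⊕ Fin 3) F) : A ∈ Matrix.symplecticGroup (Fin 3) F ↔
    ∀ x y, B0 F (A.mulVec x) (A.mulVec y) = B0 F x y := by
  have h1 : ∀ x y, B0 F (A.mulVec x) (A.mulVec y) = - (x ⬝ᵥ (A.transpose * Matrix.J (Fin 3) F * A).mulVec y) := by
    intro x y
    rw [B0J, ← Matrix.mulVec_mulVec, ← Matrix.mulVec_mulVec, Matrix.dotProduct_mulVec x, Matrix.vecMul_transpose]
  rw [SymplecticGroup.mem_iff']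
  constructor
  · intro h x y
    rw [h1, h, B0J]
  · intro h
    ext i j
    have := h (Pi.single i 1) (Pi.single j 1)
    rw [h1, B0J] at this
    simpa using this

def rho0 (T : V0 F ≃ₗ[F] V) (hT : ∀ x y, B (T x) (T y) = B0 F x y) : Sp B →* Matrix.symplecticGroup (Fin 3) F where
     toFun := fun g => ⟨LinearMap.toMatrix' (T.symm.toLinearMap ∘ₗ g.1.toLinearMap ∘ₗ T.toLinearMap), by
        rw [memJ]
        intro x y
        rw [LinearMap.toMatrix'_mulVec, LinearMap.toMatrix'_mulVec]
        simp [← hT, g.2 _ _]⟩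
     map_one' := by
        apply Subtype.ext
        refine Eq.trans ?_ LinearMap.toMatrix'_id
        show LinearMap.toMatrix' _ = LinearMap.toMatrix' _
        congr 1
        ext; simp
     map_mul' := by
        intro g h
        apply Subtype.ext
        show LinearMap.toMatrix' _ = LinearMap.toMatrix' _ * LinearMap.toMatrix' _
        rw [← LinearMap.toMatrix'_comp]
        congr 1
        ext; simp

def rho (T : V0 F ≃ₗ[F] V) (hT : ∀ x y, B (T x) (T y) = B0 F x y) : Sp B ≃* Matrix.symplecticGroup (Fin 3) F :=
  MulEquiv.ofBijective (rho0 T hT) (by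
    constructor
    · intro g h hgh
      have h1 := LinearMap.toMatrix'.injective (congrArg Subtype.val hgh)
      apply sp_ext
      intro x
      have h2 : g.1 x = h.1 x := by
        have := LinearMap.congr_fun h1 (T.symm x)
        simpa using this
      exact h2
    · intro A
      have hA := (memJ A.1).1 A.2
      refine ⟨mkS B (T.toLinearMap ∘ₗ Matrix.toLin' A.1 ∘ₗ T.symm.toLinearMap) ?_, ?_⟩
      · intro x y
        simp [hT, hA, ← hT (T.symm x)]
      · apply Subtype.ext
        show LinearMap.toMatrix' _ = _
        refine Eq.trans ?_ (LinearMap.toMatrix'_toLin' A.1)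
        congr 1
        apply LinearMap.ext
        intro x
        show T.symm (T (Matrix.toLin' A.1 (T.symm (T x)))) = _
        simp)

theorem exPrj (B : V →ₗ[F] V →ₗ[F] F) [hS : Sy B] : ∃ π : Sp B →* ProjSp 3 F, Prj π := by
  obtain ⟨T, hT⟩ := iso0 B
  refine ⟨(QuotientGroup.mk' _).comp (rho T hT).toMonoidHom, (QuotientGroup.mk'_surjective _).comp (rho T hT).surjective, ?_⟩
  intro g
  rw [← cen]
  show QuotientGroup.mk' _ (rho T hT g) = 1 ↔ _
  rw [QuotientGroup.mk'_apply, QuotientGroup.eq_one_iff, Subgroup.mem_center_iff, Subgroup.mem_center_iff]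
  constructor
  · intro h x
    apply (rho T hT).injective
    rw [map_mul, map_mul, h]
  · intro h x
    obtain ⟨x, rfl⟩ := (rho T hT).surjective x
    rw [← map_mul, ← map_mul, h]
end base
end
end PSP

theorem gammaW_PSp6_ge_three (p f q : ℕ) (hp : p.Prime) (hpodd : Odd p) (hp3 : p ≠ 3)
    (hf : 0 < f) (hq : q = p ^ f)
    (F : Type*) [Field F] [Fintype F] (hF : Fintype.card F = q)
    (H K : Subgroup (ProjSp 3 F)) (hH : H ≠ ⊤) (hK : K ≠ ⊤) :
    ∃ g : ProjSp 3 F, ∀ φ : ProjSp 3 F ≃* ProjSp 3 F, φ g ∉ H ∧ φ g ∉ K := by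
  have : Fact p.Prime := ⟨hp⟩
  have hch : CharP F p := by
    obtain ⟨r, hr⟩ := CharP.exists F
    obtain ⟨n, hr1, hn⟩ := FiniteField.card F r
    have : r ∣ p^f := by rw [← hq, ← hF, hn]; exact dvd_pow_self r n.2.ne'
    have := (Nat.prime_dvd_prime_iff_eq hr1 hp).1 (hr1.dvd_of_dvd_pow this)
    rwa [← this]
  have hne : ∀ l : ℕ, l.Prime → p ≠ l → (l : F) ≠ 0 := by
    intro l hl hpl h
    rw [CharP.cast_eq_zero_iff F p, Nat.prime_dvd_prime_iff_eq hp hl] at h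
    exact hpl h
  have h2 : (2:F) ≠ 0 := by exact_mod_cast hne 2 Nat.prime_two (by rintro rfl; revert hpodd; decide)
  have h3 : (3:F) ≠ 0 := by exact_mod_cast hne 3 Nat.prime_three hp3
  have hS0 := PSP.Sy0 h2 h3
  obtain ⟨V, _, _, _, B, hS, s, E, e, f', hs, E1, E2, E3⟩ := PSP.exSm (PSP.B0 F)
  obtain ⟨b, b1, b2, b3⟩ := PSP.exb hp hs
  obtain ⟨a, N, hN, ha⟩ := PSP.exA B
  obtain ⟨c, M, hM, hc⟩ := PSP.exC B
  obtain ⟨D, y, D1, D2, y1, y2, y3⟩ := PSP.exD hp B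
  obtain ⟨u, u1, u2, u3⟩ := PSP.exU hp B
  obtain ⟨π, hπ⟩ := PSP.exPrj B
  exact PSP.MAIN hπ hp hpodd ⟨hN, ha, hM, hc, hs, b1, b2, b3, E1, E2, E3, D1, D2, y1, y2, y3, u1, u2, u3⟩ H K hH hK
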